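/- Fix ν ∈ (0,1) and α ∈ (0, 1−ν). There exists a sequence (a_n)_{n≥1} of real numbers with 0 ≤ a_n ≤ 2 which satisfies condition R(ν), satisfies Hooley's averaged parity condition — for every B > 0 there is a constant C_B with ∑_{d≤x^α} |∑_{n≤x, d|n} μ(n) a_n| ≤ C_B · x·(log x)^{−B} for all x ≥ 2 — and such that for every integer k ≥ 1 the asymptotic formula S_k(x) ~ k·x·(log x)^{k−1} as x → ∞ fails. -/

import Mathlib

open Finset Filter

/-- The generalized von Mangoldt function `Λ_k(n) = ∑_{d ∣ n} μ(d) (log (n/d))^k`. -/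
noncomputable def Lambdak (k : ℕ) (n : ℕ) : ℝ :=
  ∑ d ∈ n.divisors, (ArithmeticFunction.moebius d : ℝ) * (Real.log ((n : ℝ) / (d : ℝ))) ^ k

/-- `S_k(x) = ∑_{n ≤ x} a_n Λ_k(n)`. -/
noncomputable def Ssum (a : ℕ → ℝ) (k : ℕ) (x : ℝ) : ℝ :=
  ∑ n ∈ Finset.Icc 1 ⌊x⌋₊, a n * Lambdak k n

/-- `T_k(x) = S_k(x)/(k x (log x)^{k−1})`. -/
noncomputable def Tquot (a : ℕ → ℝ) (k : ℕ) (x : ℝ) : ℝ :=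
  Ssum a k x / (k * x * Real.log x ^ (k - 1))

/-- Condition `R(ν)`: for every `B > 0` there is `C_B` with
`∑_{d ≤ x^ν} |∑_{n ≤ x, d ∣ n} a_n − x/d| ≤ C_B · x (log x)^{−B}` for all `x ≥ 2`. -/
noncomputable def Rcond (ν : ℝ) (a : ℕ → ℝ) : Prop :=
  ∀ B : ℝ, 0 < B → ∃ C : ℝ, ∀ x : ℝ, 2 ≤ x →
    ∑ d ∈ Finset.Icc 1 ⌊x ^ ν⌋₊,
      |(∑ n ∈ (Finset.Icc 1 ⌊x⌋₊).filter (fun n => d ∣ n), a n) - x / d|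
      ≤ C * x * Real.log x ^ (-B)

noncomputable def vv (n : ℕ) (s : ℂ) : ℂ :=
  (s - 1) * ((n + 1 : ℝ) : ℂ) ^ (-s) + ((n + 1 + 1 : ℝ) : ℂ) ^ (1 - s) - ((n + 1 : ℝ) : ℂ) ^ (1 - s)

noncomputable def WW (s : ℂ) : ℂ := 1 + ∑' n, vv n s

lemma hasDeriv_cpow_real (u : ℝ) (hu : 0 < u) (c : ℂ) :
    HasDerivAt (fun x : ℝ => (x : ℂ) ^ c) (c * (u : ℂ) ^ (c - 1)) u := by
  have h1 : HasDerivAt (fun z : ℂ => z ^ c) (c * (u : ℂ) ^ (c - 1) * 1) (u : ℂ) :=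
    (hasDerivAt_id (u : ℂ)).cpow_const (Or.inl (by simpa using hu))
  have := h1.comp_ofReal
  simpa using this

lemma cpow_diff_bound (a u : ℝ) (ha : 0 < a) (hau : a ≤ u) (hu : u ≤ a + 1) (s : ℂ) (hs : 0 < s.re) :
    ‖(u : ℂ) ^ (-s) - (a : ℂ) ^ (-s)‖ ≤ ‖s‖ * a ^ (-s.re - 1) := by
  have := Convex.norm_image_sub_le_of_norm_hasDerivWithin_le (s := Set.Icc a (a+1)) (x := a) (y := u)
    (f := fun x : ℝ => (x : ℂ) ^ (-s)) (f' := fun x => (-s) * (x : ℂ) ^ (-s - 1))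
    (C := ‖s‖ * a ^ (-s.re - 1))
    (fun x hx => (hasDeriv_cpow_real x (by linarith [hx.1]) (-s)).hasDerivWithinAt)
    (fun x hx => by
      have hx0 : 0 < x := by linarith [hx.1]
      rw [norm_mul, norm_neg, Complex.norm_cpow_eq_rpow_re_of_pos hx0]
      gcongr
      simp only [Complex.sub_re, Complex.neg_re, Complex.one_re]
      exact Real.rpow_le_rpow_of_nonpos ha hx.1 (by linarith))
    (convex_Icc _ _) (by simp) ⟨hau, hu⟩
  refine this.trans ?_
  have h1 : ‖u - a‖ ≤ 1 := by rw [Real.norm_eq_abs, abs_le]; constructor <;> linarith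
  exact mul_le_of_le_one_right (by positivity) h1

lemma vv_bound (n : ℕ) (s : ℂ) (hs : 0 < s.re) :
    ‖vv n s‖ ≤ ‖s - 1‖ * ‖s‖ * (n + 1 : ℝ) ^ (-s.re - 1) := by
  have ha : (0 : ℝ) < n + 1 := by positivity
  set a : ℝ := n + 1 with hadef
  have := Convex.norm_image_sub_le_of_norm_hasDerivWithin_le (s := Set.Icc a (a+1)) (x := a) (y := a + 1)
    (f := fun x : ℝ => (s - 1) * (a : ℂ) ^ (-s) * (x : ℂ) + (x : ℂ) ^ (1 - s))
    (f' := fun x => (s - 1) * (a : ℂ) ^ (-s) * 1 + (1 - s) * (x : ℂ) ^ (1 - s - 1))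
    (C := ‖s - 1‖ * (‖s‖ * a ^ (-s.re - 1)))
    (fun x hx => ((((hasDerivAt_id (x : ℂ)).comp_ofReal).const_mul _).add (hasDeriv_cpow_real x (by linarith [hx.1]) (1-s))).hasDerivWithinAt)
    (fun x hx => by
      have e : (s - 1) * (a : ℂ) ^ (-s) * 1 + (1 - s) * (x : ℂ) ^ (1 - s - 1) =
        -((s - 1) * ((x : ℂ) ^ (-s) - (a : ℂ) ^ (-s))) := by
        rw [show (1 - s - 1 : ℂ) = -s by ring]; ring
      rw [e, norm_neg, norm_mul]
      gcongr
      exact cpow_diff_bound a x ha hx.1 hx.2 s hs)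
    (convex_Icc _ _) (by simp) (by simp)
  have e2 : vv n s = ((s - 1) * (a : ℂ) ^ (-s) * ((a + 1 : ℝ) : ℂ) + ((a + 1 : ℝ) : ℂ) ^ (1 - s))
     - ((s - 1) * (a : ℂ) ^ (-s) * (a : ℂ) + (a : ℂ) ^ (1 - s)) := by
    simp only [vv, ← hadef]; push_cast; ring
  rw [e2]
  refine this.trans (le_of_eq ?_)
  simp; ring

lemma vv_diff (n : ℕ) : Differentiable ℂ (vv n) := by
  have ha : ((n + 1 : ℝ) : ℂ) ≠ 0 := by exact_mod_cast (by positivity : (0:ℝ) < n + 1).ne'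
  have hb : ((n + 1 + 1 : ℝ) : ℂ) ≠ 0 := by exact_mod_cast (by positivity : (0:ℝ) < n + 1 + 1).ne'
  intro s
  unfold vv
  refine (((differentiableAt_id.sub_const 1).mul (DifferentiableAt.const_cpow (differentiableAt_id.neg) (Or.inl ha))).add
    (DifferentiableAt.const_cpow (differentiableAt_id.const_sub 1) (Or.inl hb))).sub
    (DifferentiableAt.const_cpow (differentiableAt_id.const_sub 1) (Or.inl ha))

lemma summable_34 : Summable (fun n : ℕ => (n + 1 : ℝ) ^ (-(3/2) : ℝ)) := by
  have := (summable_nat_add_iff 1).2 (Real.summable_nat_rpow.2 (by norm_num : (-(3/2) : ℝ) < -1))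
  simpa using this

lemma vv_bound' (n : ℕ) (s : ℂ) (hs : 1/2 < s.re) :
    ‖vv n s‖ ≤ ‖s - 1‖ * ‖s‖ * (n + 1 : ℝ) ^ (-(3/2) : ℝ) := by
  refine (vv_bound n s (by linarith)).trans ?_
  gcongr
  · have : (0:ℝ) ≤ n := by positivity
    linarith
  · linarith

lemma vv_summable (s : ℂ) (hs : 1/2 < s.re) : Summable (fun n => vv n s) :=
  Summable.of_norm_bounded (summable_34.mul_left _) (fun n => vv_bound' n s hs)

lemma WW_diff (s : ℂ) (hs : 1/2 < s.re) : DifferentiableAt ℂ WW s := by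
  set R := ‖s‖ + 1
  have hopen : IsOpen ({z : ℂ | 1/2 < z.re} ∩ Metric.ball 0 R) :=
    (isOpen_lt continuous_const Complex.continuous_re).inter Metric.isOpen_ball
  have := Complex.differentiableOn_tsum_of_summable_norm (F := vv) (u := fun n : ℕ => ((R + 1) * R) * (n + 1 : ℝ) ^ (-(3/2) : ℝ))
    (U := {z : ℂ | 1/2 < z.re} ∩ Metric.ball 0 R)
    (summable_34.mul_left _) (fun n => (vv_diff n).differentiableOn) hopen
    (fun n w hw => by
      refine (vv_bound' n w hw.1).trans ?_
      have h2 : ‖w‖ ≤ R := (mem_ball_zero_iff.1 hw.2).le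
      have h1 : ‖w - 1‖ ≤ R + 1 := (norm_sub_le _ _).trans (by simpa using h2)
      gcongr)
  exact ((this s ⟨hs, by simp [R]⟩).differentiableAt (hopen.mem_nhds ⟨hs, by simp [R]⟩)).const_add 1

lemma WW_one : WW 1 = 1 := by
  have : ∀ n, vv n 1 = 0 := fun n => by simp [vv]
  simp [WW, this]

lemma WW_eq (s : ℂ) (hs : 1 < s.re) : WW s = (s - 1) * riemannZeta s := by
  have h1 : HasSum (fun n : ℕ => ((n + 1 : ℝ) : ℂ) ^ (-s)) (riemannZeta s) := by
    rw [zeta_eq_tsum_one_div_nat_add_one_cpow hs]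
    have e : (fun n : ℕ => ((n + 1 : ℝ) : ℂ) ^ (-s)) = fun n : ℕ => 1 / (n + 1 : ℂ) ^ s := by
      ext n; rw [Complex.cpow_neg]; push_cast; simp
    rw [e]
    have := (summable_nat_add_iff 1).2 (Complex.summable_one_div_nat_cpow.2 hs)
    exact Summable.hasSum (by simpa using this)
  have h2 : HasSum (fun n : ℕ => ((n + 1 + 1 : ℝ) : ℂ) ^ (1 - s) - ((n + 1 : ℝ) : ℂ) ^ (1 - s)) (0 - 1) := by
    have hs' : Summable (fun n : ℕ => ((n + 1 + 1 : ℝ) : ℂ) ^ (1 - s) - ((n + 1 : ℝ) : ℂ) ^ (1 - s)) := by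
      have := (vv_summable s (by linarith)).sub (h1.summable.mul_left (s - 1))
      refine this.congr (fun n => ?_)
      simp only [vv]; ring
    refine (hs'.hasSum_iff_tendsto_nat).2 ?_
    have e : ∀ N : ℕ, ∑ n ∈ range N, (((n + 1 + 1 : ℝ) : ℂ) ^ (1 - s) - ((n + 1 : ℝ) : ℂ) ^ (1 - s)) =
        ((N + 1 : ℝ) : ℂ) ^ (1 - s) - 1 := by
      intro N
      have := Finset.sum_range_sub (fun n : ℕ => ((n + 1 : ℝ) : ℂ) ^ (1 - s)) N
      simpa using this
    simp_rw [e]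
    refine Tendsto.sub_const ?_ 1
    rw [tendsto_zero_iff_norm_tendsto_zero]
    have : ∀ N : ℕ, ‖((N + 1 : ℝ) : ℂ) ^ (1 - s)‖ = (N + 1 : ℝ) ^ (-(s.re - 1)) := fun N => by
      rw [Complex.norm_cpow_eq_rpow_re_of_pos (by positivity)]; simp
    simp_rw [this]
    exact (tendsto_rpow_neg_atTop (by linarith)).comp
      (tendsto_natCast_atTop_atTop.atTop_add tendsto_const_nhds)
  have h3 := ((h1.mul_left (s - 1)).add h2).tsum_eq
  have : WW s = 1 + ∑' n : ℕ, ((s - 1) * ((n + 1 : ℝ) : ℂ) ^ (-s) + (((n + 1 + 1 : ℝ) : ℂ) ^ (1 - s) - ((n + 1 : ℝ) : ℂ) ^ (1 - s))) := by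
    unfold WW; congr 2; ext n; simp only [vv]; ring
  rw [this, h3]; ring

lemma WW_ne (s : ℂ) (hs : 1 ≤ s.re) : WW s ≠ 0 := by
  by_cases h1 : s = 1
  · subst h1; simp [WW_one]
  have hlim : WW s = (s - 1) * riemannZeta s := by
    have c1 : Tendsto (fun x : ℝ => WW (s + x)) (nhdsWithin 0 (Set.Ioi 0)) (nhds (WW s)) := by
      have : Tendsto (fun x : ℝ => s + (x:ℂ)) (nhdsWithin 0 (Set.Ioi 0)) (nhds s) := by
        have : Continuous (fun x : ℝ => s + (x:ℂ)) := by fun_prop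
        simpa using (this.tendsto 0).mono_left nhdsWithin_le_nhds
      exact (WW_diff s (by linarith)).continuousAt.tendsto.comp this
    have c2 : Tendsto (fun x : ℝ => (s + x - 1) * riemannZeta (s + x)) (nhdsWithin 0 (Set.Ioi 0)) (nhds ((s - 1) * riemannZeta s)) := by
      have : Tendsto (fun x : ℝ => s + (x:ℂ)) (nhdsWithin 0 (Set.Ioi 0)) (nhds s) := by
        have : Continuous (fun x : ℝ => s + (x:ℂ)) := by fun_prop
        simpa using (this.tendsto 0).mono_left nhdsWithin_le_nhds
      exact (this.sub_const 1).mul ((differentiableAt_riemannZeta h1).continuousAt.tendsto.comp this)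
    refine tendsto_nhds_unique (c1.congr' ?_) c2
    filter_upwards [self_mem_nhdsWithin] with x hx
    exact WW_eq _ (by simp; linarith [Set.mem_Ioi.1 hx])
  rw [hlim]
  exact mul_ne_zero (sub_ne_zero.2 h1) (riemannZeta_ne_zero_of_one_le_re hs)

noncomputable def ell (t : ℝ) : ℝ := Real.log (|t| + 4)

lemma ell_ge (t : ℝ) : 1 ≤ ell t := by
  rw [ell, Real.le_log_iff_exp_le (by positivity)]
  linarith [Real.exp_one_lt_d9, abs_nonneg t]

lemma norm_le_of_re (s : ℂ) (h0 : 0 ≤ s.re) (h : s.re ≤ 4) : ‖s‖ ≤ |s.im| + 4 ∧ ‖s - 1‖ ≤ |s.im| + 4 := by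
  constructor
  · refine (Complex.norm_le_abs_re_add_abs_im s).trans ?_
    rw [abs_of_nonneg h0]; linarith
  · refine (Complex.norm_le_abs_re_add_abs_im _).trans ?_
    simp only [Complex.sub_re, Complex.one_re, Complex.sub_im, Complex.one_im, sub_zero]
    have : |s.re - 1| ≤ 4 := abs_le.2 ⟨by linarith, by linarith⟩
    linarith

lemma vv_sum (N : ℕ) (s : ℂ) : ∑ n ∈ range N, vv n s =
    (s - 1) * ∑ n ∈ range N, ((n + 1 : ℝ) : ℂ) ^ (-s) + ((N + 1 : ℝ) : ℂ) ^ (1 - s) - 1 := by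
  have := Finset.sum_range_sub (fun n : ℕ => ((n + 1 : ℝ) : ℂ) ^ (1 - s)) N
  simp only [Nat.cast_zero, zero_add, Complex.ofReal_one, Complex.one_cpow] at this
  rw [add_sub_assoc, ← this, mul_sum, ← sum_add_distrib]
  refine sum_congr rfl fun n _ => ?_
  simp only [vv]; push_cast; ring

lemma WW_bound : ∃ C : ℝ, 0 < C ∧ ∀ s : ℂ, 1 - 1 / (4 * ell s.im) ≤ s.re → s.re ≤ 4 →
    ‖WW s‖ ≤ C * ((|s.im| + 4) * ell s.im) := by
  set Z := ∑' n : ℕ, (n + 1 : ℝ) ^ (-(3/2) : ℝ) with hZ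
  have hZ0 : 0 ≤ Z := tsum_nonneg fun n => by positivity
  refine ⟨6 * Real.exp 2 + Real.exp 2 + Z, by positivity, fun s h1 h2 => ?_⟩
  have hl := ell_ge s.im
  set l := ell s.im with hldef
  set τ := |s.im| + 4 with hτ
  have hτ4 : 4 ≤ τ := by linarith [abs_nonneg s.im]
  have hinv : 1 / (4 * l) ≤ 1 / 4 := by
    apply one_div_le_one_div_of_le <;> linarith
  have hσ : 3/4 ≤ s.re := by linarith
  obtain ⟨hn1, hn2⟩ := norm_le_of_re s (by linarith) h2
  rw [← hτ] at hn1 hn2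
  set N := ⌈τ ^ 4⌉₊ with hN
  have hNle : (N : ℝ) + 1 ≤ τ ^ 5 := by
    have := Nat.ceil_lt_add_one (show 0 ≤ τ ^ 4 by positivity)
    have h3 : (4:ℝ)^4 ≤ τ ^ 4 := by gcongr
    nlinarith
  have hlogm : ∀ m : ℝ, 1 ≤ m → m ≤ N + 1 → m ^ (1 - s.re) ≤ Real.exp 2 := by
    intro m hm1 hm2
    rw [Real.rpow_def_of_pos (by linarith)]
    apply Real.exp_le_exp.2
    have h5 : Real.log m ≤ 5 * l := by
      calc Real.log m ≤ Real.log (τ ^ 5) := Real.log_le_log (by linarith) (by linarith)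
        _ = 5 * l := by rw [Real.log_pow]; simp [hldef, ell, hτ]
    have h6 : 0 ≤ Real.log m := Real.log_nonneg hm1
    by_cases h7 : 0 ≤ 1 - s.re
    · calc Real.log m * (1 - s.re) ≤ 5 * l * (1 / (4 * l)) := by gcongr; linarith
        _ = 5 / 4 := by field_simp
        _ ≤ 2 := by norm_num
    · nlinarith
  have hτ1 : 1 ≤ τ := by linarith
  have htail : ‖∑' n, vv (n + N) s‖ ≤ Z * τ := by
    have hb : ∀ n : ℕ, ‖vv (n + N) s‖ ≤ τ * (n + 1 : ℝ) ^ (-(3/2) : ℝ) := by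
      intro n
      refine (vv_bound (n + N) s (by linarith)).trans ?_
      have hm : τ ^ 4 ≤ ((n + N : ℕ) : ℝ) + 1 := by
        have := Nat.le_ceil (τ ^ 4); push_cast
        have : (0:ℝ) ≤ n := by positivity
        linarith
      have hn0 : (0:ℝ) ≤ n := by positivity
      set m : ℝ := ((n + N : ℕ) : ℝ) + 1 with hmdef
      have hmn : (n : ℝ) + 1 ≤ m := by
        rw [hmdef]; push_cast
        have : (0:ℝ) ≤ N := by positivity
        linarith
      have hm0 : 0 < m := by linarith
      have e : m ^ (-s.re - 1) = m ^ (-(s.re - 1/2)) * m ^ (-(3/2) : ℝ) := by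
        rw [← Real.rpow_add hm0]; congr 1; ring
      have h8 : m ^ (-(s.re - 1/2)) ≤ τ⁻¹ := by
        calc m ^ (-(s.re - 1/2)) ≤ m ^ (-(1/4) : ℝ) := by
              apply Real.rpow_le_rpow_of_exponent_le <;> linarith
          _ ≤ (τ ^ 4) ^ (-(1/4) : ℝ) := Real.rpow_le_rpow_of_nonpos (by positivity) hm (by norm_num)
          _ = τ⁻¹ := by
              rw [← Real.rpow_natCast, ← Real.rpow_mul (by linarith), ← Real.rpow_neg_one]; norm_num
      have h9 : m ^ (-(3/2) : ℝ) ≤ (n + 1 : ℝ) ^ (-(3/2) : ℝ) :=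
        Real.rpow_le_rpow_of_nonpos (by positivity) hmn (by norm_num)
      rw [e]
      calc ‖s - 1‖ * ‖s‖ * (m ^ (-(s.re - 1/2)) * m ^ (-(3/2) : ℝ)) ≤ τ * τ * (τ⁻¹ * (n + 1 : ℝ) ^ (-(3/2) : ℝ)) := by gcongr
        _ = τ * (n + 1 : ℝ) ^ (-(3/2) : ℝ) := by field_simp
    calc _ ≤ ∑' n : ℕ, τ * (n + 1 : ℝ) ^ (-(3/2) : ℝ) := tsum_of_norm_bounded (summable_34.mul_left _).hasSum hb
      _ = Z * τ := by rw [tsum_mul_left, mul_comm]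
  have hW : WW s = (s - 1) * ∑ n ∈ range N, ((n + 1 : ℝ) : ℂ) ^ (-s) + ((N + 1 : ℝ) : ℂ) ^ (1 - s) + ∑' n, vv (n + N) s := by
    rw [WW, ← (vv_summable s (by linarith)).sum_add_tsum_nat_add N, vv_sum]; ring
  have hsum : ‖∑ n ∈ range N, ((n + 1 : ℝ) : ℂ) ^ (-s)‖ ≤ Real.exp 2 * (6 * l) := by
    have hN1 : 1 ≤ N := Nat.one_le_iff_ne_zero.2 (by positivity)
    calc _ ≤ ∑ n ∈ range N, Real.exp 2 * ((n + 1 : ℝ)⁻¹) := by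
          refine norm_sum_le_of_le _ fun n hn => ?_
          rw [Complex.norm_cpow_eq_rpow_re_of_pos (by positivity)]
          have e : (n + 1 : ℝ) ^ (-s).re = (n + 1 : ℝ) ^ (1 - s.re) * (n + 1 : ℝ)⁻¹ := by
            rw [← Real.rpow_neg_one, ← Real.rpow_add (by positivity)]; congr 1; simp only [Complex.neg_re]; ring
          rw [e]
          gcongr
          refine hlogm _ (by linarith [(by positivity : (0:ℝ) ≤ n)]) ?_
          have := Finset.mem_range.1 hn
          have : (n : ℝ) ≤ N := by exact_mod_cast this.le
          linarith
      _ = Real.exp 2 * (harmonic N : ℝ) := by rw [← mul_sum]; simp [harmonic]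
      _ ≤ Real.exp 2 * (6 * l) := by
          gcongr
          have h3 := harmonic_le_one_add_log N
          have h4 : Real.log N ≤ 5 * l := by
            calc Real.log N ≤ Real.log (τ ^ 5) := Real.log_le_log (by exact_mod_cast hN1) (by linarith)
              _ = 5 * l := by rw [Real.log_pow]; simp [hldef, ell, hτ]
          linarith
  have h10 : ‖((N + 1 : ℝ) : ℂ) ^ (1 - s)‖ ≤ Real.exp 2 := by
    rw [Complex.norm_cpow_eq_rpow_re_of_pos (by positivity)]
    simp only [Complex.sub_re, Complex.one_re]
    exact hlogm _ (by linarith [(by positivity : (0:ℝ) ≤ N)]) le_rfl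
  rw [hW]
  have hτl : 1 ≤ τ * l := by nlinarith
  have hτl2 : τ ≤ τ * l := by nlinarith
  calc _ ≤ ‖s - 1‖ * ‖∑ n ∈ range N, ((n + 1 : ℝ) : ℂ) ^ (-s)‖ + ‖((N + 1 : ℝ) : ℂ) ^ (1 - s)‖ + ‖∑' n, vv (n + N) s‖ := by
        rw [← norm_mul]; exact norm_add₃_le
    _ ≤ τ * (Real.exp 2 * (6 * l)) + Real.exp 2 * (τ * l) + Z * (τ * l) := by
        gcongr
        · exact h10.trans (le_mul_of_one_le_right (by positivity) hτl)
        · exact htail.trans (by gcongr)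
    _ = _ := by ring

lemma ell_near (t t' : ℝ) (h : |t' - t| ≤ 1) : ell t' ≤ 2 * ell t ∧ |t'| + 4 ≤ 2 * (|t| + 4) := by
  have h1 : |t'| ≤ |t| + 1 := by
    have := abs_add_le (t' - t) t
    rw [sub_add_cancel] at this; linarith
  have h0 := abs_nonneg t
  refine ⟨?_, by linarith⟩
  have : 2 * ell t = Real.log ((|t| + 4) ^ 2) := by rw [Real.log_pow, ell]; norm_num
  rw [this]
  exact Real.log_le_log (by positivity) (by nlinarith)

lemma ball_near {s w : ℂ} {r : ℝ} (hr : r ≤ 1) (hw : w ∈ Metric.closedBall s r) :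
    ell w.im ≤ 2 * ell s.im ∧ |w.im| + 4 ≤ 2 * (|s.im| + 4) ∧ s.re - r ≤ w.re ∧ w.re ≤ s.re + r := by
  have h := mem_closedBall_iff_norm.1 hw
  have h1 := (Complex.abs_im_le_norm (w - s)).trans h
  have h2 := abs_le.1 ((Complex.abs_re_le_norm (w - s)).trans h)
  simp only [Complex.sub_im, Complex.sub_re] at h1 h2
  obtain ⟨h3, h4⟩ := ell_near s.im w.im (h1.trans hr)
  exact ⟨h3, h4, by linarith, by linarith⟩

lemma WW_deriv_bound : ∃ C : ℝ, 0 < C ∧ ∀ s : ℂ, 1 - 1 / (16 * ell s.im) ≤ s.re → s.re ≤ 3 →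
    ‖deriv WW s‖ ≤ C * ((|s.im| + 4) * ell s.im ^ 2) := by
  obtain ⟨C, hC, hb⟩ := WW_bound
  refine ⟨64 * C, by positivity, fun s h1 h2 => ?_⟩
  have hl := ell_ge s.im
  set l := ell s.im
  have hr0 : 0 < 1 / (16 * l) := by positivity
  have hr1 : 1 / (16 * l) ≤ 1 / 16 := one_div_le_one_div_of_le (by norm_num) (by linarith)
  have key : ∀ w ∈ Metric.closedBall s (1 / (16 * l)), 1 - 1 / (4 * ell w.im) ≤ w.re ∧ w.re ≤ 4 ∧
      (|w.im| + 4) * ell w.im ≤ 4 * ((|s.im| + 4) * l) := by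
    intro w hw
    obtain ⟨a1, a2, a3, a4⟩ := ball_near (by linarith) hw
    have hlw := ell_ge w.im
    refine ⟨?_, by linarith, ?_⟩
    · have : 1 / (8 * l) ≤ 1 / (4 * ell w.im) := one_div_le_one_div_of_le (by positivity) (by linarith)
      have e : 1 / (8 * l) = 2 * (1 / (16 * l)) := by field_simp; norm_num
      linarith
    · calc _ ≤ (2 * (|s.im| + 4)) * (2 * l) := by gcongr
        _ = _ := by ring
  have := Complex.norm_deriv_le_of_forall_mem_sphere_norm_le (f := WW) (c := s) (R := 1 / (16 * l))
    (C := C * (4 * ((|s.im| + 4) * l))) hr0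
    (DifferentiableOn.diffContOnCl (fun w hw => by
      rw [closure_ball _ hr0.ne'] at hw
      have h := (key w hw).1
      have : 1 / (4 * ell w.im) ≤ 1 / 4 := one_div_le_one_div_of_le (by norm_num) (by linarith [ell_ge w.im])
      exact (WW_diff w (by linarith)).differentiableWithinAt))
    (fun w hw => by
      obtain ⟨k1, k2, k3⟩ := key w (Metric.sphere_subset_closedBall hw)
      exact (hb w k1 k2).trans (by gcongr))
  refine this.trans (le_of_eq ?_)
  field_simp; ring

lemma zeta_341 (σ t : ℝ) (hσ : 1 < σ) :
    1 ≤ ‖riemannZeta σ‖ ^ 3 * ‖riemannZeta (σ + t * Complex.I)‖ ^ 4 * ‖riemannZeta (σ + (2 * t : ℝ) * Complex.I)‖ := by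
  have h := DirichletCharacter.norm_LSeries_product_ge_one (N := 1) 1 (x := σ - 1) (by linarith) t
  have e : ∀ (χ : DirichletCharacter ℂ 1) (s : ℂ), 1 < s.re → LSeries (fun n => χ n) s = riemannZeta s := by
    intro χ s hs
    rw [← DirichletCharacter.LFunction_eq_LSeries χ hs, Subsingleton.elim χ 1, DirichletCharacter.LFunction_modOne_eq]
  have e1 : (1 : ℂ) + ((σ - 1 : ℝ) : ℂ) = σ := by push_cast; ring
  rw [e1] at h
  rw [e _ _ (by simpa using hσ), e _ _ (by simpa using hσ), e _ _ (by simpa using hσ)] at h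
  rw [norm_mul, norm_mul, norm_pow, norm_pow] at h
  convert h using 4
  · ring_nf
  · push_cast; ring

lemma WW_lower1 : ∃ c : ℝ, 0 < c ∧ ∀ s : ℂ, 1 < s.re → s.re ≤ 3 → 1 ≤ |s.im| →
    c * (s.re - 1) ^ 3 / ell s.im ≤ (‖WW s‖ / (|s.im| + 4)) ^ 4 := by
  obtain ⟨C, hC, hb⟩ := WW_bound
  set A := C * (4 * ell 0) with hA
  have hl0 := ell_ge 0
  have hA0 : 0 < A := by positivity
  refine ⟨1 / (A ^ 3 * 5 ^ 4 * (6 * C)), by positivity, fun s h1 h2 h3 => ?_⟩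
  have hl := ell_ge s.im
  set σ := s.re
  set t := s.im
  set l := ell t
  have hs : s = σ + t * Complex.I := (Complex.re_add_im s).symm
  have h := zeta_341 σ t h1
  have hpos : ∀ u : ℝ, 1 - 1 / (4 * ell u) ≤ σ := fun u => by
    have := ell_ge u
    have : 0 < 1 / (4 * ell u) := by positivity
    linarith
  have b1 : ‖riemannZeta σ‖ ≤ A / (σ - 1) := by
    have e := WW_eq (σ : ℂ) (by simpa using h1)
    have := hb σ (by simpa using hpos 0) (by simp; linarith)
    rw [e, norm_mul] at this
    have e2 : ‖(σ : ℂ) - 1‖ = σ - 1 := by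
      rw [← Complex.ofReal_one, ← Complex.ofReal_sub, Complex.norm_real, Real.norm_of_nonneg (by linarith)]
    rw [e2] at this
    rw [le_div_iff₀ (by linarith), mul_comm]
    simpa [hA] using this
  have gen : ∀ u : ℝ, 1 ≤ |u| → ‖WW (σ + u * Complex.I)‖ ≥ |u| * ‖riemannZeta (σ + u * Complex.I)‖ := by
    intro u hu
    rw [WW_eq _ (by simpa using h1), norm_mul]
    gcongr
    have := Complex.abs_im_le_norm ((σ:ℂ) + u * Complex.I - 1)
    simpa using this
  have b2 : ‖riemannZeta (σ + t * Complex.I)‖ ≤ 5 * (‖WW s‖ / (|t| + 4)) := by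
    have g := gen t h3
    rw [← hs] at g ⊢
    rw [mul_div_assoc', le_div_iff₀ (by positivity)]
    have : |t| + 4 ≤ 5 * |t| := by linarith
    calc _ ≤ ‖riemannZeta s‖ * (5 * |t|) := by gcongr
      _ ≤ _ := by linarith
  have b3 : ‖riemannZeta (σ + (2 * t : ℝ) * Complex.I)‖ ≤ 6 * C * l := by
    have h2t : |2 * t| = 2 * |t| := by rw [abs_mul]; norm_num
    have g := gen (2 * t) (by rw [h2t]; linarith)
    have hbb := hb (σ + (2 * t : ℝ) * Complex.I) (by simpa using hpos (2 * t)) (by simp; linarith)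
    have im2 : ((σ:ℂ) + (2 * t : ℝ) * Complex.I).im = 2 * t := by simp
    rw [im2] at hbb
    have l2 : ell (2 * t) ≤ 2 * l := by
      have : 2 * l = Real.log ((|t| + 4) ^ 2) := by rw [Real.log_pow]; simp [l, ell]
      rw [this, ell, h2t]
      exact Real.log_le_log (by positivity) (by nlinarith)
    have h5 : |2 * t| * ‖riemannZeta (σ + (2 * t : ℝ) * Complex.I)‖ ≤ |2 * t| * (6 * C * l) := by
      calc _ ≤ C * ((|2 * t| + 4) * ell (2 * t)) := g.le.trans hbb
        _ ≤ C * ((2 * |t| + 4 * |t|) * (2 * l)) := by rw [h2t]; have := ell_ge (2 * t); gcongr; linarith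
        _ = _ := by rw [h2t]; ring
    exact le_of_mul_le_mul_left h5 (by rw [h2t]; linarith)
  set w := ‖WW s‖ / (|t| + 4)
  have hw0 : 0 ≤ w := by positivity
  have hσ1 : 0 < σ - 1 := by linarith
  have : 1 ≤ (A / (σ - 1)) ^ 3 * (5 * w) ^ 4 * (6 * C * l) := h.trans (by gcongr)
  rw [div_le_iff₀ (by positivity), one_div, inv_mul_le_iff₀ (by positivity)]
  have h7 : (A / (σ - 1)) ^ 3 * (5 * w) ^ 4 * (6 * C * l) * (σ - 1) ^ 3 = A ^ 3 * 5 ^ 4 * (6 * C) * (w ^ 4 * l) := by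
    field_simp
  rw [← h7]
  exact le_mul_of_one_le_left (by positivity) this

lemma WW_lower : ∃ c₀ c₁ : ℝ, 0 < c₀ ∧ c₀ ≤ 1 / 16 ∧ 0 < c₁ ∧ ∀ s : ℂ, 1 - c₀ / ell s.im ^ 9 ≤ s.re → s.re ≤ 3 →
    c₁ * ((|s.im| + 4) / ell s.im ^ 7) ≤ ‖WW s‖ := by
  obtain ⟨C, hC, hb⟩ := WW_deriv_bound
  obtain ⟨c, hc, hlow⟩ := WW_lower1
  obtain ⟨m, hm, hK⟩ : ∃ m : ℝ, 0 < m ∧ ∀ s : ℂ, s ∈ (Set.Icc 1 3 ×ℂ Set.Icc (-1) 1) → m ≤ ‖WW s‖ := by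
    have hK : IsCompact (Set.Icc (1:ℝ) 3 ×ℂ Set.Icc (-1:ℝ) 1) := isCompact_Icc.reProdIm isCompact_Icc
    obtain ⟨z, hz, hmin⟩ := hK.exists_isMinOn ⟨1, by constructor <;> simp⟩
      (f := fun s => ‖WW s‖) (fun s hs => (WW_diff s (by have := hs.1.1; linarith)).continuousAt.norm.continuousWithinAt)
    exact ⟨‖WW z‖, norm_pos_iff.2 (WW_ne z hz.1.1), fun s hs => hmin hs⟩
  set c₀ := min (1/16) (min (c / (256 * C ^ 4)) (m / (40 * C))) with hc₀
  have hc0 : 0 < c₀ := by positivity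
  have hc1 : c₀ ≤ 1/16 := min_le_left _ _
  have hc2 : c₀ ≤ c / (256 * C ^ 4) := (min_le_right _ _).trans (min_le_left _ _)
  have hc3 : c₀ ≤ m / (40 * C) := (min_le_right _ _).trans (min_le_right _ _)
  refine ⟨c₀, min (2 * C * c₀) (m / 10), hc0, hc1, by positivity, fun s h1 h2 => ?_⟩
  have hl := ell_ge s.im
  have hln : ∀ n : ℕ, 1 ≤ ell s.im ^ n := fun n => one_le_pow₀ hl
  set l := ell s.im
  set τ := |s.im| + 4 with hτ
  have hη : c₀ / l ^ 9 ≤ 1 / (16 * l) := by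
    rw [div_le_div_iff₀ (by positivity) (by positivity)]
    have : l ≤ l ^ 9 := le_self_pow₀ hl (by norm_num)
    nlinarith
  set η := c₀ / l ^ 9 with hηdef
  have hη0 : 0 < η := by positivity
  have hη1 : η ≤ c₀ := div_le_self hc0.le (hln 9)
  have mv : ∀ σ₁ : ℝ, 1 - η ≤ σ₁ → σ₁ ≤ 3 → s.re ≤ σ₁ →
      ‖WW (σ₁ + s.im * Complex.I)‖ - C * (τ * l ^ 2) * (σ₁ - s.re) ≤ ‖WW s‖ := by
    intro σ₁ ha hb' hc'
    have hconv : Convex ℝ (Set.Icc (1 - η) 3 ×ℂ {s.im}) := ((convex_Icc _ _).linear_preimage Complex.reLm).inter ((convex_singleton _).linear_preimage Complex.imLm)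
    have := Convex.norm_image_sub_le_of_norm_deriv_le (f := WW) (C := C * (τ * l ^ 2)) (x := s) (y := σ₁ + s.im * Complex.I)
      (s := (Set.Icc (1 - η) 3 ×ℂ {s.im}))
      (fun w hw => WW_diff w (by have := hw.1.1; linarith))
      (fun w hw => by
        have him : w.im = s.im := hw.2
        have := hb w (by rw [him]; linarith [hw.1.1]) hw.1.2
        rwa [him] at this) hconv ⟨⟨h1, h2⟩, rfl⟩ (by refine ⟨⟨?_, ?_⟩, ?_⟩ <;> simp [ha, hb'])
    have e : ‖(σ₁ : ℂ) + s.im * Complex.I - s‖ = σ₁ - s.re := by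
      have : (σ₁ : ℂ) + s.im * Complex.I - s = ((σ₁ - s.re : ℝ) : ℂ) := by
        apply Complex.ext <;> simp
      rw [this, Complex.norm_real, Real.norm_of_nonneg (by linarith)]
    rw [e] at this
    have h9 := norm_sub_norm_le (WW (σ₁ + s.im * Complex.I)) (WW s)
    linarith
  by_cases ht : 1 ≤ |s.im|
  · refine (mul_le_mul_of_nonneg_right (min_le_left _ _) (by positivity)).trans ?_
    set σ₁ := max s.re (1 + η) with hσ₁
    have g1 : 1 + η ≤ σ₁ := le_max_right _ _
    have g2 : σ₁ ≤ 3 := max_le h2 (by linarith)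
    have g3 : s.re ≤ σ₁ := le_max_left _ _
    have g4 : σ₁ - s.re ≤ 2 * η := by
      have : σ₁ ≤ s.re + 2 * η := max_le (by linarith) (by linarith)
      linarith
    have hlw := hlow (σ₁ + s.im * Complex.I) (by simp; linarith) (by simpa using g2) (by simpa using ht)
    have im2 : ((σ₁:ℂ) + s.im * Complex.I).im = s.im := by simp
    have re2 : ((σ₁:ℂ) + s.im * Complex.I).re = σ₁ := by simp
    rw [im2, re2] at hlw
    have k1 : 4 * C * c₀ / l ^ 7 ≤ ‖WW (σ₁ + s.im * Complex.I)‖ / τ := by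
      refine le_of_pow_le_pow_left₀ (n := 4) (by norm_num) (by positivity) (le_trans ?_ hlw)
      have : η ^ 3 ≤ (σ₁ - 1) ^ 3 := by gcongr; linarith
      calc (4 * C * c₀ / l ^ 7) ^ 4 = 256 * C ^ 4 * c₀ * c₀ ^ 3 / l ^ 28 := by ring
        _ ≤ c * c₀ ^ 3 / l ^ 28 := by
            gcongr
            rw [le_div_iff₀ (by positivity)] at hc2; linarith
        _ = c * η ^ 3 / l := by rw [hηdef]; field_simp
        _ ≤ _ := by gcongr
    rw [le_div_iff₀ (by positivity)] at k1
    have k2 := mv σ₁ (by linarith) g2 g3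
    have k3 : C * (τ * l ^ 2) * (σ₁ - s.re) ≤ C * (τ * l ^ 2) * (2 * η) := by gcongr
    have k4 : C * (τ * l ^ 2) * (2 * η) = 2 * C * c₀ / l ^ 7 * τ := by rw [hηdef]; field_simp
    have k5 : 4 * C * c₀ / l ^ 7 * τ = 2 * C * c₀ / l ^ 7 * τ + 2 * C * c₀ * (τ / l ^ 7) := by ring
    linarith
  · refine (mul_le_mul_of_nonneg_right (min_le_right _ _) (by positivity)).trans ?_
    push Not at ht
    set σ₁ := max s.re 1 with hσ₁
    have g2 : σ₁ ≤ 3 := max_le h2 (by norm_num)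
    have g3 : s.re ≤ σ₁ := le_max_left _ _
    have g4 : σ₁ - s.re ≤ η := by
      have : σ₁ ≤ s.re + η := max_le (by linarith) (by linarith)
      linarith
    have k1 := hK (σ₁ + s.im * Complex.I) (by
      refine ⟨⟨?_, ?_⟩, ?_⟩
      · simp [hσ₁]
      · simpa using g2
      · simpa using abs_le.1 ht.le)
    have k2 := mv σ₁ (by linarith [le_max_right s.re 1]) g2 g3
    have k3 : C * (τ * l ^ 2) * (σ₁ - s.re) ≤ C * (τ * l ^ 2) * η := by gcongr
    have hτ5 : τ ≤ 5 := by linarith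
    have k4 : C * (τ * l ^ 2) * η ≤ m / 8 := by
      calc C * (τ * l ^ 2) * η = C * τ * c₀ / l ^ 7 := by rw [hηdef]; field_simp
        _ ≤ C * τ * c₀ := div_le_self (by positivity) (hln 7)
        _ ≤ C * 5 * (m / (40 * C)) := by gcongr
        _ = m / 8 := by field_simp; norm_num
    have k5 : m / 10 * (τ / l ^ 7) ≤ m / 2 := by
      calc m / 10 * (τ / l ^ 7) ≤ m / 10 * 5 := by
            gcongr; exact (div_le_self (by positivity) (hln 7)).trans hτ5
        _ = m / 2 := by ring
    linarith

def DB (F : ℂ → ℂ) : Prop := ∀ k : ℕ, ∃ C : ℝ, ∀ s : ℂ, 1 < s.re → s.re ≤ 2 →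
  ‖iteratedDeriv k F s‖ ≤ C * (|s.im| + 4) ^ (1/2 : ℝ)

lemma ell_pow_le (m : ℕ) (t : ℝ) : ell t ^ m ≤ (2 ^ m * m.factorial) * (|t| + 4) ^ (1/2 : ℝ) := by
  have hl := ell_ge t
  have h := Real.pow_div_factorial_le_exp (ell t / 2) (by linarith) m
  have e : Real.exp (ell t / 2) = (|t| + 4) ^ (1/2 : ℝ) := by
    rw [Real.rpow_def_of_pos (by positivity), ell]; congr 1; ring
  rw [e, div_pow, div_div, div_le_iff₀ (by positivity)] at h
  linarith

lemma DB_of_region (F : ℂ → ℂ) (c₀ C : ℝ) (K : ℕ) (hc : 0 < c₀) (hc' : c₀ ≤ 1 / 16) (hC : 0 ≤ C)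
    (hd : ∀ s : ℂ, 1 - c₀ / ell s.im ^ 9 ≤ s.re → s.re ≤ 3 → DifferentiableAt ℂ F s)
    (hb : ∀ s : ℂ, 1 - c₀ / ell s.im ^ 9 ≤ s.re → s.re ≤ 3 → ‖F s‖ ≤ C * ell s.im ^ K) : DB F := by
  intro k
  set m := K + 9 * k
  refine ⟨k.factorial * (C * 2 ^ K) * (2 ^ 9 / c₀) ^ k * (2 ^ m * m.factorial), fun s h1 h2 => ?_⟩
  have hl := ell_ge s.im
  set l := ell s.im with hldef
  set r := c₀ / (2 * l) ^ 9 with hr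
  have hr0 : 0 < r := by positivity
  have hr1 : r ≤ 1 := (div_le_self hc.le (one_le_pow₀ (by linarith))).trans (by linarith)
  have key : ∀ w ∈ Metric.closedBall s r, 1 - c₀ / ell w.im ^ 9 ≤ w.re ∧ w.re ≤ 3 ∧ ell w.im ≤ 2 * l := by
    intro w hw
    obtain ⟨a1, a2, a3, a4⟩ := ball_near hr1 hw
    have hlw := ell_ge w.im
    refine ⟨?_, by linarith, a1⟩
    have : r ≤ c₀ / ell w.im ^ 9 := by rw [hr]; gcongr
    linarith
  have := Complex.norm_iteratedDeriv_le_of_forall_mem_sphere_norm_le (f := F) (c := s) (R := r)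
    (C := C * (2 * l) ^ K) k hr0
    (DifferentiableOn.diffContOnCl (fun w hw => by
      rw [closure_ball _ hr0.ne'] at hw
      exact (hd w (key w hw).1 (key w hw).2.1).differentiableWithinAt))
    (fun w hw => by
      obtain ⟨k1, k2, k3⟩ := key w (Metric.sphere_subset_closedBall hw)
      have := ell_ge w.im
      exact (hb w k1 k2).trans (by gcongr))
  refine this.trans ?_
  have e : k.factorial * (C * (2 * l) ^ K) / r ^ k = k.factorial * (C * 2 ^ K) * (2 ^ 9 / c₀) ^ k * l ^ m := by
    rw [hr, show l ^ m = l ^ K * (l ^ 9) ^ k by rw [← pow_mul, ← pow_add]]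
    simp only [mul_pow, div_pow]
    field_simp
  rw [e, mul_assoc _ (2 ^ m * _ : ℝ)]
  gcongr
  exact ell_pow_le m s.im

lemma DB_congr {F G : ℂ → ℂ} (hF : DB F) (h : ∀ s : ℂ, 1 < s.re → G s = F s) : DB G := by
  intro k
  obtain ⟨C, hC⟩ := hF k
  refine ⟨C, fun s h1 h2 => ?_⟩
  have : G =ᶠ[nhds s] F := by
    filter_upwards [(isOpen_lt continuous_const Complex.continuous_re).mem_nhds h1] with w hw
    exact h w hw
  rw [this.iteratedDeriv_eq]
  exact hC s h1 h2

lemma DB_moebius : DB (LSeries (fun n => ((ArithmeticFunction.moebius n : ℤ) : ℂ))) := by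
  obtain ⟨c₀, c₁, h0, h1, h2, hlow⟩ := WW_lower
  have hre : ∀ s : ℂ, 1 - c₀ / ell s.im ^ 9 ≤ s.re → 1/2 < s.re := fun s hs => by
    have : c₀ / ell s.im ^ 9 ≤ c₀ := div_le_self h0.le (one_le_pow₀ (ell_ge s.im))
    linarith
  have hpos : ∀ s : ℂ, 1 - c₀ / ell s.im ^ 9 ≤ s.re → s.re ≤ 3 → 0 < ‖WW s‖ := fun s a b => by
    have := ell_ge s.im
    exact lt_of_lt_of_le (by positivity) (hlow s a b)
  refine DB_congr (F := fun s => (s - 1) / WW s) (DB_of_region _ c₀ (1 / c₁) 7 h0 h1 (by positivity) ?_ ?_) ?_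
  · intro s a b
    exact (differentiableAt_id.sub_const 1).div (WW_diff s (hre s a)) (norm_pos_iff.1 (hpos s a b))
  · intro s a b
    have hl := ell_ge s.im
    rw [norm_div, div_le_iff₀ (hpos s a b)]
    have h5 := hlow s a b
    have h6 := (norm_le_of_re s (by linarith [hre s a]) (by linarith)).2
    calc ‖s - 1‖ ≤ |s.im| + 4 := h6
      _ = 1 / c₁ * ell s.im ^ 7 * (c₁ * ((|s.im| + 4) / ell s.im ^ 7)) := by field_simp
      _ ≤ _ := by gcongr
  · intro s hs
    have hz := ArithmeticFunction.LSeries_zeta_mul_Lseries_moebius hs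
    rw [ArithmeticFunction.LSeries_zeta_eq_riemannZeta hs] at hz
    have h3 : WW s ≠ 0 := WW_ne s hs.le
    have h4 := WW_eq s hs
    rw [eq_div_iff h3, h4, mul_comm, mul_assoc, hz, mul_one]

lemma DB_lambda : DB (LSeries (fun n => ((ArithmeticFunction.vonMangoldt n - 1 : ℝ) : ℂ))) := by
  obtain ⟨c₀, c₁, h0, h1, h2, hlow⟩ := WW_lower
  obtain ⟨C', hC', hder⟩ := WW_deriv_bound
  obtain ⟨C, hC, hbd⟩ := WW_bound
  have hl := fun s : ℂ => ell_ge s.im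
  have hre : ∀ s : ℂ, 1 - c₀ / ell s.im ^ 9 ≤ s.re → 1/2 < s.re := fun s hs => by
    have : c₀ / ell s.im ^ 9 ≤ c₀ := div_le_self h0.le (one_le_pow₀ (ell_ge s.im))
    linarith
  have hre2 : ∀ s : ℂ, 1 - c₀ / ell s.im ^ 9 ≤ s.re → 1 - 1 / (16 * ell s.im) ≤ s.re := fun s hs => by
    have := hl s
    have : c₀ / ell s.im ^ 9 ≤ 1 / (16 * ell s.im) := by
      rw [div_le_div_iff₀ (by positivity) (by positivity)]
      have : ell s.im ≤ ell s.im ^ 9 := le_self_pow₀ (hl s) (by norm_num)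
      nlinarith
    linarith
  have hpos : ∀ s : ℂ, 1 - c₀ / ell s.im ^ 9 ≤ s.re → s.re ≤ 3 → 0 < ‖WW s‖ := fun s a b => by
    have := hl s
    exact lt_of_lt_of_le (by positivity) (hlow s a b)
  have hopen : IsOpen {z : ℂ | 1/2 < z.re} := isOpen_lt continuous_const Complex.continuous_re
  have hdW : DifferentiableOn ℂ WW {z : ℂ | 1/2 < z.re} := fun s hs => (WW_diff s hs).differentiableWithinAt
  have hds : DifferentiableOn ℂ (dslope WW 1) {z : ℂ | 1/2 < z.re} :=
    (Complex.differentiableOn_dslope (hopen.mem_nhds (by norm_num))).2 hdW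
  obtain ⟨D, hD⟩ : ∃ D, ∀ s ∈ Metric.closedBall (1:ℂ) (1/4), ‖dslope WW 1 s‖ ≤ D :=
    (isCompact_closedBall (1:ℂ) (1/4)).exists_bound_of_continuousOn (hds.continuousOn.mono (by
      intro s hs
      have h := mem_closedBall_iff_norm.1 hs
      have h2 := abs_le.1 ((Complex.abs_re_le_norm (s - 1)).trans h)
      simp only [Complex.sub_re, Complex.one_re] at h2
      show 1/2 < s.re
      linarith))
  have hD0 : 0 ≤ D := (norm_nonneg _).trans (hD 1 (by simp))
  have hdsb : ∀ s : ℂ, 1 - c₀ / ell s.im ^ 9 ≤ s.re → s.re ≤ 3 → ‖dslope WW 1 s‖ ≤ (D + 17 * (C + 1)) * ell s.im := by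
    intro s a b
    have hls := hl s
    by_cases hs : ‖s - 1‖ ≤ 1/4
    · have := hD s (mem_closedBall_iff_norm.2 hs)
      nlinarith
    · push Not at hs
      have hne : s ≠ 1 := by rintro rfl; norm_num at hs
      rw [dslope_of_ne _ hne, slope_def_field, norm_div, div_le_iff₀ (by linarith), WW_one]
      have him := Complex.abs_im_le_norm (s - 1)
      simp only [Complex.sub_im, Complex.one_im, sub_zero] at him
      have h4 := hbd s (by
        have := hre2 s a
        have : 1 / (16 * ell s.im) ≤ 1 / (4 * ell s.im) := one_div_le_one_div_of_le (by positivity) (by linarith)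
        linarith) (by linarith)
      have h5 : |s.im| + 4 ≤ 17 * ‖s - 1‖ := by linarith
      have h6 : 1 ≤ (|s.im| + 4) * ell s.im := by nlinarith [abs_nonneg s.im]
      calc ‖WW s - 1‖ ≤ ‖WW s‖ + 1 := (norm_sub_le _ _).trans (by simp)
        _ ≤ (C + 1) * ((|s.im| + 4) * ell s.im) := by linarith
        _ ≤ (C + 1) * ((17 * ‖s - 1‖) * ell s.im) := by gcongr
        _ ≤ _ := by
          have : 0 ≤ D * (ell s.im * ‖s - 1‖) := by positivity
          nlinarith
  refine DB_congr (F := fun s => -(deriv WW s / WW s) - dslope WW 1 s)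
    (DB_of_region _ c₀ (C' / c₁ + (D + 17 * (C + 1))) 9 h0 h1 (by positivity) ?_ ?_) ?_
  · intro s a b
    exact (((hdW.deriv hopen).differentiableAt (hopen.mem_nhds (hre s a))).div (WW_diff s (hre s a)) (norm_pos_iff.1 (hpos s a b))).neg.sub
      (hds.differentiableAt (hopen.mem_nhds (hre s a)))
  · intro s a b
    have hls := hl s
    have h5 := hlow s a b
    have e1 : ‖deriv WW s / WW s‖ ≤ C' / c₁ * ell s.im ^ 9 := by
      rw [norm_div, div_le_iff₀ (hpos s a b)]
      calc _ ≤ C' * ((|s.im| + 4) * ell s.im ^ 2) := hder s (hre2 s a) b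
        _ = C' / c₁ * ell s.im ^ 9 * (c₁ * ((|s.im| + 4) / ell s.im ^ 7)) := by field_simp
        _ ≤ _ := by gcongr
    calc _ ≤ ‖deriv WW s / WW s‖ + ‖dslope WW 1 s‖ := (norm_sub_le _ _).trans (by rw [norm_neg])
      _ ≤ C' / c₁ * ell s.im ^ 9 + (D + 17 * (C + 1)) * ell s.im ^ 9 :=
          add_le_add e1 ((hdsb s a b).trans (by gcongr; exact le_self_pow₀ hls (by norm_num)))
      _ = _ := by ring
  · intro s hs
    have hne : s ≠ 1 := by rintro rfl; simp at hs
    have hs1 : s - 1 ≠ 0 := sub_ne_zero.2 hne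
    have hz0 : riemannZeta s ≠ 0 := riemannZeta_ne_zero_of_one_le_re hs.le
    have hW := WW_eq s hs
    have hWd : deriv WW s = riemannZeta s + (s - 1) * deriv riemannZeta s := by
      have : WW =ᶠ[nhds s] fun z => (z - 1) * riemannZeta z := by
        filter_upwards [(isOpen_lt continuous_const Complex.continuous_re).mem_nhds hs] with w hw
        exact WW_eq w hw
      rw [this.deriv_eq]
      have := ((hasDerivAt_id s).sub_const 1).mul (differentiableAt_riemannZeta hne).hasDerivAt
      have h9 := this.deriv
      simp only [id_eq, one_mul] at h9
      exact h9
    have e1 : LSeries (fun n => ((ArithmeticFunction.vonMangoldt n - 1 : ℝ) : ℂ)) s =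
        -deriv riemannZeta s / riemannZeta s - riemannZeta s := by
      rw [← ArithmeticFunction.LSeries_vonMangoldt_eq_deriv_riemannZeta_div hs, ← LSeries_one_eq_riemannZeta hs,
        ← LSeries_sub (ArithmeticFunction.LSeriesSummable_vonMangoldt hs) (LSeriesSummable_one_iff.2 hs)]
      congr 1; ext n; simp
    rw [e1, dslope_of_ne _ hne, slope_def_field, WW_one, hWd, hW]
    field_simp
    ring

lemma lap_int (σ : ℝ) (hσ : 0 < σ) :
    MeasureTheory.IntegrableOn (fun u : ℝ => u * Real.exp (-σ * u)) (Set.Ioi 0) := by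
  have h := integrableOn_rpow_mul_exp_neg_mul_rpow (p := 1) (s := 1) (b := σ) (by norm_num)
    (by norm_num) hσ
  simpa using h

lemma lap_int_c (s : ℂ) (hs : 0 < s.re) :
    MeasureTheory.IntegrableOn (fun u : ℝ => (u : ℂ) * Complex.exp (-s * u)) (Set.Ioi 0) := by
  refine MeasureTheory.Integrable.mono' (lap_int s.re hs) ?_ ?_
  · exact Continuous.aestronglyMeasurable (by fun_prop)
  · refine (MeasureTheory.ae_restrict_iff' measurableSet_Ioi).2 (Eventually.of_forall ?_)
    intro u hu
    have hu' : (0:ℝ) < u := hu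
    rw [norm_mul, Complex.norm_exp, Complex.norm_real, Real.norm_of_nonneg hu'.le]
    simp

lemma lap_eval (s : ℂ) (hs : 0 < s.re) :
    ∫ u in Set.Ioi (0:ℝ), (u : ℂ) * Complex.exp (-s * u) = 1 / s ^ 2 := by
  have hs0 : s ≠ 0 := by rintro rfl; simp at hs
  have hd : ∀ u ∈ Set.Ici (0:ℝ), HasDerivAt
      (fun u : ℝ => -((u:ℂ) / s + 1 / s ^ 2) * Complex.exp (-s * u))
      ((u : ℂ) * Complex.exp (-s * u)) u := by
    intro u _
    have h1 : HasDerivAt (fun u : ℝ => (u:ℂ)) 1 u := Complex.ofRealCLM.hasDerivAt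
    have h2 := ((h1.div_const s).add_const (1 / s ^ 2)).neg
    have h3 := (h1.const_mul (-s)).cexp
    have h4 := h2.mul h3
    refine h4.congr_deriv ?_
    simp only [Pi.neg_apply]
    field_simp
    ring
  have ht : Tendsto (fun u : ℝ => -((u:ℂ) / s + 1 / s ^ 2) * Complex.exp (-s * u)) atTop
      (nhds 0) := by
    rw [tendsto_zero_iff_norm_tendsto_zero]
    have h0 : Tendsto (fun u : ℝ => (‖s‖⁻¹) * (u * Real.exp (-s.re * u)) + (‖s^2‖⁻¹) * (Real.exp (-s.re * u)))
        atTop (nhds (‖s‖⁻¹ * 0 + ‖s^2‖⁻¹ * 0)) := by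
      refine Tendsto.add (Tendsto.const_mul _ ?_) (Tendsto.const_mul _ ?_)
      · have := tendsto_rpow_mul_exp_neg_mul_atTop_nhds_zero 1 s.re hs
        simpa using this
      · have := tendsto_rpow_mul_exp_neg_mul_atTop_nhds_zero 0 s.re hs
        simpa using this
    simp only [mul_zero, add_zero] at h0
    refine squeeze_zero' (Eventually.of_forall fun _ => norm_nonneg _) ?_ h0
    filter_upwards [eventually_ge_atTop 0] with u hu
    rw [norm_mul, norm_neg, Complex.norm_exp]
    have hre : (-s * u).re = -s.re * u := by simp
    rw [hre]
    have : ‖(u:ℂ) / s + 1 / s ^ 2‖ ≤ u * ‖s‖⁻¹ + ‖s^2‖⁻¹ := by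
      refine (norm_add_le _ _).trans ?_
      rw [norm_div, norm_div, Complex.norm_real, Real.norm_of_nonneg hu, norm_one, one_div,
        div_eq_mul_inv]
    calc _ ≤ (u * ‖s‖⁻¹ + ‖s^2‖⁻¹) * Real.exp (-s.re * u) := by gcongr
      _ = _ := by ring
  have := MeasureTheory.integral_Ioi_of_hasDerivAt_of_tendsto' hd (lap_int_c s hs) ht
  rw [this]; simp

noncomputable def sx (σ ξ : ℝ) : ℂ := σ + (2 * Real.pi * ξ : ℝ) * Complex.I

lemma sx_re (σ ξ : ℝ) : (sx σ ξ).re = σ := by simp [sx]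
lemma sx_im (σ ξ : ℝ) : (sx σ ξ).im = 2 * Real.pi * ξ := by simp [sx]
lemma sx_cont (σ : ℝ) : Continuous (sx σ) := by unfold sx; fun_prop

lemma sx_normsq (σ ξ : ℝ) : ‖sx σ ξ‖ ^ 2 = σ ^ 2 + (2 * Real.pi * ξ) ^ 2 := by
  rw [← Complex.normSq_eq_norm_sq, Complex.normSq_apply, sx_re, sx_im]; ring

lemma sx_ne (σ ξ : ℝ) (h : 0 < σ) : sx σ ξ ≠ 0 := by
  intro h0
  have := sx_re σ ξ
  rw [h0] at this; simp at this; linarith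

lemma inv_sq_int (σ : ℝ) (hσ : 0 < σ) :
    MeasureTheory.Integrable (fun ξ : ℝ => 1 / (sx σ ξ) ^ 2) := by
  have h := integrable_inv_one_add_sq.const_mul (max (1/σ^2) 1)
  refine h.mono' ?_ (Eventually.of_forall fun ξ => ?_)
  · refine Continuous.aestronglyMeasurable ?_
    exact continuous_const.div ((sx_cont σ).pow 2) (fun ξ => pow_ne_zero 2 (sx_ne σ ξ hσ))
  · rw [norm_div, norm_one, norm_pow, sx_normsq, one_div, ← div_eq_mul_inv,
      inv_le_comm₀ (by positivity) (by positivity), inv_div, div_le_iff₀ (by positivity)]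
    have hm1 : 1 ≤ σ^2 * max (1/σ^2) 1 := by
      calc (1:ℝ) = σ^2 * (1/σ^2) := by field_simp
        _ ≤ _ := by gcongr; exact le_max_left _ _
    have hm2 : (1:ℝ) ≤ max (1/σ^2) 1 := le_max_right _ _
    have hp : ξ ^ 2 ≤ (2 * Real.pi * ξ)^2 := by
      have := Real.pi_gt_three
      have h4 : (1:ℝ) ≤ (2 * Real.pi)^2 := by nlinarith
      nlinarith [sq_nonneg ξ]
    have : (2 * Real.pi * ξ)^2 ≤ (2 * Real.pi * ξ)^2 * max (1/σ^2) 1 :=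
      le_mul_of_one_le_right (sq_nonneg _) hm2
    nlinarith

lemma perron0 (σ : ℝ) (hσ : 0 < σ) (v : ℝ) :
    ∫ ξ : ℝ, Complex.exp (sx σ ξ * v) / (sx σ ξ) ^ 2 = ((max v 0 : ℝ) : ℂ) := by
  set g : ℝ → ℂ := fun u => ((max u 0 * Real.exp (-σ * u) : ℝ) : ℂ) with hg
  have hgi : g = Set.indicator (Set.Ioi 0) (fun u : ℝ => (u : ℂ) * Complex.exp (-(σ:ℂ) * u)) := by
    funext u
    by_cases hu : 0 < u
    · rw [Set.indicator_of_mem (show u ∈ Set.Ioi (0:ℝ) from hu)]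
      simp [hg, max_eq_left hu.le]
    · rw [Set.indicator_of_notMem (show u ∉ Set.Ioi (0:ℝ) from hu)]
      simp [hg, max_eq_right (not_lt.1 hu)]
  have hint : MeasureTheory.Integrable g := by
    rw [hgi, MeasureTheory.integrable_indicator_iff measurableSet_Ioi]
    exact lap_int_c σ (by simpa using hσ)
  have hF : ∀ ξ, FourierTransform.fourier g ξ = 1 / (sx σ ξ) ^ 2 := by
    intro ξ
    rw [Real.fourier_real_eq_integral_exp_smul, ← lap_eval (sx σ ξ) (by rw [sx_re]; exact hσ),
      ← MeasureTheory.integral_indicator measurableSet_Ioi]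
    congr 1
    funext u
    rw [hgi]
    by_cases hu : 0 < u
    · rw [Set.indicator_of_mem (show u ∈ Set.Ioi (0:ℝ) from hu),
        Set.indicator_of_mem (show u ∈ Set.Ioi (0:ℝ) from hu), smul_eq_mul, mul_left_comm,
        ← Complex.exp_add]
      congr 2
      simp [sx]; ring
    · rw [Set.indicator_of_notMem (show u ∉ Set.Ioi (0:ℝ) from hu),
        Set.indicator_of_notMem (show u ∉ Set.Ioi (0:ℝ) from hu), smul_zero]
  have hFf : FourierTransform.fourier g = fun ξ => 1 / (sx σ ξ) ^ 2 := funext hF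
  have hcont : Continuous g := by rw [hg]; fun_prop
  have h := hint.fourierInv_fourier_eq (by rw [hFf]; exact inv_sq_int σ hσ) (hcont.continuousAt (x := v))
  rw [hFf, Real.fourierInv_eq'] at h
  have h2 : ∫ ξ : ℝ, Complex.exp (sx σ ξ * v) / (sx σ ξ) ^ 2
     = Complex.exp (σ * v) * ∫ ξ : ℝ, Complex.exp (((2 * Real.pi * inner ℝ ξ v : ℝ) : ℂ) * Complex.I) • (1 / (sx σ ξ) ^ 2) := by
    rw [← MeasureTheory.integral_const_mul]
    congr 1
    funext ξ
    rw [smul_eq_mul, ← mul_assoc, ← Complex.exp_add, mul_one_div]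
    congr 2
    simp [sx]; ring
  rw [h2, h, hg]
  simp only [Complex.ofReal_mul, Complex.ofReal_exp]
  rw [mul_left_comm, ← Complex.exp_add]
  simp

lemma perron_sum (c : ℕ → ℂ) (x σ : ℝ) (hx : 1 ≤ x) (hσ : 0 < σ) (hs : LSeriesSummable c (σ:ℂ)) :
    ∑ n ∈ Icc 1 ⌊x⌋₊, c n * ((Real.log (x / n) : ℝ) : ℂ) =
      ∫ ξ : ℝ, LSeries c (sx σ ξ) * (Complex.exp (sx σ ξ * Real.log x) / (sx σ ξ) ^ 2) := by
  have hx0 : 0 < x := by linarith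
  set F : ℕ → ℝ → ℂ := fun n ξ => LSeries.term c (sx σ ξ) n *
    (Complex.exp (sx σ ξ * Real.log x) / (sx σ ξ) ^ 2) with hF
  set I0 : ℝ := ∫ ξ : ℝ, ‖1 / (sx σ ξ) ^ 2‖
  have hFe : ∀ n : ℕ, n ≠ 0 → ∀ ξ, F n ξ = c n *
      (Complex.exp (sx σ ξ * (Real.log x - Real.log n : ℝ)) / (sx σ ξ) ^ 2) := by
    intro n hn ξ
    simp only [hF]
    rw [LSeries.term_of_ne_zero hn, Complex.cpow_def_of_ne_zero (by exact_mod_cast hn),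
      Complex.ofReal_sub, mul_sub, Complex.exp_sub, Complex.natCast_log, mul_comm (sx σ ξ) (Complex.log n)]
    field_simp
  have hF0 : ∀ ξ, F 0 ξ = 0 := by intro ξ; simp [hF]
  have hFn : ∀ n ξ, ‖F n ξ‖ = ‖LSeries.term c (σ:ℂ) n‖ * Real.exp (σ * Real.log x) * ‖1 / (sx σ ξ) ^ 2‖ := by
    intro n ξ
    simp only [hF]
    rw [norm_mul, norm_div, LSeries.norm_term_eq, LSeries.norm_term_eq, sx_re, Complex.ofReal_re,
      Complex.norm_exp, norm_div, norm_one]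
    have : (sx σ ξ * (Real.log x : ℂ)).re = σ * Real.log x := by simp [sx]
    rw [this]; ring
  have hmeas : ∀ n, MeasureTheory.AEStronglyMeasurable (F n) := by
    intro n
    rcases eq_or_ne n 0 with rfl | hn
    · have : F 0 = fun _ => 0 := funext hF0
      rw [this]; exact MeasureTheory.aestronglyMeasurable_const
    · have : F n = _ := funext (hFe n hn)
      rw [this]
      refine Continuous.aestronglyMeasurable (continuous_const.mul ?_)
      refine Continuous.div ?_ ((sx_cont σ).pow 2) (fun ξ => pow_ne_zero 2 (sx_ne σ ξ hσ))
      exact Complex.continuous_exp.comp ((sx_cont σ).mul continuous_const)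
  have hint : ∀ n, MeasureTheory.Integrable (F n) := by
    intro n
    refine ((inv_sq_int σ hσ).norm.const_mul (‖LSeries.term c (σ:ℂ) n‖ * Real.exp (σ * Real.log x))).mono'
      (hmeas n) (Eventually.of_forall fun ξ => ?_)
    rw [hFn]
  have hsum : Summable fun n => ∫ ξ, ‖F n ξ‖ := by
    have : ∀ n, ∫ ξ, ‖F n ξ‖ = ‖LSeries.term c (σ:ℂ) n‖ * (Real.exp (σ * Real.log x) * I0) := by
      intro n
      simp_rw [hFn]
      rw [MeasureTheory.integral_const_mul, mul_assoc]
    simp_rw [this]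
    exact hs.norm.mul_right _
  have hS := MeasureTheory.hasSum_integral_of_summable_integral_norm hint hsum
  have hR : ∀ ξ, ∑' n, F n ξ = LSeries c (sx σ ξ) * (Complex.exp (sx σ ξ * Real.log x) / (sx σ ξ) ^ 2) := by
    intro ξ
    simp only [hF]
    rw [tsum_mul_right]; rfl
  simp_rw [hR] at hS
  rw [← hS.tsum_eq]
  have hI : ∀ n, ∫ ξ, F n ξ = if n ∈ Icc 1 ⌊x⌋₊ then c n * ((Real.log (x / n) : ℝ) : ℂ) else 0 := by
    intro n
    rcases eq_or_ne n 0 with rfl | hn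
    · simp [hF0]
    · simp_rw [hFe n hn]
      rw [MeasureTheory.integral_const_mul, perron0 σ hσ]
      have hnp : (0:ℝ) < n := by exact_mod_cast Nat.pos_of_ne_zero hn
      split_ifs with h
      · rw [mem_Icc, Nat.le_floor_iff hx0.le] at h
        rw [Real.log_div hx0.ne' hnp.ne', max_eq_left]
        have := Real.log_le_log hnp h.2
        linarith
      · have : x < n := by
          by_contra hc
          exact h (mem_Icc.2 ⟨Nat.pos_of_ne_zero hn, (Nat.le_floor_iff hx0.le).2 (not_lt.1 hc)⟩)
        have := Real.log_le_log hx0 this.le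
        rw [max_eq_right (by linarith)]; simp
  simp_rw [hI]
  rw [tsum_eq_sum (s := Icc 1 ⌊x⌋₊)]
  · exact Finset.sum_congr rfl fun n hn => by rw [if_pos hn]
  · intro n hn; rw [if_neg hn]

noncomputable def maj (ξ : ℝ) : ℝ := (|2 * Real.pi * ξ| + 4) ^ (1/2:ℝ) / (1 + (2 * Real.pi * ξ) ^ 2)

lemma maj_int : MeasureTheory.Integrable maj := by
  have h0 : MeasureTheory.Integrable (fun t : ℝ => (|t| + 4) ^ (1/2:ℝ) / (1 + t ^ 2)) := by
    have h := (integrable_one_add_norm (E := ℝ) (μ := MeasureTheory.volume) (r := 3/2) (by simp; norm_num)).const_mul 4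
    refine h.mono' ?_ (Eventually.of_forall fun t => ?_)
    · refine Continuous.aestronglyMeasurable ?_
      refine Continuous.div ?_ (by fun_prop) (fun t => by positivity)
      exact Continuous.rpow_const (by fun_prop) (fun t => Or.inr (by norm_num))
    · rw [Real.norm_of_nonneg (by positivity), Real.norm_eq_abs]
      have hp : (0:ℝ) < 1 + |t| := by positivity
      have e : (1 + |t|) ^ (-(3/2):ℝ) = (1+|t|)^(1/2:ℝ) / (1+|t|)^2 := by
        rw [← Real.rpow_natCast, ← Real.rpow_sub hp]; norm_num
      rw [e, ← mul_div_assoc, div_le_div_iff₀ (by positivity) (by positivity)]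
      have h1 : (|t| + 4)^(1/2:ℝ) ≤ 2 * (1+|t|)^(1/2:ℝ) := by
        calc (|t| + 4)^(1/2:ℝ) ≤ (4 * (1+|t|))^(1/2:ℝ) := by
              gcongr; linarith [abs_nonneg t]
          _ = 4^(1/2:ℝ) * (1+|t|)^(1/2:ℝ) := by rw [Real.mul_rpow (by norm_num) hp.le]
          _ = _ := by
            rw [show (4:ℝ) = 2^(2:ℝ) by norm_num, ← Real.rpow_mul (by norm_num)]; norm_num
      have h2 : (1+|t|)^2 ≤ 2 * (1 + t^2) := by
        rw [← sq_abs t]; nlinarith [sq_nonneg (|t| - 1)]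
      calc _ ≤ (2 * (1+|t|)^(1/2:ℝ)) * (2 * (1 + t^2)) := by gcongr
        _ = _ := by ring
  have := h0.comp_mul_left' (R := 2 * Real.pi) (by positivity)
  exact this

lemma iter_logMul (c : ℕ → ℂ) (k n : ℕ) :
    (LSeries.logMul^[k] c) n = ((Real.log n : ℝ) : ℂ) ^ k * c n := by
  induction k with
  | zero => simp
  | succ k ih => rw [Function.iterate_succ_apply', LSeries.logMul, ih, Complex.natCast_log]; ring

lemma absc_le (c : ℕ → ℂ) (hc : ∀ n, ‖c n‖ ≤ 1 + Real.log n) (σ : ℝ) (hσ : 1 < σ) :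
    LSeries.abscissaOfAbsConv c < σ := by
  have h : LSeries.abscissaOfAbsConv c ≤ ((σ-1)/2 : ℝ) + 1 := by
    refine LSeries.abscissaOfAbsConv_le_of_le_const_mul_rpow ⟨1 + 1/((σ-1)/2), fun n hn => ?_⟩
    have he : 0 < (σ-1)/2 := by linarith
    have h1 := Real.log_le_rpow_div (Nat.cast_nonneg n) he
    have hn1 : (1:ℝ) ≤ n := by exact_mod_cast Nat.one_le_iff_ne_zero.2 hn
    have h2 : (1:ℝ) ≤ (n:ℝ)^((σ-1)/2) := Real.one_le_rpow hn1 he.le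
    calc ‖c n‖ ≤ 1 + Real.log n := hc n
      _ ≤ (n:ℝ)^((σ-1)/2) + (n:ℝ)^((σ-1)/2) / ((σ-1)/2) := by linarith
      _ = _ := by ring
  refine h.trans_lt ?_
  have : (((σ-1)/2 : ℝ) : EReal) + 1 = (((σ-1)/2 + 1 : ℝ) : EReal) := by push_cast; rfl
  rw [this]
  exact EReal.coe_lt_coe_iff.2 (by linarith)

lemma smooth_bound (c : ℕ → ℂ) (hc : ∀ n, ‖c n‖ ≤ 1 + Real.log n) (hD : DB (LSeries c)) (k : ℕ) :
    ∃ C : ℝ, 0 ≤ C ∧ ∀ x : ℝ, 3 ≤ x →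
      ‖∑ n ∈ Icc 1 ⌊x⌋₊, ((Real.log n : ℝ) : ℂ) ^ k * c n * ((Real.log (x / n) : ℝ) : ℂ)‖ ≤ C * x := by
  obtain ⟨C, hC⟩ := hD k
  refine ⟨|C| * Real.exp 1 * ∫ ξ, maj ξ, ?_, fun x hx => ?_⟩
  · have : 0 ≤ ∫ ξ, maj ξ := MeasureTheory.integral_nonneg fun ξ => by unfold maj; positivity
    positivity
  have hx0 : (0:ℝ) < x := by linarith
  have hl : 1 ≤ Real.log x := by
    rw [Real.le_log_iff_exp_le hx0]; linarith [Real.exp_one_lt_d9]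
  set σ : ℝ := 1 + 1 / Real.log x with hσ
  have hσ1 : 1 < σ := by rw [hσ]; have : 0 < 1 / Real.log x := by positivity
                         linarith
  have hσ2 : σ ≤ 2 := by
    rw [hσ]; have : 1 / Real.log x ≤ 1 := by rw [div_le_one (by linarith)]; exact hl
    linarith
  have hsum : LSeriesSummable (LSeries.logMul^[k] c) (σ:ℂ) := by
    apply LSeriesSummable_of_abscissaOfAbsConv_lt_re
    rw [LSeries.absicssaOfAbsConv_logPowMul]
    exact absc_le c hc σ hσ1
  have hP := perron_sum (LSeries.logMul^[k] c) x σ (by linarith) (by linarith) hsum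
  simp_rw [iter_logMul] at hP
  rw [hP]
  have hbd : ∀ ξ, ‖LSeries (LSeries.logMul^[k] c) (sx σ ξ) * (Complex.exp (sx σ ξ * Real.log x) / (sx σ ξ) ^ 2)‖
      ≤ (|C| * Real.exp 1 * x) * maj ξ := by
    intro ξ
    have h1 := hC (sx σ ξ) (by rw [sx_re]; exact hσ1) (by rw [sx_re]; exact hσ2)
    rw [LSeries_iteratedDeriv k (by rw [sx_re]; exact absc_le c hc σ hσ1), norm_mul, norm_pow, norm_neg, norm_one, one_pow,
      one_mul, sx_im] at h1
    rw [norm_mul, norm_div, norm_pow, sx_normsq, Complex.norm_exp]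
    have h2 : (sx σ ξ * (Real.log x : ℂ)).re = Real.log x + 1 := by
      simp [sx, hσ]; field_simp
    rw [h2, Real.exp_add, Real.exp_log hx0]
    have h3 : 1 ≤ σ^2 := by nlinarith
    unfold maj
    calc _ ≤ (|C| * (|2 * Real.pi * ξ| + 4) ^ (1/2:ℝ)) * (x * Real.exp 1 / (1 + (2 * Real.pi * ξ)^2)) := by
          gcongr
          refine h1.trans ?_
          gcongr; exact le_abs_self C
      _ = _ := by ring
  refine (MeasureTheory.norm_integral_le_of_norm_le (maj_int.const_mul _) (Eventually.of_forall hbd)).trans ?_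
  rw [MeasureTheory.integral_const_mul]
  apply le_of_eq; ring

lemma abel_ineq {E : Type*} [NormedAddCommGroup E] [NormedSpace ℝ E] (f : ℕ → ℝ) (d : ℕ → E)
    (a b : ℕ) (K : ℝ) (hf : ∀ i, a < i → i < b → f (i+1) ≤ f i) (hf0 : 0 ≤ f b)
    (hab : a < b) (hK : ∀ j, a < j → j ≤ b → ‖∑ i ∈ Ioc a j, d i‖ ≤ K) :
    ‖∑ i ∈ Ioc a b, f i • d i‖ ≤ K * f (a+1) := by
  have key : ∀ j, a + 1 ≤ j → j ≤ b →
      ‖∑ i ∈ Ioc a j, f i • d i - f j • ∑ i ∈ Ioc a j, d i‖ ≤ K * (f (a+1) - f j) := by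
    intro j hj
    induction j, hj using Nat.le_induction with
    | base => intro _; simp
    | succ j hj ih =>
      intro hjb
      have ih' := ih (by omega)
      have hD := hK j (by omega) (by omega)
      have hm := hf j (by omega) (by omega)
      rw [Finset.sum_Ioc_succ_top (by omega), Finset.sum_Ioc_succ_top (by omega)]
      have e : ∑ i ∈ Ioc a j, f i • d i + f (j+1) • d (j+1) - f (j+1) • (∑ i ∈ Ioc a j, d i + d (j+1))
        = (∑ i ∈ Ioc a j, f i • d i - f j • ∑ i ∈ Ioc a j, d i) + (f j - f (j+1)) • ∑ i ∈ Ioc a j, d i := by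
        rw [smul_add, sub_smul]; abel
      rw [e]
      refine (norm_add_le _ _).trans ?_
      rw [norm_smul, Real.norm_of_nonneg (by linarith)]
      have := mul_le_mul_of_nonneg_left hD (show 0 ≤ f j - f (j+1) by linarith)
      linarith
  have h1 := key b hab le_rfl
  have h2 := hK b hab le_rfl
  have h3 : ‖f b • ∑ i ∈ Ioc a b, d i‖ ≤ f b * K := by
    rw [norm_smul, Real.norm_of_nonneg hf0]; gcongr
  calc _ = ‖(∑ i ∈ Ioc a b, f i • d i - f b • ∑ i ∈ Ioc a b, d i) + f b • ∑ i ∈ Ioc a b, d i‖ := by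
        rw [sub_add_cancel]
    _ ≤ K * (f (a+1) - f b) + f b * K := (norm_add_le _ _).trans (by linarith)
    _ = _ := by ring

lemma Lg_pow_le (m : ℕ) : ∃ C : ℝ, 0 < C ∧ ∀ x : ℝ, 1 ≤ x → (1 + Real.log x) ^ m ≤ C * x := by
  refine ⟨(1 + m) ^ m, by positivity, fun x hx => ?_⟩
  rcases Nat.eq_zero_or_pos m with rfl | hm
  · simpa using hx
  have hx0 : 0 < x := by linarith
  have hm' : (0:ℝ) < m := by exact_mod_cast hm
  have h := Real.log_le_rpow_div hx0.le (ε := 1/m) (by positivity)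
  have h1 : (1:ℝ) ≤ x^(1/(m:ℝ)) := Real.one_le_rpow hx (by positivity)
  have h0 : 0 ≤ Real.log x := Real.log_nonneg hx
  calc (1 + Real.log x)^m ≤ ((1 + m) * x^(1/(m:ℝ)))^m := by
        gcongr
        have : x ^ (1/(m:ℝ)) / (1/(m:ℝ)) = m * x^(1/(m:ℝ)) := by field_simp
        rw [this] at h; linarith
    _ = (1+m)^m * x := by
      rw [mul_pow, ← Real.rpow_natCast (x^(1/(m:ℝ))), ← Real.rpow_mul hx0.le,
        one_div, inv_mul_cancel₀ hm'.ne', Real.rpow_one]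

lemma V_bound (c : ℕ → ℂ) (hc : ∀ n, ‖c n‖ ≤ 1 + Real.log n) (hD : DB (LSeries c)) (m : ℕ) :
    ∃ C : ℝ, 0 ≤ C ∧ ∀ x : ℝ, 3 ≤ x →
      ‖∑ n ∈ Icc 1 ⌊x⌋₊, ((Real.log n : ℝ) : ℂ) ^ (2*m+1) * c n‖ ≤ C * x * (1 + Real.log x) ^ (m+1) := by
  obtain ⟨C, hC0, hC⟩ := smooth_bound c hc hD (2*m+1)
  obtain ⟨C1, hC1, hC1'⟩ := Lg_pow_le (m+1)
  refine ⟨C * Real.exp 1 + C + 2 * 2^(2*m+2) + 2^(2*m+2) * C1, by positivity, fun x hx => ?_⟩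
  have hx0 : 0 < x := by linarith
  set Lg := 1 + Real.log x with hLg
  have hl : 1 ≤ Real.log x := by
    rw [Real.le_log_iff_exp_le hx0]; linarith [Real.exp_one_lt_d9]
  have hLg1 : 1 ≤ Lg := by linarith
  set h : ℝ := (Lg ^ (m+1))⁻¹ with hh
  have hh0 : 0 < h := by positivity
  have hh1 : h ≤ 1 := inv_le_one_of_one_le₀ (one_le_pow₀ hLg1)
  set y := x * Real.exp h with hy
  have hxy : x ≤ y := by rw [hy]; nlinarith [Real.one_le_exp hh0.le]
  have hy0 : 0 < y := by linarith
  set d : ℕ → ℂ := fun n => ((Real.log n : ℝ) : ℂ) ^ (2*m+1) * c n with hd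
  have hfl : ⌊x⌋₊ ≤ ⌊y⌋₊ := Nat.floor_mono hxy
  have hex : Real.exp h ≤ 1 + 2 * h := by
    have := (abs_le.1 (Real.abs_exp_sub_one_le (x := h) (by rw [abs_of_pos hh0]; exact hh1))).2
    rw [abs_of_pos hh0] at this; linarith
  have hylog : Real.log y = Real.log x + h := by
    rw [hy, Real.log_mul hx0.ne' (Real.exp_pos _).ne', Real.log_exp]
  have hsplit : ∑ n ∈ Icc 1 ⌊y⌋₊, d n * ((Real.log (y/n) : ℝ):ℂ) =
      ∑ n ∈ Icc 1 ⌊x⌋₊, d n * ((Real.log (x/n) : ℝ):ℂ) + h * ∑ n ∈ Icc 1 ⌊x⌋₊, d n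
        + ∑ n ∈ Ioc ⌊x⌋₊ ⌊y⌋₊, d n * ((Real.log (y/n) : ℝ):ℂ) := by
    have e1 : ∀ N : ℕ, Icc 1 N = Ioc 0 N := fun N => by ext; simp [Nat.succ_le_iff]
    rw [e1, e1, ← Finset.sum_Ioc_consecutive _ (Nat.zero_le _) hfl, Finset.mul_sum, ← Finset.sum_add_distrib]
    congr 1
    refine Finset.sum_congr rfl fun n hn => ?_
    have hn0 : (0:ℝ) < n := by exact_mod_cast (mem_Ioc.1 hn).1
    rw [Real.log_div hy0.ne' hn0.ne', Real.log_div hx0.ne' hn0.ne', hylog]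
    push_cast; ring
  have hB1 := hC y (by linarith)
  have hB2 := hC x hx
  have hy3 : y ≤ x * Real.exp 1 := by rw [hy]; gcongr
  have htail : ‖∑ n ∈ Ioc ⌊x⌋₊ ⌊y⌋₊, d n * ((Real.log (y/n) : ℝ):ℂ)‖ ≤
      (2 * h * x + 1) * ((2 * Lg)^(2*m+2) * h) := by
    refine (norm_sum_le_of_le (f := fun n => d n * ((Real.log (y/n) : ℝ):ℂ)) _ (n := fun _ => (2 * Lg)^(2*m+2) * h) fun n hn => ?_).trans ?_
    · rw [mem_Ioc, Nat.floor_lt hx0.le, Nat.le_floor_iff hy0.le] at hn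
      have hn1 : (1:ℝ) ≤ n := by linarith
      have hn0 : (0:ℝ) < n := by linarith
      have hln : 0 ≤ Real.log n := Real.log_nonneg hn1
      have hln2 : Real.log n ≤ Real.log y := Real.log_le_log hn0 hn.2
      have hlt : 1 + Real.log n ≤ 2 * Lg := by rw [hylog] at hln2; linarith
      rw [norm_mul, hd]
      simp only [norm_mul, norm_pow, Complex.norm_real]
      rw [Real.norm_of_nonneg hln]
      have h1 : ‖Real.log (y/n)‖ ≤ h := by
        have := Real.log_le_log hx0 hn.1.le
        rw [Real.log_div hy0.ne' hn0.ne', hylog, Real.norm_of_nonneg (by linarith)]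
        linarith
      have h2 : Real.log n ^ (2*m+1) * ‖c n‖ ≤ (2*Lg)^(2*m+2) := by
        rw [pow_succ (2*Lg)]
        gcongr
        · linarith
        · exact (hc n).trans hlt
      gcongr
    · rw [Finset.sum_const, Nat.card_Ioc, nsmul_eq_mul, Nat.cast_sub hfl]
      gcongr
      have h1 := Nat.floor_le hy0.le
      have h2 := Nat.lt_floor_add_one x
      have : y ≤ x + 2 * h * x := by rw [hy]; nlinarith
      linarith
  have hmain : ‖(h:ℂ) * ∑ n ∈ Icc 1 ⌊x⌋₊, d n‖ ≤ C * (x * Real.exp 1) + C * x + (2 * h * x + 1) * ((2 * Lg)^(2*m+2) * h) := by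
    have e : (h:ℂ) * ∑ n ∈ Icc 1 ⌊x⌋₊, d n = ∑ n ∈ Icc 1 ⌊y⌋₊, d n * ((Real.log (y/n) : ℝ):ℂ)
       - ∑ n ∈ Icc 1 ⌊x⌋₊, d n * ((Real.log (x/n) : ℝ):ℂ) - ∑ n ∈ Ioc ⌊x⌋₊ ⌊y⌋₊, d n * ((Real.log (y/n) : ℝ):ℂ) := by
      rw [hsplit]; ring
    rw [e]
    refine (norm_sub_le _ _).trans (add_le_add ((norm_sub_le _ _).trans (add_le_add ?_ hB2)) htail)
    exact hB1.trans (by gcongr)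
  rw [norm_mul, Complex.norm_real, Real.norm_of_nonneg hh0.le, mul_comm, ← le_div_iff₀ hh0] at hmain
  refine hmain.trans ?_
  have hhL : h * Lg^(m+1) = 1 := by rw [hh]; exact inv_mul_cancel₀ (by positivity)
  have e1 : (C * (x * Real.exp 1) + C * x + (2 * h * x + 1) * ((2 * Lg)^(2*m+2) * h)) / h
     = (C * (x * Real.exp 1) + C * x) * Lg^(m+1) + 2 * x * 2^(2*m+2) * Lg^(m+1)
       + 2^(2*m+2) * Lg^(m+1) * Lg^(m+1) := by
    rw [div_eq_iff hh0.ne']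
    have e2 : Lg^(2*m+2) = Lg^(m+1) * Lg^(m+1) := by ring
    rw [mul_pow, e2]
    set q := Lg^(m+1)
    linear_combination (-(C * (x * Real.exp 1) + C * x) + 2 * h * x * 2^(2*m+2) * q)  * hhL
  rw [e1]
  have := hC1' x (by linarith)
  have h3 : 2^(2*m+2) * Lg^(m+1) * Lg^(m+1) ≤ 2^(2*m+2) * Lg^(m+1) * (C1 * x) := by gcongr
  calc _ ≤ (C * (x * Real.exp 1) + C * x) * Lg^(m+1) + 2 * x * 2^(2*m+2) * Lg^(m+1)
       + 2^(2*m+2) * Lg^(m+1) * (C1 * x) := by gcongr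
    _ = _ := by ring

lemma triv_sum (c : ℕ → ℂ) (hc : ∀ n, ‖c n‖ ≤ 1 + Real.log n) (N : ℕ) (x : ℝ) (hN : (N:ℝ) ≤ x) (hx : 1 ≤ x) :
    ‖∑ n ∈ Icc 1 N, c n‖ ≤ N * (1 + Real.log x) := by
  refine (norm_sum_le_of_le (n := fun _ => 1 + Real.log x) _ fun n hn => ?_).trans ?_
  · have hn' := mem_Icc.1 hn
    refine (hc n).trans ?_
    have : (n:ℝ) ≤ N := by exact_mod_cast hn'.2
    have := Real.log_le_log (by exact_mod_cast hn'.1) (this.trans hN)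
    linarith
  · simp; linarith

lemma tauber (c : ℕ → ℂ) (hc : ∀ n, ‖c n‖ ≤ 1 + Real.log n) (hD : DB (LSeries c)) (m : ℕ) :
    ∃ C : ℝ, 0 ≤ C ∧ ∀ x : ℝ, 1 ≤ x →
      ‖∑ n ∈ Icc 1 ⌊x⌋₊, c n‖ ≤ C * x / (1 + Real.log x) ^ m := by
  obtain ⟨C, hC0, hC⟩ := V_bound c hc hD m
  obtain ⟨C1, hC1, hC1'⟩ := Lg_pow_le (2*m+2)
  set A := (1 + Real.log 16)^(m+1) with hA
  have hl16 : 0 ≤ Real.log 16 := Real.log_nonneg (by norm_num)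
  refine ⟨A + (C1 + 2 * C * 4^(2*m+1)), by positivity, fun x hx => ?_⟩
  have hx0 : 0 < x := by linarith
  have hl0 : 0 ≤ Real.log x := Real.log_nonneg hx
  set Lg := 1 + Real.log x with hLg
  have hLg1 : 1 ≤ Lg := by linarith
  rw [le_div_iff₀ (by positivity)]
  rcases lt_or_ge x 16 with hx16 | hx16
  · have h1 := triv_sum c hc ⌊x⌋₊ x (Nat.floor_le hx0.le) hx
    have h2 : Lg^(m+1) ≤ A := by
      rw [hA]; gcongr; rw [hLg]; gcongr
    calc _ ≤ (⌊x⌋₊ * Lg) * Lg^m := by gcongr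
      _ = ⌊x⌋₊ * Lg^(m+1) := by ring
      _ ≤ x * A := by gcongr; exact Nat.floor_le hx0.le
      _ ≤ _ := by
        have : 0 ≤ (C1 + 2 * C * 4^(2*m+1)) * x := by positivity
        linarith
  · set z := Real.sqrt x with hz
    have hz4 : 4 ≤ z := by rw [hz]; apply Real.le_sqrt_of_sq_le; linarith
    have hzz : z * z = x := Real.mul_self_sqrt hx0.le
    have hzx : z ≤ x := by nlinarith
    set a := ⌊z⌋₊ with ha
    set b := ⌊x⌋₊ with hb
    have hab : a < b := by
      rw [ha, hb, Nat.floor_lt (by linarith)]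
      have := Nat.lt_floor_add_one x
      nlinarith
    have haz : (a:ℝ) ≤ z := Nat.floor_le (by linarith)
    have hlz : Real.log z = Real.log x / 2 := by rw [hz, Real.log_sqrt hx0.le]
    have hl1 : 1 ≤ Real.log x := by
      rw [Real.le_log_iff_exp_le hx0]; linarith [Real.exp_one_lt_d9]
    have e1 : ∀ N : ℕ, Icc 1 N = Ioc 0 N := fun N => by ext; simp [Nat.succ_le_iff]
    set d : ℕ → ℂ := fun n => ((Real.log n : ℝ) : ℂ) ^ (2*m+1) * c n with hd
    have hV : ∀ j, a ≤ j → j ≤ b → ‖∑ n ∈ Ioc 0 j, d n‖ ≤ C * x * Lg^(m+1) := by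
      intro j hj hjb
      have hj3 : (3:ℝ) ≤ j := by
        have h4 : 4 ≤ a := Nat.le_floor (by exact_mod_cast hz4)
        have : 3 ≤ j := by omega
        exact_mod_cast this
      have h1 := hC j hj3
      rw [Nat.floor_natCast, e1] at h1
      have hjx : (j:ℝ) ≤ x := le_trans (by exact_mod_cast hjb) (Nat.floor_le hx0.le)
      have : Real.log j ≤ Real.log x := Real.log_le_log (by linarith) hjx
      have : 0 ≤ Real.log j := Real.log_nonneg (by linarith)
      refine h1.trans ?_
      rw [hLg]
      gcongr
    have hK : ∀ j, a < j → j ≤ b → ‖∑ n ∈ Ioc a j, d n‖ ≤ 2 * (C * x * Lg^(m+1)) := by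
      intro j hj hjb
      have : ∑ n ∈ Ioc a j, d n = ∑ n ∈ Ioc 0 j, d n - ∑ n ∈ Ioc 0 a, d n := by
        rw [← Finset.sum_Ioc_consecutive _ (Nat.zero_le a) hj.le]; ring
      rw [this]
      refine (norm_sub_le _ _).trans ?_
      have := hV j hj.le hjb
      have := hV a le_rfl hab.le
      linarith
    set f : ℕ → ℝ := fun n => ((Real.log n)^(2*m+1))⁻¹ with hf
    have ha4 : 4 ≤ a := Nat.le_floor (by exact_mod_cast hz4)
    have hlogpos : ∀ i : ℕ, 2 ≤ i → 0 < Real.log i := fun i hi => Real.log_pos (by exact_mod_cast hi)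
    have hAb := abel_ineq f d a b _ (fun i hi hib => by
      have := hlogpos i (by omega)
      have h2 : Real.log i ≤ Real.log ((i+1:ℕ):ℝ) := Real.log_le_log (by exact_mod_cast (by omega : 0 < i)) (by push_cast; linarith)
      simp only [hf]; gcongr) (by
      have := hlogpos b (by omega)
      simp only [hf]; positivity) hab hK
    have hcd : ∑ i ∈ Ioc a b, f i • d i = ∑ i ∈ Ioc a b, c i := by
      refine Finset.sum_congr rfl fun i hi => ?_
      have := hlogpos i (by have := (mem_Ioc.1 hi).1; omega)
      simp only [hf, hd, Complex.real_smul]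
      have h2 : ((Real.log i : ℝ) : ℂ) ≠ 0 := by exact_mod_cast this.ne'
      push_cast
      rw [Complex.natCast_log] at h2
      field_simp
    rw [hcd] at hAb
    have hfa : f (a+1) ≤ 4^(2*m+1) / Lg^(2*m+1) := by
      have h1 : z < (a+1:ℕ) := by push_cast; exact Nat.lt_floor_add_one z
      have h2 : Lg / 4 ≤ Real.log ((a+1:ℕ):ℝ) := by
        have := Real.log_le_log (by linarith) h1.le
        rw [hlz] at this; rw [hLg]; linarith
      simp only [hf]
      rw [← div_pow, ← inv_pow]
      gcongr
      rw [show 4 / Lg = (Lg/4)⁻¹ by rw [inv_div]]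
      gcongr
    have hA2 : ‖∑ n ∈ Ioc a b, c n‖ * Lg^m ≤ 2 * C * 4^(2*m+1) * x := by
      calc _ ≤ (2 * (C * x * Lg^(m+1)) * (4^(2*m+1) / Lg^(2*m+1))) * Lg^m := by
            gcongr; exact hAb.trans (by gcongr)
        _ = _ := by
          have : Lg^(2*m+1) = Lg^(m+1) * Lg^m := by ring
          rw [this]; field_simp
    have hA1 : ‖∑ n ∈ Ioc 0 a, c n‖ * Lg^m ≤ C1 * x := by
      have h1 := triv_sum c hc a x (haz.trans hzx) hx
      rw [e1] at h1
      have h2 := hC1' x hx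
      have h3 : Lg^(m+1) ≤ C1 * z := by
        have hq := hC1' z (by linarith)
        obtain ⟨C2, hC2, hC2'⟩ := Lg_pow_le (m+1)
        by_contra hcon
        push Not at hcon
        have : (C1 * z)^2 < (Lg^(m+1))^2 := by gcongr
        have e : (Lg^(m+1))^2 = Lg^(2*m+2) := by ring
        rw [e] at this
        have hC11 : 1 ≤ C1 := by have := hC1' 1 le_rfl; simpa using this
        have : (C1*z)^2 = C1 * (C1 * x) := by rw [← hzz]; ring
        have : C1 * x ≤ C1 * (C1 * x) := le_mul_of_one_le_left (by positivity) hC11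
        linarith
      calc _ ≤ (a * Lg) * Lg^m := by gcongr
        _ = a * Lg^(m+1) := by ring
        _ ≤ z * (C1 * z) := by gcongr
        _ = C1 * x := by rw [← hzz]; ring
    have : ‖∑ n ∈ Icc 1 b, c n‖ ≤ ‖∑ n ∈ Ioc 0 a, c n‖ + ‖∑ n ∈ Ioc a b, c n‖ := by
      rw [e1, ← Finset.sum_Ioc_consecutive _ (Nat.zero_le a) hab.le]
      exact norm_add_le _ _
    have hA0 : 0 ≤ A * x := by rw [hA]; positivity
    calc _ ≤ (‖∑ n ∈ Ioc 0 a, c n‖ + ‖∑ n ∈ Ioc a b, c n‖) * Lg^m := by gcongr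
      _ ≤ C1 * x + 2 * C * 4^(2*m+1) * x := by rw [add_mul]; linarith
      _ ≤ _ := by linarith

lemma M_bound (m : ℕ) : ∃ C : ℝ, 0 ≤ C ∧ ∀ x : ℝ, 1 ≤ x →
    |∑ n ∈ Icc 1 ⌊x⌋₊, (ArithmeticFunction.moebius n : ℝ)| ≤ C * x / (1 + Real.log x) ^ m := by
  obtain ⟨C, h0, h⟩ := tauber _ (fun n => by
    rcases eq_or_ne n 0 with rfl | hn
    · simp
    have h1 : ‖((ArithmeticFunction.moebius n : ℤ) : ℂ)‖ ≤ 1 := by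
      rw [Complex.norm_intCast]
      exact_mod_cast ArithmeticFunction.abs_moebius_le_one
    have : 0 ≤ Real.log n := Real.log_nonneg (by exact_mod_cast Nat.one_le_iff_ne_zero.2 hn)
    linarith) DB_moebius m
  refine ⟨C, h0, fun x hx => ?_⟩
  have := h x hx
  have e : (∑ n ∈ Icc 1 ⌊x⌋₊, ((ArithmeticFunction.moebius n : ℤ) : ℂ)) =
    ((∑ n ∈ Icc 1 ⌊x⌋₊, (ArithmeticFunction.moebius n : ℝ) : ℝ) : ℂ) := by push_cast; rfl
  rw [e, Complex.norm_real, Real.norm_eq_abs] at this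
  exact this

lemma psi_bound (m : ℕ) : ∃ C : ℝ, 0 ≤ C ∧ ∀ x : ℝ, 1 ≤ x →
    |∑ n ∈ Icc 1 ⌊x⌋₊, (ArithmeticFunction.vonMangoldt n - 1)| ≤ C * x / (1 + Real.log x) ^ m := by
  obtain ⟨C, h0, h⟩ := tauber _ (fun n => by
    have h1 := ArithmeticFunction.vonMangoldt_le_log (n := n)
    have h2 := ArithmeticFunction.vonMangoldt_nonneg (n := n)
    rw [Complex.norm_real, Real.norm_eq_abs, abs_le]
    constructor <;> linarith) DB_lambda m
  refine ⟨C, h0, fun x hx => ?_⟩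
  have := h x hx
  have e : (∑ n ∈ Icc 1 ⌊x⌋₊, ((ArithmeticFunction.vonMangoldt n - 1 : ℝ) : ℂ)) =
    ((∑ n ∈ Icc 1 ⌊x⌋₊, (ArithmeticFunction.vonMangoldt n - 1 : ℝ) : ℝ) : ℂ) := by push_cast; rfl
  rw [e, Complex.norm_real, Real.norm_eq_abs] at this
  exact this

noncomputable def sg (s : ℝ) (n : ℕ) : ℝ := s ^ (ArithmeticFunction.cardFactors n)

lemma sg_mul (s : ℝ) {m n : ℕ} (hm : m ≠ 0) (hn : n ≠ 0) : sg s (m * n) = sg s m * sg s n := by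
  unfold sg; rw [ArithmeticFunction.cardFactors_mul hm hn, pow_add]

lemma sg_one_left (n : ℕ) : sg 1 n = 1 := by simp [sg]

lemma sg_abs {s : ℝ} (hs : s = 1 ∨ s = -1) (n : ℕ) : |sg s n| = 1 := by
  unfold sg; rcases hs with rfl | rfl <;> simp [abs_pow]

lemma sg_sq {s : ℝ} (hs : s = 1 ∨ s = -1) (n : ℕ) : sg s n * sg s n = 1 := by
  rw [← abs_mul_abs_self, sg_abs hs]; norm_num

lemma sg_prime (s : ℝ) {p : ℕ} (hp : p.Prime) : sg s p = s := by
  simp [sg, ArithmeticFunction.cardFactors_apply_prime hp]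

lemma moebius_real (n : ℕ) : (ArithmeticFunction.moebius n : ℝ) =
    (if Squarefree n then 1 else 0) * sg (-1) n := by
  split_ifs with h
  · rw [ArithmeticFunction.moebius_apply_of_squarefree h]; simp [sg]
  · rw [ArithmeticFunction.moebius_eq_zero_of_not_squarefree h]; simp

lemma sum_mult (g : ℕ → ℝ) (N q : ℕ) (hq : 0 < q) :
    ∑ n ∈ (Icc 1 N).filter (fun n => q ∣ n), g n = ∑ m ∈ Icc 1 (N / q), g (q * m) := by
  symm
  refine Finset.sum_bij (fun m _ => q * m) ?_ ?_ ?_ ?_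
  · intro m hm
    rw [mem_Icc] at hm
    rw [mem_filter, mem_Icc]
    refine ⟨⟨Nat.mul_pos hq hm.1, ?_⟩, dvd_mul_right _ _⟩
    calc q * m ≤ q * (N / q) := Nat.mul_le_mul_left _ hm.2
      _ ≤ N := Nat.mul_div_le _ _
  · intro a _ b _ h; exact Nat.eq_of_mul_eq_mul_left hq h
  · intro n hn
    rw [mem_filter, mem_Icc] at hn
    obtain ⟨m, rfl⟩ := hn.2
    refine ⟨m, ?_, rfl⟩
    rw [mem_Icc]
    refine ⟨Nat.pos_of_mul_pos_left hn.1.1, ?_⟩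
    rw [Nat.le_div_iff_mul_le hq, mul_comm]; exact hn.1.2
  · intro m _; rfl

lemma sqdvd_iff {a b k : ℕ} (ha : Squarefree a) (hb : 0 < b) : k ^ 2 ∣ b ^ 2 * a ↔ k ∣ b := by
  constructor
  · intro h
    have hb0 : b ≠ 0 := hb.ne'
    have ha0 : a ≠ 0 := ha.ne_zero
    have hk0 : k ≠ 0 := by
      rintro rfl
      rw [zero_pow two_ne_zero, zero_dvd_iff] at h
      exact (mul_ne_zero (pow_ne_zero 2 hb0) ha0) h
    rw [← Nat.factorization_le_iff_dvd hk0 hb0]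
    rw [← Nat.factorization_le_iff_dvd (pow_ne_zero 2 hk0) (mul_ne_zero (pow_ne_zero 2 hb0) ha0)] at h
    intro p
    have h1 := h p
    have h2 := ha.natFactorization_le_one p
    rw [Nat.factorization_mul (pow_ne_zero 2 hb0) ha0, Nat.factorization_pow, Nat.factorization_pow] at h1
    simp at h1
    omega
  · intro h
    exact Dvd.dvd.mul_right (pow_dvd_pow_of_dvd h 2) a

lemma sqfree_sum (N n : ℕ) (hn : n ∈ Icc 1 N) :
    (if Squarefree n then (1:ℝ) else 0) =
      ∑ k ∈ (Icc 1 N).filter (fun k => k ^ 2 ∣ n), (ArithmeticFunction.moebius k : ℝ) := by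
  rw [mem_Icc] at hn
  obtain ⟨a, b, ha, hb, hab, hsq⟩ := Nat.sq_mul_squarefree_of_pos hn.1
  have hset : (Icc 1 N).filter (fun k => k ^ 2 ∣ n) = b.divisors := by
    ext k
    rw [mem_filter, mem_Icc, Nat.mem_divisors, ← hab, sqdvd_iff hsq hb]
    constructor
    · rintro ⟨_, h⟩; exact ⟨h, hb.ne'⟩
    · rintro ⟨h, _⟩
      refine ⟨⟨Nat.pos_of_dvd_of_pos h hb, ?_⟩, h⟩
      have h1 := Nat.le_of_dvd hb h
      have h2 : b ≤ b ^ 2 * a := by nlinarith [Nat.mul_le_mul hb ha]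
      omega
  rw [hset]
  have h1 := ArithmeticFunction.coe_mul_zeta_apply (f := ArithmeticFunction.moebius) (x := b)
  rw [ArithmeticFunction.moebius_mul_coe_zeta, ArithmeticFunction.one_apply] at h1
  have h2 : ((∑ k ∈ b.divisors, ArithmeticFunction.moebius k : ℤ) : ℝ) = ∑ k ∈ b.divisors, (ArithmeticFunction.moebius k : ℝ) := by push_cast; rfl
  rw [← h2, ← h1]
  have : Squarefree n ↔ b = 1 := by
    rw [← hab]
    constructor
    · intro h
      have := h b ⟨a, by ring⟩
      exact Nat.isUnit_iff.1 this
    · rintro rfl; simpa using hsq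
  by_cases hb1 : b = 1
  · simp [this, hb1]
  · simp [this, hb1]

lemma lam_sum (N n : ℕ) (hn : n ∈ Icc 1 N) :
    sg (-1) n = ∑ k ∈ (Icc 1 N).filter (fun k => k ^ 2 ∣ n), (ArithmeticFunction.moebius (n / k ^ 2) : ℝ) := by
  rw [mem_Icc] at hn
  obtain ⟨a, b, ha, hb, hab, hsq⟩ := Nat.sq_mul_squarefree_of_pos hn.1
  rw [Finset.sum_eq_single_of_mem b]
  · rw [← hab, Nat.mul_div_cancel_left _ (by positivity), moebius_real, if_pos hsq, one_mul,
      sg_mul _ (by positivity) ha.ne', pow_two, sg_mul _ hb.ne' hb.ne', sg_sq (Or.inr rfl), one_mul]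
  · rw [mem_filter, mem_Icc]
    refine ⟨⟨hb, ?_⟩, ⟨a, hab.symm⟩⟩
    have h2 : b ≤ b ^ 2 * a := by nlinarith [Nat.mul_le_mul hb ha]
    omega
  · intro k hk hkb
    rw [mem_filter, mem_Icc] at hk
    have hkd : k ∣ b := by
      have := hk.2
      rw [← hab] at this
      exact (sqdvd_iff hsq hb).1 this
    obtain ⟨l, rfl⟩ := hkd
    have hl : l ≠ 1 := by rintro rfl; simp at hkb
    have : n / k ^ 2 = l * l * a := by
      rw [← hab]
      apply Nat.div_eq_of_eq_mul_right (by have := hk.1.1; positivity); ring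
    rw [this, ArithmeticFunction.moebius_eq_zero_of_not_squarefree]
    · simp
    · intro h
      exact hl (Nat.isUnit_iff.1 (h l ⟨a, rfl⟩))

lemma L_eq (N : ℕ) : ∑ n ∈ Icc 1 N, sg (-1) n =
    ∑ k ∈ Icc 1 N, ∑ m ∈ Icc 1 (N / k ^ 2), (ArithmeticFunction.moebius m : ℝ) := by
  rw [Finset.sum_congr rfl (fun n hn => lam_sum N n hn)]
  simp_rw [Finset.sum_filter]
  rw [Finset.sum_comm]
  refine Finset.sum_congr rfl fun k hk => ?_
  have hk1 := (mem_Icc.1 hk).1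
  rw [← Finset.sum_filter, sum_mult (fun n => (ArithmeticFunction.moebius (n / k ^ 2) : ℝ)) N (k^2) (by positivity)]
  refine Finset.sum_congr rfl fun m _ => ?_
  rw [Nat.mul_div_cancel_left _ (by positivity)]

lemma Lg_div (x q : ℝ) (hq : 1 ≤ q) (hqx : q ≤ x) :
    1 + Real.log x ≤ (1 + Real.log (x / q)) * (1 + Real.log q) := by
  have h1 : 0 ≤ Real.log q := Real.log_nonneg hq
  have h2 : 0 ≤ Real.log (x / q) := Real.log_nonneg ((one_le_div (by linarith)).2 hqx)
  have h3 : Real.log x = Real.log (x/q) + Real.log q := by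
    have hx0 : 0 < x := by linarith
    rw [← Real.log_mul (by positivity) (by positivity), div_mul_cancel₀ _ (by positivity)]
  nlinarith [mul_nonneg h1 h2]

lemma L_bound (m : ℕ) : ∃ C : ℝ, 0 ≤ C ∧ ∀ x : ℝ, 1 ≤ x →
    |∑ n ∈ Icc 1 ⌊x⌋₊, sg (-1) n| ≤ C * x / (1 + Real.log x) ^ m := by
  obtain ⟨C, hC0, hC⟩ := M_bound m
  obtain ⟨C1, hC1, hC1'⟩ := Lg_pow_le (2*m)
  have hsum : Summable (fun k : ℕ => 1 / (k:ℝ) ^ (3/2:ℝ)) := Real.summable_one_div_nat_rpow.2 (by norm_num)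
  set S := ∑' k : ℕ, 1 / (k:ℝ) ^ (3/2:ℝ) with hS
  have hS0 : 0 ≤ S := tsum_nonneg fun k => by positivity
  refine ⟨C * 2^m * Real.sqrt C1 * S, by positivity, fun x hx => ?_⟩
  have hx0 : 0 < x := by linarith
  have hl0 : 0 ≤ Real.log x := Real.log_nonneg hx
  rw [L_eq, le_div_iff₀ (by positivity)]
  have hterm : ∀ k ∈ Icc 1 ⌊x⌋₊, |∑ m ∈ Icc 1 (⌊x⌋₊ / k ^ 2), (ArithmeticFunction.moebius m : ℝ)| * (1 + Real.log x)^m ≤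
      C * 2^m * Real.sqrt C1 * x * (1 / (k:ℝ) ^ (3/2:ℝ)) := by
    intro k hk
    have hk1 : (1:ℝ) ≤ k := by exact_mod_cast (mem_Icc.1 hk).1
    have hk0 : (0:ℝ) < k := by linarith
    have hf : ⌊x⌋₊ / k^2 = ⌊x / (k:ℝ)^2⌋₊ := by
      rw [← Nat.floor_div_natCast]; push_cast; rfl
    rcases lt_or_ge x ((k:ℝ)^2) with h | h
    · have : ⌊x / (k:ℝ)^2⌋₊ = 0 := Nat.floor_eq_zero.2 ((div_lt_one (by positivity)).2 h)
      rw [hf, this]; simp; positivity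
    · have hk2 : (1:ℝ) ≤ (k:ℝ)^2 := one_le_pow₀ hk1
      have h1 := hC (x / (k:ℝ)^2) ((one_le_div (by positivity)).2 h)
      rw [← hf] at h1
      have h2 := Lg_div x ((k:ℝ)^2) hk2 h
      have hlk : 0 ≤ Real.log k := Real.log_nonneg hk1
      have hlq : 0 ≤ Real.log (x / (k:ℝ)^2) := Real.log_nonneg ((one_le_div (by positivity)).2 h)
      rw [Real.log_pow] at h2
      push_cast at h2
      have h3 : 1 + Real.log x ≤ (1 + Real.log (x/(k:ℝ)^2)) * (2 * (1 + Real.log k)) := by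
        refine h2.trans ?_
        gcongr; linarith
      have h4 : (1 + Real.log k)^m ≤ Real.sqrt C1 * (k:ℝ)^(1/2:ℝ) := by
        rw [← Real.sqrt_eq_rpow, ← Real.sqrt_mul hC1.le]
        apply Real.le_sqrt_of_sq_le
        rw [← pow_mul, mul_comm m 2]; exact hC1' k hk1
      calc _ ≤ (C * (x / (k:ℝ)^2) / (1 + Real.log (x / (k:ℝ)^2))^m) * ((1 + Real.log (x/(k:ℝ)^2)) * (2 * (1 + Real.log k)))^m := by
            gcongr
        _ = C * 2^m * (x / (k:ℝ)^2) * (1 + Real.log k)^m := by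
            rw [mul_pow, mul_pow]; field_simp
        _ ≤ C * 2^m * (x / (k:ℝ)^2) * (Real.sqrt C1 * (k:ℝ)^(1/2:ℝ)) := by gcongr
        _ = _ := by
          have : (k:ℝ)^(3/2:ℝ) * (k:ℝ)^(1/2:ℝ) = (k:ℝ)^2 := by
            rw [← Real.rpow_add hk0, ← Real.rpow_natCast]; norm_num
          rw [← this]
          have hp := Real.rpow_pos_of_pos hk0 (1/2)
          field_simp
  calc _ ≤ (∑ k ∈ Icc 1 ⌊x⌋₊, |∑ m ∈ Icc 1 (⌊x⌋₊ / k ^ 2), (ArithmeticFunction.moebius m : ℝ)|) * (1 + Real.log x)^m := by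
        gcongr; exact Finset.abs_sum_le_sum_abs _ _
    _ ≤ ∑ k ∈ Icc 1 ⌊x⌋₊, C * 2^m * Real.sqrt C1 * x * (1 / (k:ℝ) ^ (3/2:ℝ)) := by
        rw [Finset.sum_mul]; exact Finset.sum_le_sum hterm
    _ ≤ C * 2^m * Real.sqrt C1 * x * S := by
        rw [← Finset.mul_sum]
        gcongr
        exact hsum.sum_le_tsum _ (fun k _ => by positivity)
    _ = _ := by ring

lemma L_mult (m : ℕ) : ∃ C : ℝ, 0 ≤ C ∧ ∀ (x : ℝ) (q : ℕ), 1 ≤ q → (q:ℝ) ≤ x →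
    |∑ n ∈ (Icc 1 ⌊x⌋₊).filter (fun n => q ∣ n), sg (-1) n| ≤ C * (x / q) / (1 + Real.log (x / q)) ^ m := by
  obtain ⟨C, hC0, hC⟩ := L_bound m
  refine ⟨C, hC0, fun x q hq hqx => ?_⟩
  have hq0 : (0:ℝ) < q := by exact_mod_cast hq
  rw [sum_mult _ _ _ hq]
  have : ∑ n ∈ Icc 1 (⌊x⌋₊ / q), sg (-1) (q * n) = sg (-1) q * ∑ n ∈ Icc 1 (⌊x⌋₊ / q), sg (-1) n := by
    rw [Finset.mul_sum]
    refine Finset.sum_congr rfl fun n hn => sg_mul _ (by omega) ?_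
    have := (mem_Icc.1 hn).1; omega
  rw [this, abs_mul, sg_abs (Or.inr rfl), one_mul, ← Nat.floor_div_natCast]
  exact hC _ ((one_le_div hq0).2 hqx)

def PW (g : ℕ → ℝ) (θ : ℝ) : Prop :=
  ∀ m : ℕ, ∃ C : ℝ, 0 ≤ C ∧ ∀ x : ℝ, 1 ≤ x → ∀ q : ℕ, 1 ≤ q → (q:ℝ) ≤ x ^ θ →
    |∑ n ∈ (Icc 1 ⌊x⌋₊).filter (fun n => q ∣ n), g n| ≤ C * (x / q) / (1 + Real.log x) ^ m

def AV (g : ℕ → ℝ) (θ : ℝ) : Prop :=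
  ∀ m : ℕ, ∃ C : ℝ, 0 ≤ C ∧ ∀ x : ℝ, 1 ≤ x →
    ∑ d ∈ Icc 1 ⌊x ^ θ⌋₊, |∑ n ∈ (Icc 1 ⌊x⌋₊).filter (fun n => d ∣ n), g n|
      ≤ C * x / (1 + Real.log x) ^ m

lemma harm_le (N : ℕ) (x : ℝ) (hx : 1 ≤ x) (hN : (N:ℝ) ≤ x) :
    ∑ d ∈ Icc 1 N, (1:ℝ) / d ≤ 1 + Real.log x := by
  have h := harmonic_le_one_add_log N
  rw [harmonic_eq_sum_Icc] at h
  push_cast at h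
  simp_rw [one_div]
  refine h.trans ?_
  rcases Nat.eq_zero_or_pos N with rfl | hN0
  · simp; exact Real.log_nonneg hx
  · gcongr

lemma floor_rpow_le (x θ : ℝ) (hx : 1 ≤ x) (hθ : θ ≤ 1) : ((⌊x ^ θ⌋₊ : ℕ) : ℝ) ≤ x := by
  refine (Nat.floor_le (by positivity)).trans ?_
  calc x ^ θ ≤ x ^ (1:ℝ) := Real.rpow_le_rpow_of_exponent_le hx hθ
    _ = x := Real.rpow_one x

lemma PW_AV (g : ℕ → ℝ) (θ : ℝ) (hθ : θ ≤ 1) (h : PW g θ) : AV g θ := by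
  intro m
  obtain ⟨C, hC0, hC⟩ := h (m+1)
  refine ⟨C, hC0, fun x hx => ?_⟩
  have hl0 : 0 ≤ Real.log x := Real.log_nonneg hx
  have hx0 : 0 < x := by linarith
  calc _ ≤ ∑ d ∈ Icc 1 ⌊x ^ θ⌋₊, (C * x / (1 + Real.log x) ^ (m+1)) * (1 / (d:ℝ)) := by
        refine Finset.sum_le_sum fun d hd => ?_
        rw [mem_Icc] at hd
        refine (hC x hx d hd.1 ((Nat.le_floor_iff (by positivity)).1 hd.2)).trans ?_
        apply le_of_eq; ring
    _ ≤ (C * x / (1 + Real.log x) ^ (m+1)) * (1 + Real.log x) := by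
        rw [← Finset.mul_sum]
        gcongr
        exact harm_le _ x hx (floor_rpow_le x θ hx hθ)
    _ = _ := by rw [pow_succ]; field_simp

lemma sum_tau (h : ℕ → ℝ) (h0 : ∀ n, 0 ≤ h n) (hm : ∀ a b, 0 < a → 0 < b → h (a * b) ≤ h a * h b) (N : ℕ) :
    ∑ k ∈ Icc 1 N, h k * (k.divisors.card : ℝ) ≤ (∑ k ∈ Icc 1 N, h k) ^ 2 := by
  have e : ∀ k ∈ Icc 1 N, h k * (k.divisors.card : ℝ) = ∑ a ∈ Icc 1 N, ∑ b ∈ Icc 1 N, if a * b = k then h k else 0 := by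
    intro k hk
    rw [mem_Icc] at hk
    have : (k.divisors.card : ℝ) = ∑ a ∈ Icc 1 N, ∑ b ∈ Icc 1 N, if a * b = k then (1:ℝ) else 0 := by
      have hc : k.divisorsAntidiagonal.card = k.divisors.card := by
        rw [← Nat.map_div_right_divisors, Finset.card_map]
      rw [← Finset.sum_product', ← Finset.sum_filter, Finset.sum_const, nsmul_eq_mul, mul_one, ← hc]
      norm_cast
      congr 1
      ext ⟨a, b⟩
      simp only [Nat.mem_divisorsAntidiagonal, mem_filter, mem_product, mem_Icc]
      constructor
      · rintro ⟨rfl, h⟩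
        have ha : 0 < a := Nat.pos_of_ne_zero (by rintro rfl; simp at h)
        have hb : 0 < b := Nat.pos_of_ne_zero (by rintro rfl; simp at h)
        exact ⟨⟨⟨ha, by nlinarith⟩, ⟨hb, by nlinarith⟩⟩, rfl⟩
      · rintro ⟨_, h⟩; exact ⟨h, by omega⟩
    rw [this, Finset.mul_sum]
    refine Finset.sum_congr rfl fun a _ => ?_
    rw [Finset.mul_sum]
    refine Finset.sum_congr rfl fun b _ => ?_
    simp
  rw [Finset.sum_congr rfl e, Finset.sum_comm, pow_two, Finset.sum_mul_sum]
  refine Finset.sum_le_sum fun a ha => ?_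
  rw [Finset.sum_comm]
  refine Finset.sum_le_sum fun b hb => ?_
  rw [Finset.sum_ite_eq]
  split_ifs
  · exact hm a b (mem_Icc.1 ha).1 (mem_Icc.1 hb).1
  · exact mul_nonneg (h0 _) (h0 _)

lemma tau_mul (a b : ℕ) : (a * b).divisors.card ≤ a.divisors.card * b.divisors.card := by
  rw [Nat.divisors_mul]; exact Finset.card_mul_le

lemma sum_tau_sq (x : ℝ) (N : ℕ) (hx : 1 ≤ x) (hN : (N:ℝ) ≤ x) :
    ∑ k ∈ Icc 1 N, (k.divisors.card : ℝ)^2 / k ≤ (1 + Real.log x) ^ 4 := by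
  have hl0 : 0 ≤ Real.log x := Real.log_nonneg hx
  have h1 := sum_tau (fun k => 1 / (k:ℝ)) (fun n => by positivity) (fun a b _ _ => by
    push_cast; apply le_of_eq; field_simp) N
  have h2 := sum_tau (fun k => 1 / (k:ℝ) * k.divisors.card) (fun n => by positivity) (fun a b _ _ => by
    have : ((a*b).divisors.card : ℝ) ≤ a.divisors.card * b.divisors.card := by exact_mod_cast tau_mul a b
    calc 1 / ((a*b : ℕ):ℝ) * (a*b).divisors.card ≤ 1 / ((a*b : ℕ):ℝ) * (a.divisors.card * b.divisors.card) := by gcongr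
      _ = _ := by push_cast; field_simp) N
  have h3 : ∑ k ∈ Icc 1 N, 1 / (k:ℝ) * k.divisors.card ≤ (1 + Real.log x)^2 := by
    refine h1.trans ?_
    have := harm_le N x hx hN
    have h0 : 0 ≤ ∑ k ∈ Icc 1 N, 1 / (k:ℝ) := Finset.sum_nonneg fun _ _ => by positivity
    gcongr
  have h0 : 0 ≤ ∑ k ∈ Icc 1 N, 1 / (k:ℝ) * k.divisors.card := Finset.sum_nonneg fun _ _ => by positivity
  calc _ = ∑ k ∈ Icc 1 N, 1 / (k:ℝ) * k.divisors.card * k.divisors.card := by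
        refine Finset.sum_congr rfl fun k _ => ?_
        ring
    _ ≤ _ := h2
    _ ≤ ((1 + Real.log x)^2)^2 := by gcongr
    _ = _ := by ring

lemma card_mult (N q : ℕ) (hq : 0 < q) : (((Icc 1 N).filter (fun n => q ∣ n)).card : ℝ) ≤ (N:ℝ) / q := by
  have := sum_mult (fun _ => 1) N q hq
  simp only [Finset.sum_const, nsmul_eq_mul, mul_one, Nat.card_Icc, Nat.add_sub_cancel] at this
  rw [this]; exact Nat.cast_div_le

lemma gcd_sum (e D : ℕ) (x : ℝ) (hx : 1 ≤ x) (hD : (D:ℝ) ≤ x) (he : 0 < e) :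
    ∑ d ∈ Icc 1 D, (Nat.gcd d e : ℝ) / d ≤ e.divisors.card * (1 + Real.log x) := by
  have h1 : ∀ d ∈ Icc 1 D, (Nat.gcd d e : ℝ) / d ≤ ∑ f ∈ e.divisors, if f ∣ d then (f:ℝ) / d else 0 := by
    intro d hd
    have : (Nat.gcd d e : ℝ) / d = if Nat.gcd d e ∣ d then (Nat.gcd d e : ℝ) / d else 0 := by
      rw [if_pos (Nat.gcd_dvd_left d e)]
    rw [this]
    refine Finset.single_le_sum (f := fun f : ℕ => if f ∣ d then (f:ℝ) / d else 0) (fun f _ => ?_) ?_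
    · split_ifs <;> positivity
    · exact Nat.mem_divisors.2 ⟨Nat.gcd_dvd_right d e, he.ne'⟩
  refine (Finset.sum_le_sum h1).trans ?_
  rw [Finset.sum_comm]
  calc _ ≤ ∑ f ∈ e.divisors, (1 + Real.log x) := by
        refine Finset.sum_le_sum fun f hf => ?_
        have hf0 : 0 < f := Nat.pos_of_mem_divisors hf
        rw [← Finset.sum_filter, sum_mult (fun d => (f:ℝ)/d) D f hf0]
        calc _ = ∑ m ∈ Icc 1 (D / f), (1:ℝ) / m := by
              refine Finset.sum_congr rfl fun m hm => ?_
              have : (0:ℝ) < m := by exact_mod_cast (mem_Icc.1 hm).1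
              have : (0:ℝ) < f := by exact_mod_cast hf0
              push_cast; field_simp
          _ ≤ _ := harm_le _ x hx (le_trans (by exact_mod_cast Nat.div_le_self D f) hD)
    _ = _ := by simp; ring

lemma Lg_pow_le_rpow (m : ℕ) (ε : ℝ) (hε : 0 < ε) :
    ∃ C : ℝ, 0 < C ∧ ∀ x : ℝ, 1 ≤ x → (1 + Real.log x) ^ m ≤ C * x ^ ε := by
  obtain ⟨M, hM⟩ := exists_nat_gt ((m:ℝ) / ε)
  obtain ⟨C, hC, h⟩ := Lg_pow_le M
  refine ⟨C ^ ε, by positivity, fun x hx => ?_⟩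
  have hl0 : 0 ≤ Real.log x := Real.log_nonneg hx
  have h1 := h x hx
  rw [← Real.mul_rpow hC.le (by linarith)]
  calc (1 + Real.log x)^m = (1 + Real.log x)^(m:ℝ) := by rw [Real.rpow_natCast]
    _ ≤ (1 + Real.log x)^((M:ℝ) * ε) := by
        apply Real.rpow_le_rpow_of_exponent_le (by linarith)
        rw [div_lt_iff₀ hε] at hM; exact hM.le
    _ = ((1 + Real.log x)^M)^ε := by rw [Real.rpow_mul (by linarith), Real.rpow_natCast]
    _ ≤ _ := by gcongr

lemma AV_sqfree (g : ℕ → ℝ) (G θ θ' : ℝ) (hG : ∀ n, |g n| ≤ G) (hθ : θ < θ') (hθ1 : θ' ≤ 1)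
    (h : PW g θ') : AV (fun n => (if Squarefree n then 1 else 0) * g n) θ := by
  intro m
  have hG0 : 0 ≤ G := (abs_nonneg _).trans (hG 0)
  obtain ⟨C, hC0, hC⟩ := h (m + (m+5) + 1)
  obtain ⟨C1, hC1, hC1'⟩ := Lg_pow_le_rpow (2*(m+5)) ((θ'-θ)/2) (by linarith)
  obtain ⟨x0, hx01, hx0⟩ : ∃ x0 : ℝ, 1 ≤ x0 ∧ ∀ x, x0 ≤ x → 4 * C1 ≤ x ^ ((θ'-θ)/2) := by
    have := (tendsto_rpow_atTop (y := (θ'-θ)/2) (by linarith)).eventually (eventually_ge_atTop (4 * C1))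
    obtain ⟨x0, hx0⟩ := eventually_atTop.1 this
    exact ⟨max x0 1, le_max_right _ _, fun x hx => hx0 x ((le_max_left _ _).trans hx)⟩
  have hlx0 : 0 ≤ Real.log x0 := Real.log_nonneg hx01
  refine ⟨G * x0 * (1 + Real.log x0)^m + 2 * C + G, by positivity, fun x hx => ?_⟩
  have hxp : 0 < x := by linarith
  have hl0 : 0 ≤ Real.log x := Real.log_nonneg hx
  set Lg := 1 + Real.log x with hLg
  have hLg1 : 1 ≤ Lg := by linarith
  set N := ⌊x⌋₊ with hN
  have hNx : (N:ℝ) ≤ x := Nat.floor_le hxp.le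
  set D := ⌊x ^ θ⌋₊ with hD
  have hDx : (D:ℝ) ≤ x := floor_rpow_le x θ hx (by linarith)
  rw [le_div_iff₀ (by positivity)]
  rcases lt_or_ge x x0 with hxx | hxx
  · have h1 : ∀ d ∈ Icc 1 D, |∑ n ∈ (Icc 1 N).filter (fun n => d ∣ n), (if Squarefree n then 1 else 0) * g n| ≤ x * G := by
      intro d _
      refine (Finset.abs_sum_le_sum_abs _ _).trans ?_
      calc _ ≤ ∑ n ∈ (Icc 1 N).filter (fun n => d ∣ n), G := by
            refine Finset.sum_le_sum fun n _ => ?_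
            rw [abs_mul]
            have : |(if Squarefree n then (1:ℝ) else 0)| ≤ 1 := by split_ifs <;> simp
            calc _ ≤ 1 * G := by gcongr; exact hG n
              _ = G := one_mul G
        _ ≤ ∑ n ∈ Icc 1 N, G := Finset.sum_le_sum_of_subset_of_nonneg (filter_subset _ _) (fun _ _ _ => hG0)
        _ = N * G := by simp
        _ ≤ _ := by gcongr
    have h2 := Finset.sum_le_sum h1
    rw [Finset.sum_const, nsmul_eq_mul, Nat.card_Icc, Nat.add_sub_cancel] at h2
    have : Lg ≤ 1 + Real.log x0 := by rw [hLg]; gcongr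
    calc _ ≤ (D * (x * G)) * Lg^m := by gcongr
      _ ≤ (x0 * (x * G)) * (1 + Real.log x0)^m := by gcongr; linarith
      _ ≤ _ := by
        have : 0 ≤ (2 * C + G) * x := by positivity
        linarith
  · set K := ⌈Lg^(m+5)⌉₊ with hK
    have hK1 : Lg^(m+5) ≤ K := Nat.le_ceil _
    have hK2 : (K:ℝ) ≤ 2 * Lg^(m+5) := by
      have := Nat.ceil_lt_add_one (show 0 ≤ Lg^(m+5) by positivity)
      have := one_le_pow₀ (n := m+5) hLg1
      linarith
    have hK0 : 0 < (K:ℝ) := by have := one_le_pow₀ (n := m+5) hLg1; linarith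
    have hKK : (K:ℝ)^2 * x^θ ≤ x^θ' := by
      have h1 : (K:ℝ)^2 ≤ 4 * Lg^(2*(m+5)) := by
        calc (K:ℝ)^2 ≤ (2 * Lg^(m+5))^2 := by gcongr
          _ = _ := by ring
      have h2 := hC1' x hx
      have h3 := hx0 x hxx
      calc (K:ℝ)^2 * x^θ ≤ (4 * (C1 * x^((θ'-θ)/2))) * x^θ := by gcongr; linarith
        _ = (4 * C1) * (x^((θ'-θ)/2) * x^θ) := by ring
        _ ≤ x^((θ'-θ)/2) * (x^((θ'-θ)/2) * x^θ) := by gcongr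
        _ = _ := by rw [← Real.rpow_add hxp, ← Real.rpow_add hxp]; congr 1; ring
    have hbd : ∀ d ∈ Icc 1 D, |∑ n ∈ (Icc 1 N).filter (fun n => d ∣ n), (if Squarefree n then 1 else 0) * g n|
        ≤ K * (C * (x/d) / Lg^(m+(m+5)+1)) + ∑ k ∈ Icc 1 N, (G * x / (K * k) * ((Nat.gcd d (k^2) : ℝ) / d)) := by
      intro d hd
      have hd1 := mem_Icc.1 hd
      have hd0 : (0:ℝ) < d := by exact_mod_cast hd1.1
      have e : ∑ n ∈ (Icc 1 N).filter (fun n => d ∣ n), (if Squarefree n then 1 else 0) * g n =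
          ∑ k ∈ Icc 1 N, (ArithmeticFunction.moebius k : ℝ) * ∑ n ∈ (Icc 1 N).filter (fun n => Nat.lcm d (k^2) ∣ n), g n := by
        rw [Finset.sum_congr rfl (fun n hn => by rw [sqfree_sum N n (mem_filter.1 hn).1])]
        simp_rw [Finset.sum_filter, Finset.sum_mul, Finset.mul_sum]
        have : ∀ n ∈ Icc 1 N, (if d ∣ n then ∑ k ∈ Icc 1 N, (if k^2 ∣ n then (ArithmeticFunction.moebius k : ℝ) else 0) * g n else 0)
            = ∑ k ∈ Icc 1 N, (ArithmeticFunction.moebius k : ℝ) * (if Nat.lcm d (k^2) ∣ n then g n else 0) := by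
          intro n _
          by_cases hdn : d ∣ n
          · rw [if_pos hdn]
            refine Finset.sum_congr rfl fun k _ => ?_
            by_cases hkn : k^2 ∣ n
            · rw [if_pos hkn, if_pos (Nat.lcm_dvd hdn hkn)]
            · rw [if_neg hkn, if_neg (fun hl => hkn ((Nat.dvd_lcm_right _ _).trans hl))]; ring
          · rw [if_neg hdn]
            symm
            refine Finset.sum_eq_zero fun k _ => ?_
            rw [if_neg (fun hl => hdn ((Nat.dvd_lcm_left _ _).trans hl))]; ring
        rw [Finset.sum_congr rfl this, Finset.sum_comm]
      rw [e]
      refine (Finset.abs_sum_le_sum_abs _ _).trans ?_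
      have hk : ∀ k ∈ Icc 1 N, |(ArithmeticFunction.moebius k : ℝ) * ∑ n ∈ (Icc 1 N).filter (fun n => Nat.lcm d (k^2) ∣ n), g n|
          ≤ (if k ∈ Icc 1 K then C * (x/d) / Lg^(m+(m+5)+1) else 0) + (G * x / (K * k) * ((Nat.gcd d (k^2) : ℝ) / d)) := by
        intro k hk
        have hk1 := mem_Icc.1 hk
        have hk0 : (0:ℝ) < k := by exact_mod_cast hk1.1
        have hlpos : 0 < Nat.lcm d (k^2) := Nat.lcm_pos hd1.1 (pow_pos hk1.1 2)
        rw [abs_mul]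
        have hmu : |(ArithmeticFunction.moebius k : ℝ)| ≤ 1 := by exact_mod_cast ArithmeticFunction.abs_moebius_le_one
        have hmm : ∀ t : ℝ, |(ArithmeticFunction.moebius k : ℝ)| * |t| ≤ |t| := fun t => by
          calc _ ≤ 1 * |t| := by gcongr
            _ = _ := one_mul _
        refine (hmm _).trans ?_
        by_cases hkK : k ≤ K
        · rw [if_pos (mem_Icc.2 ⟨hk1.1, hkK⟩)]
          have hq : ((Nat.lcm d (k^2) : ℕ) : ℝ) ≤ x^θ' := by
            have h1 : Nat.lcm d (k^2) ≤ d * k^2 := Nat.le_of_dvd (Nat.mul_pos hd1.1 (pow_pos hk1.1 2)) (Nat.lcm_dvd_mul _ _)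
            have h2 : (d:ℝ) ≤ x^θ := (Nat.le_floor_iff (by positivity)).1 hd1.2
            calc ((Nat.lcm d (k^2) : ℕ) : ℝ) ≤ ((d * k^2 : ℕ) : ℝ) := by exact_mod_cast h1
              _ = d * (k:ℝ)^2 := by push_cast; ring
              _ ≤ x^θ * (K:ℝ)^2 := by gcongr
              _ ≤ _ := by linarith
          have h1 := hC x hx _ hlpos hq
          have h2 : (d:ℝ) ≤ (Nat.lcm d (k^2) : ℕ) := by exact_mod_cast Nat.le_of_dvd hlpos (Nat.dvd_lcm_left _ _)
          have h3 : C * (x / (Nat.lcm d (k^2) : ℕ)) / Lg^(m+(m+5)+1) ≤ C * (x/d) / Lg^(m+(m+5)+1) := by gcongr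
          have h4 : 0 ≤ (G * x / (K * k) * ((Nat.gcd d (k^2) : ℝ) / d)) := by positivity
          linarith
        · rw [if_neg (fun hm => hkK (mem_Icc.1 hm).2), zero_add]
          have hkK' : (K:ℝ) ≤ k := by exact_mod_cast (not_le.1 hkK).le
          refine (Finset.abs_sum_le_sum_abs _ _).trans ((Finset.sum_le_sum fun n _ => hG n).trans ?_)
          rw [Finset.sum_const, nsmul_eq_mul]
          have h1 := card_mult N _ hlpos
          have h2 : ((Nat.gcd d (k^2) : ℕ) : ℝ) * (Nat.lcm d (k^2) : ℕ) = d * (k:ℝ)^2 := by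
            exact_mod_cast Nat.gcd_mul_lcm d (k^2)
          have hlp : (0:ℝ) < (Nat.lcm d (k^2) : ℕ) := by exact_mod_cast hlpos
          calc _ ≤ ((N:ℝ) / (Nat.lcm d (k^2) : ℕ)) * G := by gcongr
            _ = N * G * (Nat.gcd d (k^2) : ℕ) / (d * (k:ℝ)^2) := by
                rw [← h2]
                have : (0:ℝ) < (Nat.gcd d (k^2) : ℕ) := by exact_mod_cast Nat.gcd_pos_of_pos_left _ hd1.1
                field_simp
            _ ≤ x * G * (Nat.gcd d (k^2) : ℕ) / (d * (K * k)) := by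
                gcongr
                nlinarith
            _ = _ := by field_simp
      refine (Finset.sum_le_sum hk).trans ?_
      rw [Finset.sum_add_distrib]
      gcongr
      rw [← Finset.sum_filter, Finset.sum_const, nsmul_eq_mul]
      gcongr
      calc _ ≤ (Icc 1 K).card := Finset.card_le_card (fun k hk => (mem_filter.1 hk).2)
        _ = K := by simp
    have hsum := Finset.sum_le_sum hbd
    rw [Finset.sum_add_distrib] at hsum
    have hA : ∑ d ∈ Icc 1 D, K * (C * (x/d) / Lg^(m+(m+5)+1)) ≤ 2 * C * x / Lg^m := by
      calc _ = K * C * x / Lg^(m+(m+5)+1) * ∑ d ∈ Icc 1 D, (1:ℝ)/d := by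
            rw [Finset.mul_sum]; refine Finset.sum_congr rfl fun d _ => ?_; ring
        _ ≤ (2 * Lg^(m+5)) * C * x / Lg^(m+(m+5)+1) * Lg := by
            gcongr; exact harm_le D x hx hDx
        _ = _ := by rw [pow_add, pow_add, pow_one]; field_simp; ring
    have hB : ∑ d ∈ Icc 1 D, ∑ k ∈ Icc 1 N, (G * x / (K * k) * ((Nat.gcd d (k^2) : ℝ) / d)) ≤ G * x / Lg^m := by
      rw [Finset.sum_comm]
      calc _ ≤ ∑ k ∈ Icc 1 N, (G * x / K * Lg) * ((k.divisors.card : ℝ)^2 / k) := by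
            refine Finset.sum_le_sum fun k hk => ?_
            have hk1 := mem_Icc.1 hk
            rw [← Finset.mul_sum]
            have h1 := gcd_sum (k^2) D x hx hDx (pow_pos hk1.1 2)
            have h2 : ((k^2).divisors.card : ℝ) ≤ (k.divisors.card : ℝ)^2 := by
              have := tau_mul k k
              rw [← pow_two, ← pow_two] at this
              exact_mod_cast this
            calc _ ≤ G * x / (K * k) * ((k.divisors.card : ℝ)^2 * Lg) := by
                  gcongr
                  exact h1.trans (by gcongr)
              _ = _ := by ring
        _ ≤ (G * x / K * Lg) * Lg^4 := by
            rw [← Finset.mul_sum]; gcongr; exact sum_tau_sq x N hx hNx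
        _ ≤ (G * x / Lg^(m+5) * Lg) * Lg^4 := by gcongr
        _ = _ := by rw [pow_add]; field_simp
    have h3 : 0 ≤ G * x0 * (1 + Real.log x0)^m * x := by positivity
    calc _ ≤ (2 * C * x / Lg^m + G * x / Lg^m) * Lg^m := by gcongr; linarith
      _ = 2 * C * x + G * x := by field_simp
      _ ≤ _ := by linarith

def BK (g : ℕ → ℝ) (θ : ℝ) : Prop :=
  ∀ m : ℕ, ∃ C : ℝ, 0 ≤ C ∧ ∀ i M q : ℕ, 2 ^ i ≤ M → M ≤ 2 ^ (i+1) → 1 ≤ q →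
    (q:ℝ) ≤ ((2:ℝ) ^ i) ^ θ →
    |∑ n ∈ (Ioc (2^i) M).filter (fun n => q ∣ n), g n| ≤ C * ((2:ℝ)^i / q) / (1 + Real.log ((2:ℝ)^i)) ^ m

lemma split_mult (g : ℕ → ℝ) (q A M : ℕ) (h : A ≤ M) :
    ∑ n ∈ (Icc 1 M).filter (fun n => q ∣ n), g n = ∑ n ∈ (Icc 1 A).filter (fun n => q ∣ n), g n
      + ∑ n ∈ (Ioc A M).filter (fun n => q ∣ n), g n := by
  have e1 : ∀ N : ℕ, Icc 1 N = Ioc 0 N := fun N => by ext; simp [Nat.succ_le_iff]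
  simp_rw [Finset.sum_filter]
  rw [e1, e1, Finset.sum_Ioc_consecutive _ (Nat.zero_le _) h]

lemma triv_mult (g : ℕ → ℝ) (G : ℝ) (hG : ∀ n, |g n| ≤ G) (N q : ℕ) (hq : 0 < q) :
    |∑ n ∈ (Icc 1 N).filter (fun n => q ∣ n), g n| ≤ G * (N / q) := by
  have hG0 : 0 ≤ G := (abs_nonneg _).trans (hG 0)
  refine (Finset.abs_sum_le_sum_abs _ _).trans ((Finset.sum_le_sum fun n _ => hG n).trans ?_)
  rw [Finset.sum_const, nsmul_eq_mul, mul_comm]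
  gcongr
  exact card_mult N q hq

lemma BK_PW (g : ℕ → ℝ) (G θ θ' : ℝ) (hG : ∀ n, |g n| ≤ G) (h0 : 0 < θ) (hθ : θ < θ')
    (h : BK g θ') : PW g θ := by
  intro m
  have hG0 : 0 ≤ G := (abs_nonneg _).trans (hG 0)
  obtain ⟨C, hC0, hC⟩ := h m
  set η := θ / θ' with hη
  have hθ' : 0 < θ' := by linarith
  have hη0 : 0 < η := by positivity
  have hη1 : η < 1 := (div_lt_one hθ').2 hθ
  obtain ⟨C1, hC1, hC1'⟩ := Lg_pow_le_rpow m (1-η) (by linarith)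
  refine ⟨2 * G * C1 + 2 * C / η^m, by positivity, fun x hx q hq hqx => ?_⟩
  have hx0 : 0 < x := by linarith
  have hl0 : 0 ≤ Real.log x := Real.log_nonneg hx
  set Lg := 1 + Real.log x with hLg
  have hLg1 : 1 ≤ Lg := by linarith
  have hq0 : (0:ℝ) < q := by exact_mod_cast hq
  have hxη : 1 ≤ x^η := Real.one_le_rpow hx hη0.le
  have hex : ∃ i : ℕ, x^η ≤ (2:ℝ)^i := (pow_unbounded_of_one_lt (x^η) one_lt_two).imp fun _ h => h.le
  set i1 := Nat.find hex with hi1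
  have hi1a : x^η ≤ (2:ℝ)^i1 := Nat.find_spec hex
  have hi1b : (2:ℝ)^i1 ≤ 2 * x^η := by
    rcases Nat.eq_zero_or_pos i1 with h | h
    · rw [h]; simp; linarith
    · have := Nat.find_min hex (m := i1 - 1) (by omega)
      push Not at this
      have e : (2:ℝ)^i1 = 2 * 2^(i1-1) := by rw [← pow_succ']; congr 1; omega
      rw [e]; linarith
  set S : ℕ → ℝ := fun M => ∑ n ∈ (Icc 1 M).filter (fun n => q ∣ n), g n with hS
  set E := C / η^m / Lg^m / q with hE
  have hE0 : 0 ≤ E := by positivity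
  have hblock : ∀ i M, i1 ≤ i → 2^i ≤ M → M ≤ 2^(i+1) → |S M| ≤ |S (2^i)| + E * 2^i := by
    intro i M hi hM1 hM2
    have h2i : x^η ≤ (2:ℝ)^i := hi1a.trans (pow_le_pow_right₀ one_le_two hi)
    have h1 := hC i M q hM1 hM2 hq (by
      calc (q:ℝ) ≤ x^θ := hqx
        _ = (x^η)^θ' := by rw [← Real.rpow_mul hx0.le, hη, div_mul_cancel₀ _ hθ'.ne']
        _ ≤ _ := by gcongr)
    have h3 : η * Lg ≤ 1 + Real.log ((2:ℝ)^i) := by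
      have := Real.log_le_log (by positivity) h2i
      rw [Real.log_rpow hx0] at this
      rw [hLg]; linarith
    have h2 : C * ((2:ℝ)^i / q) / (1 + Real.log ((2:ℝ)^i)) ^ m ≤ E * 2^i := by
      calc _ ≤ C * ((2:ℝ)^i / q) / (η * Lg) ^ m := by gcongr
        _ = _ := by rw [mul_pow, hE]; field_simp
    simp only [hS]
    rw [split_mult g q (2^i) M hM1]
    exact (abs_add_le _ _).trans (by linarith)
  have hdy : ∀ i, i1 ≤ i → |S (2^i)| ≤ G * (2^i1 / q) + E * 2^i := by
    intro i hi
    induction i, hi using Nat.le_induction with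
    | base =>
      have := triv_mult g G hG (2^i1) q hq
      push_cast at this
      have : 0 ≤ E * 2^i1 := by positivity
      simp only [hS]; linarith
    | succ i hi ih =>
      have := hblock i (2^(i+1)) hi (Nat.pow_le_pow_right (by norm_num) (by omega)) le_rfl
      have e : E * (2:ℝ)^(i+1) = E * 2^i + E * 2^i := by ring
      linarith
  set N := ⌊x⌋₊ with hN
  have hNx : (N:ℝ) ≤ x := Nat.floor_le hx0.le
  have hN1 : 1 ≤ N := Nat.le_floor (by simpa using hx)
  have hfin : |S N| ≤ G * (2 * x^η / q) + 2 * E * x := by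
    rcases le_total N (2^i1) with hc | hc
    · have h1 := triv_mult g G hG N q hq
      have h2 : (N:ℝ) ≤ 2^i1 := by exact_mod_cast hc
      have : 0 ≤ 2 * E * x := by positivity
      have : G * (N / q) ≤ G * (2 * x^η/q) := by gcongr; linarith
      simp only [hS]; linarith
    · set I := Nat.log 2 N with hI
      have hI1 : 2^I ≤ N := Nat.pow_log_le_self 2 (by omega)
      have hI2 : N < 2^(I+1) := Nat.lt_pow_succ_log_self (by norm_num) N
      have hI3 : i1 ≤ I := Nat.le_log_of_pow_le (by norm_num) hc
      have h1 := hblock I N hI3 hI1 hI2.le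
      have h2 := hdy I hI3
      have h3 : (2:ℝ)^I ≤ x := le_trans (by exact_mod_cast hI1) hNx
      have h4 : E * 2^I ≤ E * x := by gcongr
      have h5 : G * (2^i1 / q) ≤ G * (2 * x^η/q) := by gcongr
      linarith
  refine hfin.trans ?_
  have h1 : x^η * Lg^m ≤ C1 * x := by
    calc x^η * Lg^m ≤ x^η * (C1 * x^(1-η)) := by gcongr; exact hC1' x hx
      _ = C1 * (x^η * x^(1-η)) := by ring
      _ = C1 * x := by rw [← Real.rpow_add hx0]; simp
  have h2 : x^η ≤ C1 * x / Lg^m := by rw [le_div_iff₀ (by positivity)]; exact h1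
  calc _ ≤ G * (2 * (C1 * x / Lg^m) / q) + 2 * E * x := by gcongr
    _ = _ := by rw [hE]; ring

noncomputable def PP (γ β : ℝ) (i : ℕ) : Finset ℕ :=
  (Ioc ⌊((2:ℝ)^i)^γ⌋₊ ⌊((2:ℝ)^i)^β⌋₊).filter Nat.Prime

noncomputable def sig (γ β : ℝ) (i : ℕ) : ℝ := ∑ p ∈ PP γ β i, Real.log p / p

noncomputable def Wi (γ β : ℝ) (i n : ℕ) : ℝ :=
  1 - (∑ p ∈ (PP γ β i).filter (fun p => p ∣ n), Real.log p) / sig γ β i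

lemma PP_mem {γ β : ℝ} {i p : ℕ} (hp : p ∈ PP γ β i) :
    p.Prime ∧ ((2:ℝ)^i)^γ < p ∧ (p:ℝ) ≤ ((2:ℝ)^i)^β := by
  unfold PP at hp
  rw [mem_filter, mem_Ioc, Nat.floor_lt (by positivity), Nat.le_floor_iff (by positivity)] at hp
  exact ⟨hp.2, hp.1.1, hp.1.2⟩

lemma Wi_sum (γ β : ℝ) (i A M q : ℕ) (g : ℕ → ℝ) :
    ∑ n ∈ (Ioc A M).filter (fun n => q ∣ n), g n * Wi γ β i n =
      ∑ n ∈ (Ioc A M).filter (fun n => q ∣ n), g n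
      - (∑ p ∈ PP γ β i, Real.log p * ∑ n ∈ (Ioc A M).filter (fun n => Nat.lcm p q ∣ n), g n) / sig γ β i := by
  unfold Wi
  simp_rw [mul_sub, mul_one, Finset.sum_sub_distrib]
  congr 1
  simp_rw [← mul_div_assoc, ← Finset.sum_div, Finset.sum_filter, Finset.mul_sum]
  congr 1
  rw [Finset.sum_comm]
  have : ∀ n ∈ Ioc A M, (if q ∣ n then ∑ p ∈ PP γ β i, g n * (if p ∣ n then Real.log p else 0) else 0)
      = ∑ p ∈ PP γ β i, Real.log p * (if Nat.lcm p q ∣ n then g n else 0) := by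
    intro n _
    by_cases hq : q ∣ n
    · rw [if_pos hq]
      refine Finset.sum_congr rfl fun p _ => ?_
      by_cases hp : p ∣ n
      · rw [if_pos hp, if_pos (Nat.lcm_dvd hp hq)]; ring
      · rw [if_neg hp, if_neg (fun h => hp ((Nat.dvd_lcm_left _ _).trans h))]; ring
    · rw [if_neg hq]
      symm
      refine Finset.sum_eq_zero fun p _ => ?_
      rw [if_neg (fun h => hq ((Nat.dvd_lcm_right _ _).trans h))]; ring
  rw [Finset.sum_congr rfl this, Finset.sum_comm]

lemma log_dvd_sum (P : Finset ℕ) (hP : ∀ p ∈ P, p.Prime) (n : ℕ) (hn : 0 < n) :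
    ∑ p ∈ P.filter (fun p => p ∣ n), Real.log p ≤ Real.log n := by
  have hd : ∏ p ∈ P.filter (fun p => p ∣ n), p ∣ n := by
    refine Finset.prod_primes_dvd n (fun p hp => (hP p (mem_filter.1 hp).1).prime) (fun p hp => (mem_filter.1 hp).2)
  have h1 := Nat.le_of_dvd hn hd
  have h2 : ∑ p ∈ P.filter (fun p => p ∣ n), Real.log p = Real.log ((∏ p ∈ P.filter (fun p => p ∣ n), p : ℕ) : ℝ) := by
    push_cast
    rw [Real.log_prod]
    intro p hp
    have := (hP p (mem_filter.1 hp).1).pos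
    positivity
  rw [h2]
  apply Real.log_le_log
  · exact_mod_cast Nat.pos_of_dvd_of_pos hd hn
  · exact_mod_cast h1

lemma count_block (A M q : ℕ) (hA : A ≤ M) (hq : 0 < q) :
    |∑ n ∈ (Ioc A M).filter (fun n => q ∣ n), (1:ℝ) - ((M:ℝ) - A) / q| ≤ 1 := by
  have h := split_mult (fun _ => (1:ℝ)) q A M hA
  rw [sum_mult _ _ _ hq, sum_mult _ _ _ hq] at h
  simp only [Finset.sum_const, nsmul_eq_mul, mul_one, Nat.card_Icc, Nat.add_sub_cancel] at h ⊢
  have hq0 : (0:ℝ) < q := by exact_mod_cast hq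
  have a1 : ((M / q : ℕ):ℝ) ≤ M / q := Nat.cast_div_le
  have a2 : ((A / q : ℕ):ℝ) ≤ A / q := Nat.cast_div_le
  have a3 : (M:ℝ) / q < (M / q : ℕ) + 1 := by
    rw [div_lt_iff₀ hq0]
    exact_mod_cast (by rw [mul_comm]; exact Nat.lt_mul_div_succ M hq : M < (M / q + 1) * q)
  have a4 : (A:ℝ) / q < (A / q : ℕ) + 1 := by
    rw [div_lt_iff₀ hq0]
    exact_mod_cast (by rw [mul_comm]; exact Nat.lt_mul_div_succ A hq : A < (A / q + 1) * q)
  rw [sub_div, abs_le]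
  constructor <;> linarith

lemma cancel_block (γ β : ℝ) (i M q : ℕ) (hβ : 0 ≤ β) (hs : 0 < sig γ β i) (hM : 2^i ≤ M)
    (hq : 1 ≤ q) (hqX : (q:ℝ) ≤ ((2:ℝ)^i)^γ) :
    |∑ n ∈ (Ioc (2^i) M).filter (fun n => q ∣ n), Wi γ β i n| ≤ 2 * ((2:ℝ)^i)^β := by
  have h := Wi_sum γ β i (2^i) M q (fun _ => 1)
  simp_rw [one_mul] at h
  rw [h]
  set c : ℕ → ℝ := fun q => ∑ n ∈ (Ioc (2^i) M).filter (fun n => q ∣ n), (1:ℝ) with hc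
  have hcount : ∀ q, 0 < q → |c q - ((M:ℝ) - 2^i) / q| ≤ 1 := by
    intro q hq
    have := count_block (2^i) M q hM hq
    push_cast at this
    exact this
  have hlcm : ∀ p ∈ PP γ β i, Nat.lcm p q = p * q := by
    intro p hp
    obtain ⟨h1, h2, h3⟩ := PP_mem hp
    apply Nat.Coprime.lcm_eq_mul
    rw [Nat.Prime.coprime_iff_not_dvd h1]
    intro hd
    have := Nat.le_of_dvd hq hd
    have : (p:ℝ) ≤ q := by exact_mod_cast this
    linarith
  have hq0 : (0:ℝ) < q := by exact_mod_cast hq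
  have e : c q - (∑ p ∈ PP γ β i, Real.log p * c (Nat.lcm p q)) / sig γ β i =
      (c q - ((M:ℝ) - 2^i) / q) - (∑ p ∈ PP γ β i, Real.log p * (c (p * q) - ((M:ℝ) - 2^i) / (p*q : ℕ))) / sig γ β i := by
    have : ∑ p ∈ PP γ β i, Real.log p * (((M:ℝ) - 2^i) / (p*q : ℕ)) = sig γ β i * (((M:ℝ) - 2^i) / q) := by
      unfold sig
      rw [Finset.sum_mul]
      refine Finset.sum_congr rfl fun p hp => ?_
      have : (0:ℝ) < p := by exact_mod_cast (PP_mem hp).1.pos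
      push_cast; field_simp
    simp_rw [mul_sub, Finset.sum_sub_distrib]
    have e2 : ∑ p ∈ PP γ β i, Real.log p * c (Nat.lcm p q) = ∑ p ∈ PP γ β i, Real.log p * c (p * q) :=
      Finset.sum_congr rfl (fun p hp => by rw [hlcm p hp])
    rw [this, e2]
    generalize ((M:ℝ) - 2^i) / q = t
    generalize ∑ p ∈ PP γ β i, Real.log p * c (p * q) = r
    field_simp
    ring
  show |c q - (∑ p ∈ PP γ β i, Real.log p * c (Nat.lcm p q)) / sig γ β i| ≤ _
  rw [e]
  have h2 : |(∑ p ∈ PP γ β i, Real.log p * (c (p * q) - ((M:ℝ) - 2^i) / (p*q : ℕ))) / sig γ β i| ≤ ((2:ℝ)^i)^β := by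
    rw [abs_div, abs_of_pos hs, div_le_iff₀ hs]
    refine (Finset.abs_sum_le_sum_abs _ _).trans ?_
    unfold sig
    rw [Finset.mul_sum]
    refine Finset.sum_le_sum fun p hp => ?_
    obtain ⟨h1, h2, h3⟩ := PP_mem hp
    have hp1 : (1:ℝ) ≤ p := by exact_mod_cast h1.one_le
    have hlp : 0 ≤ Real.log p := Real.log_nonneg hp1
    rw [abs_mul, abs_of_nonneg hlp]
    calc _ ≤ Real.log p * 1 := by gcongr; exact hcount _ (Nat.mul_pos h1.pos hq)
      _ = p * (Real.log p / p) := by field_simp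
      _ ≤ _ := by gcongr
  have h3 : (1:ℝ) ≤ ((2:ℝ)^i)^β := Real.one_le_rpow (one_le_pow₀ one_le_two) hβ
  refine (abs_sub _ _).trans ?_
  have := hcount q hq
  linarith

lemma L_block (η : ℝ) (hη0 : 0 ≤ η) (hη : η < 1) (m : ℕ) : ∃ C, 0 ≤ C ∧ ∀ i M q : ℕ, 2^i ≤ M → M ≤ 2^(i+1) → 1 ≤ q →
    (q:ℝ) ≤ ((2:ℝ)^i)^η →
    |∑ n ∈ (Ioc (2^i) M).filter (fun n => q ∣ n), sg (-1) n| ≤ C * ((2:ℝ)^i/q) / (1 + Real.log ((2:ℝ)^i))^m := by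
  obtain ⟨C, hC, h⟩ := L_mult m
  refine ⟨3 * C / (1-η)^m, by have : 0 < 1 - η := by linarith
                              positivity, ?_⟩
  intro i M q h1 h2 hq hqX
  have hη1 : 0 < 1 - η := by linarith
  set X : ℝ := (2:ℝ)^i with hX
  have hX1 : 1 ≤ X := one_le_pow₀ one_le_two
  have hX0 : 0 < X := by linarith
  have hq0 : (0:ℝ) < q := by exact_mod_cast hq
  have hlX : 0 ≤ Real.log X := Real.log_nonneg hX1
  have hqx : (q:ℝ) ≤ X := hqX.trans (by
    calc X^η ≤ X^(1:ℝ) := Real.rpow_le_rpow_of_exponent_le hX1 hη.le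
      _ = X := by simp)
  have key : ∀ N : ℕ, 2^i ≤ N → N ≤ 2^(i+1) → |∑ n ∈ (Icc 1 N).filter (fun n => q ∣ n), sg (-1) n| ≤
      C * ((N:ℝ)/q) / ((1-η) * (1 + Real.log X))^m := by
    intro N hN1 hN2
    have hN1' : X ≤ N := by rw [hX]; exact_mod_cast hN1
    have := h N q hq (hqx.trans hN1')
    rw [Nat.floor_natCast] at this
    refine this.trans ?_
    have hl : (1-η) * (1 + Real.log X) ≤ 1 + Real.log (N/q) := by
      rw [Real.log_div (by linarith) hq0.ne']
      have a1 := Real.log_le_log hX0 hN1'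
      have a2 := Real.log_le_log hq0 hqX
      rw [Real.log_rpow hX0] at a2
      nlinarith
    gcongr
  have hs := split_mult (fun n => sg (-1) n) q (2^i) M h1
  have k1 := key (2^i) le_rfl (Nat.pow_le_pow_right (by norm_num) (by omega))
  have k2 := key M h1 h2
  have e : ∑ n ∈ (Ioc (2^i) M).filter (fun n => q ∣ n), sg (-1) n =
    (∑ n ∈ (Icc 1 M).filter (fun n => q ∣ n), sg (-1) n) - (∑ n ∈ (Icc 1 (2^i)).filter (fun n => q ∣ n), sg (-1) n) := by
    linarith
  rw [e]
  have hM : (M:ℝ) ≤ 2 * X := by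
    have : (M:ℝ) ≤ 2^(i+1) := by exact_mod_cast h2
    rw [hX]; rw [pow_succ] at this; linarith
  push_cast at k1
  rw [← hX] at k1
  refine (abs_sub _ _).trans ?_
  calc _ ≤ C * ((M:ℝ)/q) / ((1-η) * (1 + Real.log X))^m + C * (X/q) / ((1-η) * (1 + Real.log X))^m := add_le_add k2 k1
    _ ≤ C * ((2*X)/q) / ((1-η) * (1 + Real.log X))^m + C * (X/q) / ((1-η) * (1 + Real.log X))^m := by gcongr
    _ = _ := by rw [mul_pow]; field_simp; ring

lemma osc_block (γ β δ c : ℝ) (hβ : 0 ≤ β) (hδ : 0 ≤ δ) (hs : β + δ < 1) (hc : 0 < c) (m : ℕ) :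
    ∃ C, 0 ≤ C ∧ ∀ i M q : ℕ, 0 < sig γ β i → c * Real.log ((2:ℝ)^i) ≤ sig γ β i → 2^i ≤ M → M ≤ 2^(i+1) → 1 ≤ q →
    (q:ℝ) ≤ ((2:ℝ)^i)^δ →
    |∑ n ∈ (Ioc (2^i) M).filter (fun n => q ∣ n), sg (-1) n * Wi γ β i n| ≤
      C * ((2:ℝ)^i/q) / (1 + Real.log ((2:ℝ)^i))^m := by
  obtain ⟨C, hC, h⟩ := L_block (β+δ) (by linarith) hs m
  refine ⟨C * (2 + 1/c), by positivity, ?_⟩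
  intro i M q hsig hcs h1 h2 hq hqX
  set X : ℝ := (2:ℝ)^i with hX
  have hX1 : 1 ≤ X := one_le_pow₀ one_le_two
  have hX0 : 0 < X := by linarith
  have hq0 : (0:ℝ) < q := by exact_mod_cast hq
  have hlX : 0 ≤ Real.log X := Real.log_nonneg hX1
  have hqx : (q:ℝ) ≤ X := hqX.trans (by
    calc X^δ ≤ X^(1:ℝ) := Real.rpow_le_rpow_of_exponent_le hX1 (by linarith)
      _ = X := by simp)
  set D := C * X / (1 + Real.log X)^m with hD
  have hD0 : 0 ≤ D := by positivity
  have hb : ∀ l : ℕ, 1 ≤ l → (l:ℝ) ≤ X^(β+δ) →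
      |∑ n ∈ (Ioc (2^i) M).filter (fun n => l ∣ n), sg (-1) n| ≤ D * (1 / l) := by
    intro l hl hlX
    refine (h i M l h1 h2 hl hlX).trans (le_of_eq ?_)
    rw [hD]; ring
  rw [Wi_sum]
  have t1 := hb q hq (hqX.trans (Real.rpow_le_rpow_of_exponent_le hX1 (by linarith)))
  have t2 : |∑ p ∈ PP γ β i, Real.log p * ∑ n ∈ (Ioc (2^i) M).filter (fun n => Nat.lcm p q ∣ n), sg (-1) n| ≤
      D * (1/q) * (sig γ β i * (1 + 1/c)) := by
    refine (Finset.abs_sum_le_sum_abs _ _).trans ?_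
    have : ∀ p ∈ PP γ β i, |Real.log p * ∑ n ∈ (Ioc (2^i) M).filter (fun n => Nat.lcm p q ∣ n), sg (-1) n| ≤
        D * (1/q) * (Real.log p / p + if p ∣ q then Real.log p else 0) := by
      intro p hp
      obtain ⟨p1, p2, p3⟩ := PP_mem hp
      have hp1 : (1:ℝ) ≤ p := by exact_mod_cast p1.one_le
      have hlp : 0 ≤ Real.log p := Real.log_nonneg hp1
      rw [abs_mul, abs_of_nonneg hlp]
      have hl1 : 1 ≤ Nat.lcm p q := Nat.lcm_pos p1.pos hq
      have hl2 : ((Nat.lcm p q : ℕ):ℝ) ≤ X^(β+δ) := by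
        have : Nat.lcm p q ≤ p * q := Nat.le_of_dvd (Nat.mul_pos p1.pos hq) (Nat.lcm_dvd_mul p q)
        have : ((Nat.lcm p q : ℕ):ℝ) ≤ p * q := by exact_mod_cast this
        rw [Real.rpow_add hX0]
        refine this.trans ?_
        gcongr
      have := hb _ hl1 hl2
      calc _ ≤ Real.log p * (D * (1 / (Nat.lcm p q : ℕ))) := by gcongr
        _ ≤ _ := by
          by_cases hd : p ∣ q
          · rw [if_pos hd, Nat.lcm_eq_right hd]
            have : 0 ≤ D * (1/q) * (Real.log p / p) := by positivity
            nlinarith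
          · rw [if_neg hd, Nat.Coprime.lcm_eq_mul ((Nat.Prime.coprime_iff_not_dvd p1).2 hd)]
            push_cast
            apply le_of_eq
            field_simp
            ring
    refine (Finset.sum_le_sum this).trans ?_
    rw [← Finset.mul_sum, Finset.sum_add_distrib, ← Finset.sum_filter]
    have l1 := log_dvd_sum (PP γ β i) (fun p hp => (PP_mem hp).1) q hq
    have l2 := Real.log_le_log hq0 hqx
    have l3 : Real.log X ≤ sig γ β i * (1/c) := by
      rw [mul_one_div, le_div_iff₀ hc]; linarith
    have : ∑ p ∈ PP γ β i, Real.log p / p = sig γ β i := rfl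
    rw [this]
    gcongr
    linarith
  refine (abs_sub _ _).trans ?_
  rw [abs_div, abs_of_pos hsig]
  calc _ ≤ D * (1/q) + D * (1/q) * (sig γ β i * (1 + 1/c)) / sig γ β i := by gcongr
    _ = _ := by rw [hD]; field_simp; ring

noncomputable def ww (γ β : ℝ) (i0 n : ℕ) : ℝ :=
  if n ≤ 1 ∨ Nat.log 2 (n-1) < i0 then 0 else Wi γ β (Nat.log 2 (n-1)) n

lemma log_block {i n : ℕ} (h1 : 2^i < n) (h2 : n ≤ 2^(i+1)) : Nat.log 2 (n-1) = i := by
  rw [Nat.log_eq_iff (Or.inr ⟨by norm_num, by have := Nat.one_le_two_pow (n := i); omega⟩)]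
  omega

lemma ww_block (γ β : ℝ) (i0 : ℕ) {i n : ℕ} (h1 : 2^i < n) (h2 : n ≤ 2^(i+1)) :
    ww γ β i0 n = if i < i0 then 0 else Wi γ β i n := by
  unfold ww
  rw [log_block h1 h2]
  have := Nat.one_le_two_pow (n := i)
  by_cases h : i < i0
  · simp [h]
  · rw [if_neg (by omega), if_neg h]

lemma ww_bound (γ β c : ℝ) (i0 : ℕ) (hc : 0 < c) (hi0 : 1 ≤ i0)
    (hsig : ∀ i, i0 ≤ i → 0 < sig γ β i ∧ c * Real.log ((2:ℝ)^i) ≤ sig γ β i) (n : ℕ) :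
    |ww γ β i0 n| ≤ 1 + 2/c := by
  unfold ww
  split_ifs with h
  · rw [abs_zero]; positivity
  · push Not at h
    set i := Nat.log 2 (n-1) with hi
    have h2 : n - 1 < 2^(i+1) := Nat.lt_pow_succ_log_self (by norm_num) _
    obtain ⟨s1, s2⟩ := hsig i h.2
    unfold Wi
    have l1 := log_dvd_sum (PP γ β i) (fun p hp => (PP_mem hp).1) n (by omega)
    have l2 : Real.log n ≤ Real.log ((2:ℝ)^(i+1)) := by
      apply Real.log_le_log
      · exact_mod_cast (by omega : 0 < n)
      · exact_mod_cast (by omega : n ≤ 2^(i+1))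
    have l3 : Real.log ((2:ℝ)^(i+1)) ≤ 2 * Real.log ((2:ℝ)^i) := by
      rw [Real.log_pow, Real.log_pow]
      have : 0 < Real.log 2 := Real.log_pos (by norm_num)
      have : (1:ℝ) ≤ i := by exact_mod_cast hi0.trans h.2
      push_cast; nlinarith
    have l0 : 0 ≤ ∑ p ∈ (PP γ β i).filter (fun p => p ∣ n), Real.log p :=
      Finset.sum_nonneg fun p hp => Real.log_natCast_nonneg p
    have : (∑ p ∈ (PP γ β i).filter (fun p => p ∣ n), Real.log p) / sig γ β i ≤ 2/c := by
      rw [div_le_div_iff₀ s1 hc]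
      nlinarith
    have : 0 ≤ (∑ p ∈ (PP γ β i).filter (fun p => p ∣ n), Real.log p) / sig γ β i := by positivity
    have : 0 < 2 / c := by positivity
    rw [abs_le]; constructor <;> linarith

lemma ww_BK1 (γ β : ℝ) (i0 : ℕ) (hβ : 0 ≤ β) (hs : γ + β < 1)
    (hsig : ∀ i, i0 ≤ i → 0 < sig γ β i) : BK (ww γ β i0) γ := by
  intro m
  obtain ⟨C, hC, h⟩ := Lg_pow_le_rpow m (1 - γ - β) (by linarith)
  refine ⟨2 * C, by positivity, ?_⟩
  intro i M q h1 h2 hq hqX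
  have hX1 : (1:ℝ) ≤ 2^i := one_le_pow₀ one_le_two
  have hX0 : (0:ℝ) < 2^i := by linarith
  have hq0 : (0:ℝ) < q := by exact_mod_cast hq
  have hlX : 0 ≤ Real.log ((2:ℝ)^i) := Real.log_nonneg hX1
  have e : ∑ n ∈ (Ioc (2^i) M).filter (fun n => q ∣ n), ww γ β i0 n =
      ∑ n ∈ (Ioc (2^i) M).filter (fun n => q ∣ n), (if i < i0 then 0 else Wi γ β i n) := by
    refine Finset.sum_congr rfl fun n hn => ?_
    have := mem_Ioc.1 (mem_filter.1 hn).1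
    exact ww_block _ _ _ this.1 (this.2.trans h2)
  rw [e]
  by_cases hi : i < i0
  · simp only [if_pos hi, Finset.sum_const_zero, abs_zero]; positivity
  · simp only [if_neg hi]
    refine (cancel_block γ β i M q hβ (hsig i (by omega)) h1 hq hqX).trans ?_
    rw [le_div_iff₀ (by positivity)]
    have := h _ hX1
    set X : ℝ := 2^i with hX
    calc 2 * X^β * (1 + Real.log X)^m ≤ 2 * X^β * (C * X^(1-γ-β)) := by gcongr
      _ = 2 * C * (X^β * X^(1-γ-β)) := by ring
      _ = 2 * C * (X / X^γ) := by
        rw [← Real.rpow_add hX0, show β + (1-γ-β) = 1 - γ by ring, Real.rpow_sub hX0, Real.rpow_one]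
      _ ≤ _ := by gcongr

lemma ww_BK2 (γ β δ c : ℝ) (i0 : ℕ) (hβ : 0 ≤ β) (hδ : 0 ≤ δ) (hs : β + δ < 1) (hc : 0 < c)
    (hsig : ∀ i, i0 ≤ i → 0 < sig γ β i ∧ c * Real.log ((2:ℝ)^i) ≤ sig γ β i) :
    BK (fun n => sg (-1) n * ww γ β i0 n) δ := by
  intro m
  obtain ⟨C, hC, h⟩ := osc_block γ β δ c hβ hδ hs hc m
  refine ⟨C, hC, ?_⟩
  intro i M q h1 h2 hq hqX
  have hX1 : (1:ℝ) ≤ 2^i := one_le_pow₀ one_le_two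
  have hlX : 0 ≤ Real.log ((2:ℝ)^i) := Real.log_nonneg hX1
  have e : ∑ n ∈ (Ioc (2^i) M).filter (fun n => q ∣ n), sg (-1) n * ww γ β i0 n =
      ∑ n ∈ (Ioc (2^i) M).filter (fun n => q ∣ n), sg (-1) n * (if i < i0 then 0 else Wi γ β i n) := by
    refine Finset.sum_congr rfl fun n hn => ?_
    have := mem_Ioc.1 (mem_filter.1 hn).1
    rw [ww_block _ _ _ this.1 (this.2.trans h2)]
  rw [e]
  by_cases hi : i < i0
  · simp only [if_pos hi, mul_zero, Finset.sum_const_zero, abs_zero]; positivity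
  · simp only [if_neg hi]
    obtain ⟨s1, s2⟩ := hsig i (by omega)
    exact h i M q s1 s2 h1 h2 hq hqX

open ArithmeticFunction in
noncomputable def lpw (k : ℕ) : ArithmeticFunction ℝ := ⟨fun n => if n = 0 then 0 else Real.log n ^ k, by simp⟩

lemma lpw_apply (k : ℕ) {n : ℕ} (hn : n ≠ 0) : lpw k n = Real.log n ^ k := by
  show (if n = 0 then 0 else Real.log n ^ k) = _
  rw [if_neg hn]

open ArithmeticFunction in
noncomputable def LA (k : ℕ) : ArithmeticFunction ℝ := (moebius : ArithmeticFunction ℝ) * lpw k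

open ArithmeticFunction in
lemma LA_eq (k n : ℕ) : Lambdak k n = LA k n := by
  unfold Lambdak LA
  rw [ArithmeticFunction.mul_apply, Nat.sum_divisorsAntidiagonal (f := fun a b => (moebius : ArithmeticFunction ℝ) a * lpw k b)]
  refine Finset.sum_congr rfl fun d hd => ?_
  obtain ⟨h1, h2⟩ := Nat.mem_divisors.1 hd
  have hd0 : 0 < d := Nat.pos_of_mem_divisors hd
  rw [lpw_apply _ (Nat.div_pos (Nat.le_of_dvd (Nat.pos_of_ne_zero h2) h1) hd0).ne', Nat.cast_div h1 (by positivity)]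
  rfl

open ArithmeticFunction in
lemma logder_mul (f g : ArithmeticFunction ℝ) :
    (f * g).pmul ArithmeticFunction.log = f.pmul ArithmeticFunction.log * g + f * g.pmul ArithmeticFunction.log := by
  ext n
  rw [pmul_apply, ArithmeticFunction.add_apply, mul_apply, mul_apply, mul_apply, Finset.sum_mul, ← Finset.sum_add_distrib]
  refine Finset.sum_congr rfl fun x hx => ?_
  obtain ⟨h1, h2⟩ := Nat.mem_divisorsAntidiagonal.1 hx
  rw [pmul_apply, pmul_apply, log_apply, log_apply, log_apply, ← h1]
  have : x.1 ≠ 0 := by rintro h; simp [h] at h1; exact h2 h1.symm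
  have : x.2 ≠ 0 := by rintro h; simp [h] at h1; exact h2 h1.symm
  push_cast
  rw [Real.log_mul (by positivity) (by positivity)]
  ring

open ArithmeticFunction in
lemma LA_rec (k : ℕ) : LA (k+1) = (LA k).pmul ArithmeticFunction.log + vonMangoldt * LA k := by
  have h1 : lpw (k+1) = (lpw k).pmul ArithmeticFunction.log := by
    ext n
    rw [pmul_apply, log_apply]
    by_cases hn : n = 0
    · simp [hn]
    · rw [lpw_apply _ hn, lpw_apply _ hn, pow_succ]
  have h2 := logder_mul (moebius : ArithmeticFunction ℝ) (lpw k)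
  have h3 := logder_mul (zeta : ArithmeticFunction ℝ) (moebius : ArithmeticFunction ℝ)
  have h4 : (zeta : ArithmeticFunction ℝ).pmul ArithmeticFunction.log = ArithmeticFunction.log := zeta_pmul _
  have h5 : ((1 : ArithmeticFunction ℝ)).pmul ArithmeticFunction.log = 0 := by
    ext n
    rw [pmul_apply, one_apply, log_apply]
    by_cases hn : n = 1 <;> simp [hn]
  rw [coe_zeta_mul_coe_moebius, h4, h5] at h3
  have h6 : (moebius : ArithmeticFunction ℝ).pmul ArithmeticFunction.log = - (vonMangoldt * (moebius : ArithmeticFunction ℝ)) := by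
    have e : (moebius : ArithmeticFunction ℝ) * (zeta : ArithmeticFunction ℝ) = 1 := coe_moebius_mul_coe_zeta
    have h7 := congrArg (fun z => (moebius : ArithmeticFunction ℝ) * z) h3
    simp only [mul_zero, mul_add, ← mul_assoc, e, one_mul] at h7
    rw [moebius_mul_log_eq_vonMangoldt] at h7
    exact (neg_eq_of_add_eq_zero_right h7.symm).symm
  unfold LA
  rw [h1, h2, h6]
  ring

open ArithmeticFunction in
lemma LA_zero : LA 0 = 1 := by
  have : lpw 0 = (zeta : ArithmeticFunction ℝ) := by
    ext n
    by_cases hn : n = 0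
    · simp [hn]
    · rw [lpw_apply _ hn]; simp [hn]
  unfold LA
  rw [this, coe_moebius_mul_coe_zeta]

open ArithmeticFunction in
lemma LA_one : LA 1 = vonMangoldt := by
  rw [LA_rec, LA_zero]
  ext n
  simp only [mul_one, ArithmeticFunction.add_apply, pmul_apply, one_apply, log_apply]
  by_cases hn : n = 1 <;> simp [hn]

open ArithmeticFunction in
lemma LA_nonneg (k n : ℕ) : 0 ≤ LA k n := by
  induction k generalizing n with
  | zero => rw [LA_zero, one_apply]; split_ifs <;> norm_num
  | succ k ih =>
    rw [LA_rec, ArithmeticFunction.add_apply, pmul_apply, log_apply, mul_apply]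
    have := Real.log_natCast_nonneg n
    have h2 := Finset.sum_nonneg (s := n.divisorsAntidiagonal) (f := fun x => vonMangoldt x.1 * LA k x.2)
      (fun x _ => mul_nonneg vonMangoldt_nonneg (ih _))
    have := mul_nonneg (ih n) this
    linarith

open ArithmeticFunction in
lemma LA_le (k n : ℕ) (hn : n ≠ 0) : LA k n ≤ Real.log n ^ k := by
  have h : (zeta : ArithmeticFunction ℝ) * LA k = lpw k := by
    unfold LA
    rw [← mul_assoc, coe_zeta_mul_coe_moebius, one_mul]
  have h2 := congrArg (fun f : ArithmeticFunction ℝ => f n) h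
  simp only [coe_zeta_mul_apply, lpw_apply _ hn] at h2
  rw [← h2]
  exact Finset.single_le_sum (f := fun d => LA k d) (fun d _ => LA_nonneg k d) (Nat.mem_divisors_self n hn)

open ArithmeticFunction in
lemma LA_prime_mul (k p m : ℕ) (hp : p.Prime) (hm : m ≠ 0) (hpm : ¬ p ∣ m) :
    LA k (p * m) = ∑ j ∈ range k, (k.choose j : ℝ) * Real.log p ^ (k-j) * LA j m := by
  have hp0 : (0:ℝ) < p := by exact_mod_cast hp.pos
  have hcop : Nat.Coprime p m := (Nat.Prime.coprime_iff_not_dvd hp).2 hpm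
  have hlp : ∀ d ∈ m.divisors, Real.log ((p*m : ℕ) / (d:ℝ)) = Real.log ((m:ℝ)/d) + Real.log p := by
    intro d hd
    have : (0:ℝ) < d := by exact_mod_cast Nat.pos_of_mem_divisors hd
    have : (0:ℝ) < m := by exact_mod_cast Nat.pos_of_ne_zero hm
    push_cast
    rw [mul_div_assoc, Real.log_mul (by positivity) (by positivity)]; ring
  have hdiv : (p*m).divisors = m.divisors ∪ m.divisors.image (fun d => p * d) := by
    ext d
    simp only [Nat.mem_divisors, mem_union, mem_image]
    constructor
    · rintro ⟨h1, h2⟩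
      by_cases hd : p ∣ d
      · right
        obtain ⟨e, rfl⟩ := hd
        exact ⟨e, ⟨Nat.dvd_of_mul_dvd_mul_left hp.pos h1, hm⟩, rfl⟩
      · left
        exact ⟨Nat.Coprime.dvd_of_dvd_mul_left ((Nat.Prime.coprime_iff_not_dvd hp).2 hd).symm h1, hm⟩
    · rintro (⟨h1, h2⟩ | ⟨e, ⟨h1, h2⟩, rfl⟩)
      · exact ⟨h1.mul_left p, Nat.mul_ne_zero hp.ne_zero hm⟩
      · exact ⟨Nat.mul_dvd_mul_left p h1, Nat.mul_ne_zero hp.ne_zero hm⟩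
  have hdisj : Disjoint m.divisors (m.divisors.image (fun d => p * d)) := by
    rw [Finset.disjoint_left]
    intro d hd hd'
    obtain ⟨e, he, rfl⟩ := mem_image.1 hd'
    exact hpm ((Dvd.intro _ rfl).trans (Nat.mem_divisors.1 hd).1)
  simp_rw [← LA_eq]
  unfold Lambdak
  rw [hdiv, Finset.sum_union hdisj, Finset.sum_image (fun a _ b _ h => Nat.eq_of_mul_eq_mul_left hp.pos h)]
  simp_rw [Finset.mul_sum]
  rw [Finset.sum_comm, ← Finset.sum_add_distrib]
  refine Finset.sum_congr rfl fun d hd => ?_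
  have hd0 : (0:ℝ) < d := by exact_mod_cast Nat.pos_of_mem_divisors hd
  have hmu : (moebius (p * d) : ℝ) = - moebius d := by
    have : Nat.Coprime p d := Nat.Coprime.coprime_dvd_right (Nat.mem_divisors.1 hd).1 hcop
    rw [isMultiplicative_moebius.map_mul_of_coprime this, moebius_apply_prime hp]
    push_cast; ring
  have hc : ((p * m : ℕ):ℝ) / ((p * d : ℕ):ℝ) = m / d := by
    push_cast; field_simp
  rw [hmu, hc, hlp d hd, add_pow, Finset.sum_range_succ]
  simp only [Nat.choose_self, Nat.sub_self, pow_zero, Nat.cast_one, mul_one]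
  rw [mul_add, Finset.mul_sum]
  have : ∀ j ∈ range k, (moebius d : ℝ) * (Real.log ((m:ℝ)/d) ^ j * Real.log p ^ (k-j) * (k.choose j : ℝ)) =
    (k.choose j : ℝ) * Real.log p ^ (k-j) * ((moebius d : ℝ) * Real.log ((m:ℝ)/d)^j) := fun j _ => by ring
  rw [Finset.sum_congr rfl this]
  ring

def AS (f : ℕ → ℝ) (c : ℝ) (j : ℕ) : Prop := ∀ ε : ℝ, 0 < ε → ∃ C : ℝ, 0 ≤ C ∧ ∀ N : ℕ, 1 ≤ N →
  |∑ n ∈ Icc 1 N, f n - c * N * Real.log N ^ j| ≤ ε * N * (1 + Real.log N)^j + C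

def KB (g : ℕ → ℝ) (j : ℕ) : Prop := ∃ K : ℝ, 0 ≤ K ∧ ∀ N : ℕ, 1 ≤ N →
  ∑ n ∈ Icc 1 N, g n ≤ K * N * (1 + Real.log N)^j

lemma abel_id (f w : ℕ → ℝ) (N : ℕ) (hN : 1 ≤ N) : ∑ n ∈ Icc 1 N, f n * w n =
    (∑ n ∈ Icc 1 N, f n) * w N - ∑ i ∈ Ico 1 N, (∑ n ∈ Icc 1 i, f n) * (w (i+1) - w i) := by
  induction N, hN using Nat.le_induction with
  | base => simp
  | succ N hN ih =>
    rw [Finset.sum_Icc_succ_top (by omega), Finset.sum_Icc_succ_top (by omega), Finset.sum_Ico_succ_top (by omega), ih]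
    ring

lemma log_succ_sub (i : ℕ) (hi : 1 ≤ i) : 1/((i:ℝ)+1) ≤ Real.log ((i+1 : ℕ):ℝ) - Real.log i ∧
    Real.log ((i+1 : ℕ):ℝ) - Real.log i ≤ 1/(i:ℝ) := by
  have h0 : (0:ℝ) < i := by exact_mod_cast hi
  push_cast
  rw [← Real.log_div (by positivity) (by positivity)]
  constructor
  · have := Real.one_sub_inv_le_log_of_pos (x := ((i:ℝ)+1)/i) (by positivity)
    refine le_trans (le_of_eq ?_) this
    field_simp; ring
  · have := Real.log_le_sub_one_of_pos (x := ((i:ℝ)+1)/i) (by positivity)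
    refine le_trans this (le_of_eq ?_)
    field_simp; ring

lemma sum_inv_le (N : ℕ) (hN : 1 ≤ N) : ∑ i ∈ Ico 1 N, 1/((i:ℝ)+1) ≤ Real.log N := by
  calc _ ≤ ∑ i ∈ Ico 1 N, (Real.log ((i+1:ℕ):ℝ) - Real.log (i:ℕ)) :=
        Finset.sum_le_sum fun i hi => (log_succ_sub i (mem_Ico.1 hi).1).1
    _ = _ := by rw [Finset.sum_Ico_sub (fun i : ℕ => Real.log (i:ℝ)) hN]; simp

lemma sum_inv2_le (N : ℕ) (hN : 1 ≤ N) : ∑ i ∈ Ico 1 N, (1/(i:ℝ) - 1/((i:ℝ)+1)) ≤ 1 := by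
  have h := Finset.sum_Ico_sub (fun i : ℕ => -(1/(i:ℝ))) hN
  have : ∑ i ∈ Ico 1 N, (1/(i:ℝ) - 1/((i:ℝ)+1)) = ∑ i ∈ Ico 1 N, (-(1/((i+1 : ℕ):ℝ)) - -(1/(i:ℝ))) :=
    Finset.sum_congr rfl fun i _ => by push_cast; ring
  rw [this, h]
  have : 0 ≤ 1/(N:ℝ) := by positivity
  simp at this ⊢

lemma main_sum (j N : ℕ) (hN : 1 ≤ N) :
    |∑ i ∈ Ico 1 N, Real.log i ^ j / ((i:ℝ)+1) - Real.log N ^ (j+1) / (j+1)| ≤ 2 * (1 + Real.log N)^j := by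
  have hLN : 0 ≤ Real.log N := Real.log_natCast_nonneg N
  have htel : Real.log N ^ (j+1) / (j+1) = ∑ i ∈ Ico 1 N, (Real.log ((i+1:ℕ):ℝ)^(j+1)/(j+1) - Real.log (i:ℕ)^(j+1)/(j+1)) := by
    rw [Finset.sum_Ico_sub (fun i : ℕ => Real.log (i:ℝ) ^ (j+1) / (j+1)) hN]; simp
  have htel2 : Real.log N ^ j ≥ ∑ i ∈ Ico 1 N, (Real.log ((i+1:ℕ):ℝ)^j - Real.log (i:ℕ)^j) := by
    rw [Finset.sum_Ico_sub (fun i : ℕ => Real.log (i:ℝ) ^ j) hN]; simp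
  have hpow : ∀ a b : ℝ, 0 ≤ a → a ≤ b → a^j * (b - a) ≤ b^(j+1)/(j+1) - a^(j+1)/(j+1) ∧
      b^(j+1)/(j+1) - a^(j+1)/(j+1) ≤ b^j * (b-a) := by
    intro a b ha hab
    have hj : (0:ℝ) < (j:ℝ)+1 := by positivity
    have e : b^(j+1) - a^(j+1) = (∑ i ∈ range (j+1), b^i * a^(j-i)) * (b-a) := by
      rw [← geom_sum₂_mul]; simp
    have l : ((j:ℝ)+1) * a^j ≤ ∑ i ∈ range (j+1), b^i * a^(j-i) := by
      calc ((j:ℝ)+1) * a^j = ∑ i ∈ range (j+1), a^j := by simp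
        _ ≤ _ := Finset.sum_le_sum fun i hi => by
          have : i + (j - i) = j := by have := mem_range.1 hi; omega
          calc a^j = a^i * a^(j-i) := by rw [← pow_add, this]
            _ ≤ _ := by gcongr
    have u : ∑ i ∈ range (j+1), b^i * a^(j-i) ≤ ((j:ℝ)+1) * b^j := by
      calc _ ≤ ∑ i ∈ range (j+1), b^j := Finset.sum_le_sum fun i hi => by
            have : i + (j - i) = j := by have := mem_range.1 hi; omega
            have hb : 0 ≤ b := ha.trans hab
            calc b^i * a^(j-i) ≤ b^i * b^(j-i) := by gcongr
              _ = _ := by rw [← pow_add, this]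
        _ = _ := by simp
    have hba : 0 ≤ b - a := by linarith
    rw [← sub_div, le_div_iff₀ hj, div_le_iff₀ hj, e]
    constructor
    · nlinarith [mul_le_mul_of_nonneg_right l hba]
    · nlinarith [mul_le_mul_of_nonneg_right u hba]
  rw [htel]
  have h1 : ∑ i ∈ Ico 1 N, Real.log i ^ j / ((i:ℝ)+1) ≤
      ∑ i ∈ Ico 1 N, (Real.log ((i+1:ℕ):ℝ)^(j+1)/(j+1) - Real.log (i:ℕ)^(j+1)/(j+1)) := by
    refine Finset.sum_le_sum fun i hi => ?_
    obtain ⟨l1, l2⟩ := log_succ_sub i (mem_Ico.1 hi).1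
    have ha : 0 ≤ Real.log (i:ℝ) := Real.log_natCast_nonneg i
    have h0 : 0 ≤ 1/((i:ℝ)+1) := by positivity
    refine le_trans ?_ (hpow _ _ ha (by linarith)).1
    rw [div_eq_mul_one_div]
    gcongr
  have h2 : ∑ i ∈ Ico 1 N, (Real.log ((i+1:ℕ):ℝ)^(j+1)/(j+1) - Real.log (i:ℕ)^(j+1)/(j+1)) ≤
      ∑ i ∈ Ico 1 N, (Real.log i ^ j / ((i:ℝ)+1) + ((1 + Real.log N)^j * (1/(i:ℝ) - 1/((i:ℝ)+1)) +
        (Real.log ((i+1:ℕ):ℝ)^j - Real.log (i:ℕ)^j))) := by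
    refine Finset.sum_le_sum fun i hi => ?_
    obtain ⟨hi1, hi2⟩ := mem_Ico.1 hi
    obtain ⟨l1, l2⟩ := log_succ_sub i hi1
    have hi0 : (0:ℝ) < i := by exact_mod_cast hi1
    have ha : 0 ≤ Real.log (i:ℝ) := Real.log_natCast_nonneg i
    have h0 : 0 ≤ 1/((i:ℝ)+1) := by positivity
    have hbN : Real.log ((i+1:ℕ):ℝ) ≤ 1 + Real.log N := by
      have : Real.log ((i+1:ℕ):ℝ) ≤ Real.log N := Real.log_le_log (by positivity) (by exact_mod_cast hi2)
      linarith
    set b := Real.log ((i+1:ℕ):ℝ) with hb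
    set a := Real.log (i:ℝ) with ha'
    have hb0 : 0 ≤ b := by linarith
    refine (hpow a b ha (by linarith)).2.trans ?_
    have t1 : b^j * (b-a) ≤ b^j * (1/(i:ℝ)) := by gcongr
    have t2 : b^j * (1/(i:ℝ) - 1/((i:ℝ)+1)) ≤ (1 + Real.log N)^j * (1/(i:ℝ) - 1/((i:ℝ)+1)) := by
      have : 0 ≤ 1/(i:ℝ) - 1/((i:ℝ)+1) := by
        rw [sub_nonneg]; apply one_div_le_one_div_of_le hi0; linarith
      gcongr
    have hab : a^j ≤ b^j := by gcongr; linarith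
    have t3 : (b^j - a^j) * (1/((i:ℝ)+1)) ≤ (b^j - a^j) * 1 := by
      apply mul_le_mul_of_nonneg_left _ (by linarith)
      rw [div_le_one (by positivity)]; linarith
    have e : a^j / ((i:ℝ)+1) = a^j * (1/((i:ℝ)+1)) := by rw [mul_one_div]
    rw [e]
    linarith
  rw [Finset.sum_add_distrib, Finset.sum_add_distrib, ← Finset.mul_sum] at h2
  have h3 : (1 + Real.log N)^j * ∑ i ∈ Ico 1 N, (1/(i:ℝ) - 1/((i:ℝ)+1)) ≤ (1 + Real.log N)^j * 1 := by
    gcongr; exact sum_inv2_le N hN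
  have h4 : Real.log N ^ j ≤ (1 + Real.log N)^j := by gcongr; linarith
  have h5 : 0 ≤ (1 + Real.log N)^j := by positivity
  rw [abs_le]
  constructor <;> linarith

lemma absorb (K ε : ℝ) (hK : 0 ≤ K) (hε : 0 < ε) (j : ℕ) : ∃ C, 0 ≤ C ∧ ∀ y : ℝ, 1 ≤ y →
    K * y * (1 + Real.log y)^j ≤ ε * y * (1 + Real.log y)^(j+1) + C := by
  refine ⟨K * Real.exp (K/ε) * (K/ε)^j, by positivity, ?_⟩
  intro y hy
  have hL : 0 ≤ Real.log y := Real.log_nonneg hy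
  rcases le_total (K/ε) (1 + Real.log y) with h | h
  · rw [div_le_iff₀ hε] at h
    have : 0 ≤ K * Real.exp (K/ε) * (K/ε)^j := by positivity
    have h2 : K * y * (1 + Real.log y)^j ≤ ((1 + Real.log y) * ε) * y * (1 + Real.log y)^j := by gcongr
    rw [pow_succ]; linarith
  · have h1 : y ≤ Real.exp (K/ε) := by
      rw [← Real.log_le_iff_le_exp (by linarith)]; linarith
    have : 0 ≤ ε * y * (1 + Real.log y)^(j+1) := by positivity
    have : K * y * (1 + Real.log y)^j ≤ K * Real.exp (K/ε) * (K/ε)^j := by gcongr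
    linarith

lemma absorb2 (K ε : ℝ) (hK : 0 ≤ K) (hε : 0 < ε) (j : ℕ) : ∃ C, 0 ≤ C ∧ ∀ y : ℝ, 1 ≤ y →
    K * (1 + Real.log y)^j ≤ ε * y + C := by
  obtain ⟨D, hD, h⟩ := Lg_pow_le_rpow j (1/2) (by norm_num)
  refine ⟨(K*D)^2/(4*ε), by positivity, ?_⟩
  intro y hy
  have h1 := h y hy
  rw [← Real.sqrt_eq_rpow] at h1
  have h2 : K * (1 + Real.log y)^j ≤ K * (D * √y) := by gcongr
  have h3 : √y * √y = y := Real.mul_self_sqrt (by linarith)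
  refine h2.trans ?_
  rw [← sub_nonneg]
  have : ε * y + (K*D)^2/(4*ε) - K * (D * √y) = ε * (√y - K*D/(2*ε))^2 := by
    field_simp; linear_combination (-16*ε^2)*h3
  rw [this]; positivity

lemma L1_log (f g : ℕ → ℝ) (j : ℕ) (hfg : ∀ n, |f n| ≤ g n) (hg : KB g j) : ∃ K, 0 ≤ K ∧ ∀ N : ℕ, 1 ≤ N →
    |∑ n ∈ Icc 1 N, f n * Real.log n - (∑ n ∈ Icc 1 N, f n) * Real.log N| ≤ K * N * (1 + Real.log N)^j := by
  obtain ⟨K, hK, h⟩ := hg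
  refine ⟨K, hK, fun N hN => ?_⟩
  have e : ∑ n ∈ Icc 1 N, f n * Real.log n - (∑ n ∈ Icc 1 N, f n) * Real.log N =
      ∑ n ∈ Icc 1 N, f n * (Real.log n - Real.log N) := by
    rw [Finset.sum_mul, ← Finset.sum_sub_distrib]
    exact Finset.sum_congr rfl fun n _ => by ring
  rw [e]
  calc _ ≤ ∑ n ∈ Icc 1 N, |f n * (Real.log n - Real.log N)| := Finset.abs_sum_le_sum_abs _ _
    _ ≤ ∑ n ∈ Icc 1 N, g n * (Real.log N - Real.log n) := by
      refine Finset.sum_le_sum fun n hn => ?_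
      obtain ⟨h1, h2⟩ := mem_Icc.1 hn
      have : Real.log n ≤ Real.log N := Real.log_le_log (by exact_mod_cast h1) (by exact_mod_cast h2)
      rw [abs_mul, abs_sub_comm, abs_of_nonneg (by linarith : 0 ≤ Real.log N - Real.log n)]
      exact mul_le_mul_of_nonneg_right (hfg n) (by linarith)
    _ = (∑ n ∈ Icc 1 N, g n) * Real.log N - ∑ n ∈ Icc 1 N, g n * Real.log n := by
      rw [Finset.sum_mul, ← Finset.sum_sub_distrib]
      exact Finset.sum_congr rfl fun n _ => by ring
    _ = ∑ i ∈ Ico 1 N, (∑ n ∈ Icc 1 i, g n) * (Real.log ((i+1:ℕ):ℝ) - Real.log i) := by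
      rw [abel_id g (fun n => Real.log n) N hN]; ring
    _ ≤ ∑ i ∈ Ico 1 N, K * (1 + Real.log N)^j := by
      refine Finset.sum_le_sum fun i hi => ?_
      obtain ⟨h1, h2⟩ := mem_Ico.1 hi
      have hi0 : (0:ℝ) < i := by exact_mod_cast h1
      obtain ⟨l1, l2⟩ := log_succ_sub i h1
      have l0 : 0 ≤ 1/((i:ℝ)+1) := by positivity
      have hi1 : 0 ≤ Real.log i := Real.log_natCast_nonneg i
      have hiN : Real.log i ≤ Real.log N := Real.log_le_log hi0 (by exact_mod_cast h2.le)
      calc _ ≤ (K * i * (1 + Real.log i)^j) * (1/i) := by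
            apply mul_le_mul (h i h1) l2 (by linarith) (by positivity)
        _ = K * (1 + Real.log i)^j := by field_simp
        _ ≤ _ := by gcongr
    _ ≤ _ := by
      rw [Finset.sum_const, nsmul_eq_mul, Nat.card_Ico]
      have : ((N-1:ℕ):ℝ) ≤ N := by exact_mod_cast Nat.sub_le N 1
      have hL : 0 ≤ Real.log N := Real.log_natCast_nonneg N
      have : 0 ≤ K * (1 + Real.log N)^j := by positivity
      nlinarith

lemma L2_inv (g : ℕ → ℝ) (j : ℕ) (hg : KB g j) : ∃ K, 0 ≤ K ∧ ∀ N : ℕ, 1 ≤ N →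
    ∑ n ∈ Icc 1 N, g n * (1/(n:ℝ)) ≤ K * (1 + Real.log N)^(j+1) := by
  obtain ⟨K, hK, h⟩ := hg
  refine ⟨K, hK, fun N hN => ?_⟩
  have hN0 : (0:ℝ) < N := by exact_mod_cast hN
  have hL : 0 ≤ Real.log N := Real.log_natCast_nonneg N
  rw [abel_id g (fun n => 1/(n:ℝ)) N hN]
  have h1 : (∑ n ∈ Icc 1 N, g n) * (1/(N:ℝ)) ≤ K * (1 + Real.log N)^j := by
    rw [mul_one_div, div_le_iff₀ hN0]; linarith [h N hN]
  have h2 : ∑ i ∈ Ico 1 N, -((∑ n ∈ Icc 1 i, g n) * (1/((i+1:ℕ):ℝ) - 1/(i:ℝ))) ≤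
      ∑ i ∈ Ico 1 N, (K * (1 + Real.log N)^j) * (1/((i:ℝ)+1)) := by
    refine Finset.sum_le_sum fun i hi => ?_
    obtain ⟨a1, a2⟩ := mem_Ico.1 hi
    have hi0 : (0:ℝ) < i := by exact_mod_cast a1
    have hi1 : 0 ≤ Real.log i := Real.log_natCast_nonneg i
    have hiN : Real.log i ≤ Real.log N := Real.log_le_log hi0 (by exact_mod_cast a2.le)
    calc _ = (∑ n ∈ Icc 1 i, g n) * (1/(i*((i:ℝ)+1))) := by push_cast; field_simp; ring
      _ ≤ (K * i * (1 + Real.log i)^j) * (1/(i*((i:ℝ)+1))) := by gcongr; exact h i a1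
      _ = (K * (1 + Real.log i)^j) * (1/((i:ℝ)+1)) := by field_simp
      _ ≤ _ := by gcongr
  rw [Finset.sum_neg_distrib, ← Finset.mul_sum] at h2
  have h3 : (K * (1 + Real.log N)^j) * ∑ i ∈ Ico 1 N, 1/((i:ℝ)+1) ≤ (K * (1 + Real.log N)^j) * Real.log N := by
    gcongr; exact sum_inv_le N hN
  rw [pow_succ]
  linarith

lemma L3_inv (f : ℕ → ℝ) (c : ℝ) (j : ℕ) (hf : AS f c j) (ε : ℝ) (hε : 0 < ε) : ∃ C, 0 ≤ C ∧ ∀ N : ℕ, 1 ≤ N →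
    |∑ n ∈ Icc 1 N, f n * (1/(n:ℝ)) - c * (Real.log N ^ (j+1) / (j+1))| ≤
      ε * (1 + Real.log N)^(j+1) + C * (1 + Real.log N)^j := by
  obtain ⟨C, hC, h⟩ := hf ε hε
  refine ⟨|c| + ε + C + C + |c| * 2, by positivity, fun N hN => ?_⟩
  have hN0 : (0:ℝ) < N := by exact_mod_cast hN
  have hN1 : (1:ℝ) ≤ N := by exact_mod_cast hN
  have hL : 0 ≤ Real.log N := Real.log_natCast_nonneg N
  set P := (1 + Real.log N)^j with hP
  have hP1 : 1 ≤ P := one_le_pow₀ (by linarith)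
  rw [abel_id f (fun n => 1/(n:ℝ)) N hN]
  have h1 : |(∑ n ∈ Icc 1 N, f n) * (1/(N:ℝ))| ≤ (|c| + ε + C) * P := by
    rw [abs_mul, abs_of_nonneg (by positivity : 0 ≤ 1/(N:ℝ)), mul_one_div, div_le_iff₀ hN0]
    have a1 := h N hN
    have a2 : |c * N * Real.log N ^ j| ≤ |c| * N * P := by
      rw [abs_mul, abs_mul, abs_of_pos hN0, abs_of_nonneg (by positivity : 0 ≤ Real.log N ^ j), hP]
      gcongr; linarith
    have a3 : |∑ n ∈ Icc 1 N, f n| ≤ |∑ n ∈ Icc 1 N, f n - c * N * Real.log N ^ j| + |c * N * Real.log N ^ j| := by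
      have := abs_add_le (∑ n ∈ Icc 1 N, f n - c * N * Real.log N ^ j) (c * N * Real.log N ^ j)
      simpa using this
    have a4 : C ≤ C * P * N := by
      have : 1 ≤ P * N := by nlinarith
      nlinarith
    nlinarith
  have h2 : |∑ i ∈ Ico 1 N, ((∑ n ∈ Icc 1 i, f n) * (1/((i+1:ℕ):ℝ) - 1/(i:ℝ)) + c * (Real.log i ^ j / ((i:ℝ)+1)))| ≤
      ∑ i ∈ Ico 1 N, ((ε * P) * (1/((i:ℝ)+1)) + C * (1/(i:ℝ) - 1/((i:ℝ)+1))) := by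
    refine (Finset.abs_sum_le_sum_abs _ _).trans (Finset.sum_le_sum fun i hi => ?_)
    obtain ⟨a1, a2⟩ := mem_Ico.1 hi
    have hi0 : (0:ℝ) < i := by exact_mod_cast a1
    have hi1 : 0 ≤ Real.log i := Real.log_natCast_nonneg i
    have hiN : Real.log i ≤ Real.log N := Real.log_le_log hi0 (by exact_mod_cast a2.le)
    calc _ = |∑ n ∈ Icc 1 i, f n - c * i * Real.log i ^ j| * (1/(i*((i:ℝ)+1))) := by
          rw [← abs_of_nonneg (by positivity : 0 ≤ 1/(i*((i:ℝ)+1))), ← abs_mul, ← abs_neg]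
          congr 1
          push_cast; field_simp; ring
      _ ≤ (ε * i * (1 + Real.log i)^j + C) * (1/(i*((i:ℝ)+1))) := by gcongr; exact h i a1
      _ = (ε * (1 + Real.log i)^j) * (1/((i:ℝ)+1)) + C * (1/(i:ℝ) - 1/((i:ℝ)+1)) := by field_simp; ring
      _ ≤ _ := by rw [hP]; gcongr
  rw [Finset.sum_add_distrib, Finset.sum_add_distrib, ← Finset.mul_sum, ← Finset.mul_sum, ← Finset.mul_sum] at h2
  have h3 := sum_inv_le N hN
  have h4 := sum_inv2_le N hN
  have h5 := main_sum j N hN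
  have h6 : |c * (∑ i ∈ Ico 1 N, Real.log i ^ j / ((i:ℝ)+1)) - c * (Real.log N ^ (j+1) / (j+1))| ≤ |c| * (2 * P) := by
    rw [← mul_sub, abs_mul]; gcongr
  have h7 : ε * P * (∑ i ∈ Ico 1 N, 1/((i:ℝ)+1)) ≤ ε * P * Real.log N := by gcongr
  have h8 : C * ∑ i ∈ Ico 1 N, (1/(i:ℝ) - 1/((i:ℝ)+1)) ≤ C * P := by
    calc _ ≤ C * 1 := by gcongr
      _ ≤ _ := by gcongr
  have h9 : ε * (1 + Real.log N)^(j+1) = ε * P + ε * P * Real.log N := by rw [pow_succ, hP]; ring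
  have h10 : 0 ≤ ε * P := by positivity
  rw [h9]
  rw [abs_le] at *
  constructor <;> linarith [h1.1, h1.2, h2.1, h2.2, h6.1, h6.2]

def PsiS (P : ℕ → ℝ) (s : ℝ) : Prop := ∀ ε : ℝ, 0 < ε → ∃ C : ℝ, 0 ≤ C ∧ ∀ N : ℕ,
  |∑ n ∈ Icc 1 N, P n - s * N| ≤ ε * N + C

lemma KB_of_AS (g : ℕ → ℝ) (c : ℝ) (j : ℕ) (h : AS g c j) : KB g j := by
  obtain ⟨C, hC, h⟩ := h 1 one_pos
  refine ⟨|c| + 1 + C, by positivity, fun N hN => ?_⟩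
  have hN1 : (1:ℝ) ≤ N := by exact_mod_cast hN
  have hL : 0 ≤ Real.log N := Real.log_natCast_nonneg N
  have h1 := (abs_le.1 (h N hN)).2
  have hP1 : 1 ≤ (1 + Real.log N)^j := one_le_pow₀ (by linarith)
  have a2 : c * N * Real.log N ^ j ≤ |c| * N * (1 + Real.log N)^j := by
    have := le_abs_self c
    calc _ ≤ |c| * N * Real.log N ^ j := by gcongr
      _ ≤ _ := by gcongr; linarith
  have : 1 ≤ N * (1 + Real.log N)^j := by nlinarith
  nlinarith

lemma conv_step (f P : ArithmeticFunction ℝ) (g : ℕ → ℝ) (c s : ℝ) (j : ℕ) (hfg : ∀ n, |f n| ≤ g n) (hg : KB g j)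
    (hf : AS f c j) (hP : PsiS P s) : AS (P * f : ArithmeticFunction ℝ) (c * (s/(j+1))) (j+1) := by
  intro ε hε
  obtain ⟨K1, hK1, h1⟩ := L2_inv g j hg
  obtain ⟨K, hK, hK'⟩ := hg
  set η := ε / (3 * (K1 + 1)) with hη
  have hη0 : 0 < η := by positivity
  obtain ⟨C1, hC1, p1⟩ := hP η hη0
  set ζ := ε / (3 * (|s| + 1)) with hζ
  have hζ0 : 0 < ζ := by positivity
  obtain ⟨C2, hC2, h2⟩ := L3_inv f c j hf ζ hζ0
  obtain ⟨C3, hC3, h3⟩ := absorb (|s| * C2 + (C1 + |s|) * K) (ε/3) (by positivity) (by positivity) j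
  refine ⟨C3, hC3, fun N hN => ?_⟩
  have hN1 : (1:ℝ) ≤ N := by exact_mod_cast hN
  have hL : 0 ≤ Real.log N := Real.log_natCast_nonneg N
  have e0 : ∀ M : ℕ, Icc 1 M = Ioc 0 M := fun M => by ext; simp [Nat.succ_le_iff]
  have e1 : ∑ n ∈ Icc 1 N, (P * f : ArithmeticFunction ℝ) n = ∑ n ∈ Icc 1 N, f n * ∑ m ∈ Icc 1 (N/n), P m := by
    simp_rw [e0]
    rw [mul_comm P f, ArithmeticFunction.sum_Ioc_mul_eq_sum_sum]
  have e2 : |∑ n ∈ Icc 1 N, f n * ∑ m ∈ Icc 1 (N/n), P m - s * N * ∑ n ∈ Icc 1 N, f n * (1/(n:ℝ))| ≤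
      η * N * (K1 * (1 + Real.log N)^(j+1)) + (C1 + |s|) * (K * N * (1 + Real.log N)^j) := by
    rw [Finset.mul_sum, ← Finset.sum_sub_distrib]
    calc _ ≤ ∑ n ∈ Icc 1 N, (η * N * (g n * (1/(n:ℝ))) + (C1 + |s|) * g n) := by
          refine (Finset.abs_sum_le_sum_abs _ _).trans (Finset.sum_le_sum fun n hn => ?_)
          have hn1 := (mem_Icc.1 hn).1
          have hn0 : (0:ℝ) < n := by exact_mod_cast hn1
          have a1 := p1 (N/n)
          have a2 : ((N/n : ℕ):ℝ) ≤ N/n := Nat.cast_div_le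
          have a3 : (N:ℝ)/n < (N/n : ℕ) + 1 := by
            rw [div_lt_iff₀ hn0]
            exact_mod_cast (by rw [mul_comm]; exact Nat.lt_mul_div_succ N hn1 : N < (N / n + 1) * n)
          have a4 : |∑ m ∈ Icc 1 (N/n), P m - s * (N/n : ℝ)| ≤ η * (N/n) + (C1 + |s|) := by
            have b1 : |s * ((N/n:ℕ):ℝ) - s * (N/n : ℝ)| ≤ |s| := by
              rw [← mul_sub, abs_mul]
              have : |((N/n:ℕ):ℝ) - (N/n : ℝ)| ≤ 1 := by rw [abs_le]; constructor <;> linarith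
              nlinarith [abs_nonneg s]
            have b2 := abs_sub_le (∑ m ∈ Icc 1 (N/n), P m) (s * ((N/n:ℕ):ℝ)) (s * (N/n : ℝ))
            have b3 : η * ((N/n:ℕ):ℝ) ≤ η * (N/n) := by gcongr
            linarith
          have e : f n * ∑ m ∈ Icc 1 (N/n), P m - s * N * (f n * (1/(n:ℝ))) = f n * (∑ m ∈ Icc 1 (N/n), P m - s * (N/n : ℝ)) := by
            ring
          rw [e, abs_mul]
          calc _ ≤ g n * (η * (N/n) + (C1 + |s|)) := by
                have := (abs_nonneg _).trans (hfg n)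
                gcongr; exact hfg n
            _ = _ := by ring
      _ ≤ _ := by
        rw [Finset.sum_add_distrib, ← Finset.mul_sum, ← Finset.mul_sum]
        have := h1 N hN
        have := hK' N hN
        gcongr
  rw [e1]
  have q1 : η * N * (K1 * (1 + Real.log N)^(j+1)) ≤ ε/3 * N * (1 + Real.log N)^(j+1) := by
    have : η * K1 ≤ ε/3 := by
      rw [hη, div_mul_eq_mul_div, div_le_div_iff₀ (by positivity) (by positivity)]; nlinarith
    calc _ = (η * K1) * N * (1 + Real.log N)^(j+1) := by ring
      _ ≤ _ := by gcongr
  have q2 : |s * N * ∑ n ∈ Icc 1 N, f n * (1/(n:ℝ)) - s * N * (c * (Real.log N ^ (j+1) / (j+1)))| ≤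
      ε/3 * N * (1 + Real.log N)^(j+1) + |s| * C2 * N * (1 + Real.log N)^j := by
    rw [← mul_sub, abs_mul, abs_mul, abs_of_pos (by linarith : (0:ℝ) < N)]
    have : |s| * ζ ≤ ε/3 := by
      rw [hζ, mul_div_assoc', div_le_div_iff₀ (by positivity) (by positivity)]; nlinarith [abs_nonneg s]
    calc _ ≤ |s| * N * (ζ * (1 + Real.log N)^(j+1) + C2 * (1 + Real.log N)^j) := by gcongr; exact h2 N hN
      _ = (|s| * ζ) * N * (1 + Real.log N)^(j+1) + |s| * C2 * N * (1 + Real.log N)^j := by ring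
      _ ≤ _ := by gcongr
  have q3 := h3 N hN1
  have e3 : c * (s/(j+1)) * N * Real.log N ^ (j+1) = s * N * (c * (Real.log N ^ (j+1) / (j+1))) := by ring
  rw [e3]
  have := abs_sub_le (∑ n ∈ Icc 1 N, f n * ∑ m ∈ Icc 1 (N/n), P m) (s * N * ∑ n ∈ Icc 1 N, f n * (1/(n:ℝ))) (s * N * (c * (Real.log N ^ (j+1) / (j+1))))
  linarith

lemma rec_step (f P : ArithmeticFunction ℝ) (g : ℕ → ℝ) (c s : ℝ) (j : ℕ) (hfg : ∀ n, |f n| ≤ g n) (hg : KB g j)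
    (hf : AS f c j) (hP : PsiS P s) :
    AS (f.pmul ArithmeticFunction.log + P * f : ArithmeticFunction ℝ) (c * (1 + s/(j+1))) (j+1) := by
  intro ε hε
  obtain ⟨C1, hC1, h1⟩ := conv_step f P g c s j hfg hg hf hP (ε/3) (by positivity)
  obtain ⟨K, hK, h2⟩ := L1_log f g j hfg hg
  obtain ⟨C2, hC2, h3⟩ := hf (ε/6) (by positivity)
  obtain ⟨C3, hC3, h4⟩ := absorb K (ε/6) hK (by positivity) j
  obtain ⟨C4, hC4, h5⟩ := absorb2 C2 (ε/3) hC2 (by positivity) 1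
  refine ⟨C1 + C3 + C4, by positivity, fun N hN => ?_⟩
  have hN1 : (1:ℝ) ≤ N := by exact_mod_cast hN
  have hL : 0 ≤ Real.log N := Real.log_natCast_nonneg N
  have k1 := h1 N hN
  have k2 := h2 N hN
  have k3 := h3 N hN
  have k4 := h4 N hN1
  have k5 := h5 N hN1
  have e : ∑ n ∈ Icc 1 N, (f.pmul ArithmeticFunction.log + P * f : ArithmeticFunction ℝ) n =
      ∑ n ∈ Icc 1 N, f n * Real.log n + ∑ n ∈ Icc 1 N, (P * f : ArithmeticFunction ℝ) n := by
    rw [← Finset.sum_add_distrib]; rfl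
  rw [e]
  set A := ∑ n ∈ Icc 1 N, f n
  set L := Real.log N with hLdef
  have k6 : |A * L - c * N * L^j * L| ≤ ε/6 * N * (1+L)^(j+1) + C2 * (1+L)^1 := by
    rw [← sub_mul, abs_mul, abs_of_nonneg hL]
    calc _ ≤ (ε/6 * N * (1+L)^j + C2) * L := by gcongr
      _ ≤ (ε/6 * N * (1+L)^j + C2) * (1+L) := by gcongr; linarith
      _ = _ := by ring
  have hP1 : 1 ≤ (1 + L)^(j+1) := one_le_pow₀ (by linarith)
  have k7 : ε/3 * N ≤ ε/3 * N * (1+L)^(j+1) := le_mul_of_one_le_right (by positivity) hP1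
  have e2 : c * (1 + s/(j+1)) * N * L^(j+1) = c * N * L^j * L + c * (s/(j+1)) * N * L^(j+1) := by ring
  rw [e2]
  rw [abs_le] at *
  constructor <;> linarith [k1.1, k1.2, k2.1, k2.2, k6.1, k6.2]

lemma PsiS_Lambda : PsiS (fun n => ArithmeticFunction.vonMangoldt n) 1 := by
  intro ε hε
  obtain ⟨C, hC, h⟩ := psi_bound 1
  obtain ⟨D, hD, h2⟩ := absorb C ε hC hε 0
  refine ⟨D, hD, fun N => ?_⟩
  rcases Nat.eq_zero_or_pos N with rfl | hN
  · simpa using hD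
  have hN1 : (1:ℝ) ≤ N := by exact_mod_cast hN
  have hL : 0 ≤ Real.log N := Real.log_natCast_nonneg N
  have k1 := h N hN1
  rw [Nat.floor_natCast, Finset.sum_sub_distrib] at k1
  simp only [Finset.sum_const, Nat.card_Icc, Nat.add_sub_cancel, nsmul_eq_mul, mul_one] at k1
  rw [one_mul]
  refine k1.trans ?_
  have k2 := h2 N hN1
  rw [pow_one, div_le_iff₀ (by linarith)]
  simp only [pow_zero, zero_add, pow_one, mul_one] at k2
  nlinarith

lemma PsiS_close (P : ℕ → ℝ) (s : ℝ) (hs : |s| ≤ 1) (h : ∀ N : ℕ, 1 ≤ N →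
    |∑ n ∈ Icc 1 N, P n - s * ∑ n ∈ Icc 1 N, ArithmeticFunction.vonMangoldt n| ≤ 4 * √N * Real.log N) : PsiS P s := by
  intro ε hε
  obtain ⟨C, hC, h1⟩ := PsiS_Lambda (ε/2) (by positivity)
  obtain ⟨D, hD, h2⟩ := absorb2 (16/ε) (ε/4) (by positivity) (by positivity) 2
  refine ⟨C + D, by positivity, fun N => ?_⟩
  rcases Nat.eq_zero_or_pos N with rfl | hN
  · simp; positivity
  have hN1 : (1:ℝ) ≤ N := by exact_mod_cast hN
  have hL : 0 ≤ Real.log N := Real.log_natCast_nonneg N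
  have k1 := h1 N
  have k2 := h2 N hN1
  have k3 := h N hN
  have k4 : |s * ∑ n ∈ Icc 1 N, ArithmeticFunction.vonMangoldt n - s * N| ≤ ε/2 * N + C := by
    rw [← mul_sub, abs_mul]
    rw [one_mul] at k1
    have := abs_nonneg (∑ n ∈ Icc 1 N, ArithmeticFunction.vonMangoldt n - (N:ℝ))
    nlinarith
  have k5 : 4 * √N * Real.log N ≤ ε/4 * N + (16/ε) * (1 + Real.log N)^2 := by
    have h3 : √(N:ℝ) * √N = N := Real.mul_self_sqrt (by linarith)
    have h4 : 4 * √N * Real.log N ≤ 4 * √N * (1 + Real.log N) := by gcongr; linarith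
    refine h4.trans ?_
    rw [← sub_nonneg]
    have : ε/4 * N + (16/ε) * (1 + Real.log N)^2 - 4 * √N * (1 + Real.log N) = (ε/4) * (√N - 8 * (1 + Real.log N)/ε)^2 := by
      field_simp; linear_combination (-ε^2)*h3
    rw [this]; positivity
  have := abs_sub_le (∑ n ∈ Icc 1 N, P n) (s * ∑ n ∈ Icc 1 N, ArithmeticFunction.vonMangoldt n) (s * N)
  linarith

lemma nonprime_sum (N : ℕ) (hN : 1 ≤ N) :
    ∑ n ∈ Icc 1 N, (if n.Prime then 0 else ArithmeticFunction.vonMangoldt n) ≤ 2 * √N * Real.log N := by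
  have h1 := Chebyshev.psi_sub_theta_le (x := N) (by exact_mod_cast hN)
  rw [Chebyshev.psi_sub_theta_eq_sum_not_prime, Nat.floor_natCast, Finset.sum_filter] at h1
  have e0 : Icc 1 N = Ioc 0 N := by ext; simp [Nat.succ_le_iff]
  rw [e0]
  refine le_trans (le_of_eq ?_) h1
  refine Finset.sum_congr rfl fun n _ => ?_
  by_cases h : n.Prime <;> simp [h]

noncomputable def thf (n : ℕ) : ℝ := if n.Prime then Real.log n else 0

lemma PsiS_theta : PsiS thf 1 := by
  refine PsiS_close _ 1 (by simp) fun N hN => ?_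
  rw [one_mul, abs_sub_comm, ← Finset.sum_sub_distrib]
  have h := nonprime_sum N hN
  have e : ∑ n ∈ Icc 1 N, (ArithmeticFunction.vonMangoldt n - thf n) =
      ∑ n ∈ Icc 1 N, (if n.Prime then 0 else ArithmeticFunction.vonMangoldt n) := by
    refine Finset.sum_congr rfl fun n _ => ?_
    unfold thf
    by_cases hp : n.Prime
    · simp [hp, ArithmeticFunction.vonMangoldt_apply_prime hp]
    · simp [hp]
  rw [e, abs_of_nonneg]
  · have : 0 ≤ √(N:ℝ) * Real.log N := mul_nonneg (Real.sqrt_nonneg _) (Real.log_natCast_nonneg N)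
    linarith
  · exact Finset.sum_nonneg fun n _ => by split_ifs; exacts [le_rfl, ArithmeticFunction.vonMangoldt_nonneg]

noncomputable def sgF (s : ℝ) (F : ArithmeticFunction ℝ) : ArithmeticFunction ℝ := ⟨fun n => sg s n * F n, by simp⟩

lemma sgF_apply (s : ℝ) (F : ArithmeticFunction ℝ) (n : ℕ) : sgF s F n = sg s n * F n := rfl

lemma sgF_mul (s : ℝ) (F G : ArithmeticFunction ℝ) : sgF s (F * G) = sgF s F * sgF s G := by
  ext n
  rw [sgF_apply, ArithmeticFunction.mul_apply, ArithmeticFunction.mul_apply, Finset.mul_sum]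
  refine Finset.sum_congr rfl fun x hx => ?_
  obtain ⟨h1, h2⟩ := Nat.mem_divisorsAntidiagonal.1 hx
  have a1 : x.1 ≠ 0 := by rintro h; simp [h] at h1; exact h2 h1.symm
  have a2 : x.2 ≠ 0 := by rintro h; simp [h] at h1; exact h2 h1.symm
  rw [sgF_apply, sgF_apply, ← h1, sg_mul s a1 a2]
  ring

lemma sgF_one (F : ArithmeticFunction ℝ) : sgF 1 F = F := by
  ext n; rw [sgF_apply, sg_one_left, one_mul]

lemma sgF_rec (s : ℝ) (k : ℕ) : sgF s (LA (k+1)) =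
    (sgF s (LA k)).pmul ArithmeticFunction.log + sgF s ArithmeticFunction.vonMangoldt * sgF s (LA k) := by
  rw [LA_rec, ← sgF_mul]
  ext n
  simp only [sgF_apply, ArithmeticFunction.add_apply, ArithmeticFunction.pmul_apply]
  ring

lemma PsiS_sg (s : ℝ) (hs : s = 1 ∨ s = -1) : PsiS (sgF s ArithmeticFunction.vonMangoldt) s := by
  rcases hs with rfl | rfl
  · rw [sgF_one]; exact PsiS_Lambda
  · refine PsiS_close _ (-1) (by simp) fun N hN => ?_
    have h := nonprime_sum N hN
    rw [neg_one_mul, sub_neg_eq_add, ← Finset.sum_add_distrib]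
    calc _ ≤ ∑ n ∈ Icc 1 N, |sgF (-1) ArithmeticFunction.vonMangoldt n + ArithmeticFunction.vonMangoldt n| :=
          Finset.abs_sum_le_sum_abs _ _
      _ ≤ ∑ n ∈ Icc 1 N, 2 * (if n.Prime then 0 else ArithmeticFunction.vonMangoldt n) := by
        refine Finset.sum_le_sum fun n _ => ?_
        rw [sgF_apply]
        by_cases hp : n.Prime
        · rw [sg_prime _ hp, if_pos hp]; simp
        · rw [if_neg hp]
          have h1 := sg_abs (Or.inr rfl : (-1:ℝ) = 1 ∨ (-1:ℝ) = -1) n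
          have h0 := ArithmeticFunction.vonMangoldt_nonneg (n := n)
          refine (abs_add_le _ _).trans ?_
          rw [abs_mul, h1, abs_of_nonneg h0]; linarith
      _ ≤ _ := by rw [← Finset.mul_sum]; linarith

lemma AS_of_PsiS (f : ℕ → ℝ) (c : ℝ) (h : PsiS f c) : AS f c 0 := by
  intro ε hε
  obtain ⟨C, hC, h1⟩ := h ε hε
  exact ⟨C, hC, fun N _ => by simpa using h1 N⟩

noncomputable def cc (s : ℝ) (j : ℕ) : ℝ := if s = 1 then (j:ℝ) + 1 else (if j = 0 then -1 else 0)

lemma AS_one (j : ℕ) : AS (LA (j+1)) ((j:ℝ)+1) j := by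
  induction j with
  | zero => rw [zero_add, LA_one]; simpa using AS_of_PsiS _ _ PsiS_Lambda
  | succ j ih =>
    have hP := PsiS_sg 1 (Or.inl rfl)
    rw [sgF_one] at hP
    have := rec_step (LA (j+1)) _ (LA (j+1)) _ 1 j (fun n => by rw [abs_of_nonneg (LA_nonneg _ _)]) (KB_of_AS _ _ _ ih) ih hP
    rw [← LA_rec] at this
    convert this using 1
    push_cast; field_simp

lemma AS_sg (s : ℝ) (hs : s = 1 ∨ s = -1) (j : ℕ) : AS (sgF s (LA (j+1))) (cc s j) j := by
  induction j with
  | zero =>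
    rw [zero_add, LA_one]
    have := AS_of_PsiS _ _ (PsiS_sg s hs)
    have e : cc s 0 = s := by
      unfold cc
      rcases hs with rfl | rfl <;> norm_num
    rw [e]; exact this
  | succ j ih =>
    have := rec_step (sgF s (LA (j+1))) _ (LA (j+1)) _ s j
      (fun n => by rw [sgF_apply, abs_mul, sg_abs hs, one_mul, abs_of_nonneg (LA_nonneg _ _)])
      (KB_of_AS _ _ _ (AS_one j)) ih (PsiS_sg s hs)
    rw [← sgF_rec] at this
    convert this using 1
    unfold cc
    rcases hs with rfl | rfl
    · simp; field_simp
    · norm_num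
      intro h; simp [h]

lemma sig_lower (γ β : ℝ) (hγ : 0 < γ) (hγβ : γ < β) : ∃ i0 : ℕ, 1 ≤ i0 ∧ ∀ i, i0 ≤ i →
    0 < sig γ β i ∧ ((β - γ)/2) * Real.log ((2:ℝ)^i) ≤ sig γ β i := by
  set ε := (β - γ)/(8*β) with hε
  have hβ : 0 < β := hγ.trans hγβ
  have hβγ : 0 < β - γ := by linarith
  have hε0 : 0 < ε := by positivity
  obtain ⟨C, hC, h⟩ := L3_inv thf 1 0 (AS_of_PsiS _ _ PsiS_theta) ε hε0
  obtain ⟨i0, hi0⟩ := exists_nat_ge ((2*ε + 2 * C + 2)/((β-γ)/4 * Real.log 2))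
  refine ⟨max 1 (i0+1), le_max_left _ _, fun i hi => ?_⟩
  have hl2 : 0 < Real.log 2 := Real.log_pos (by norm_num)
  have hi1 : 1 ≤ i := (le_max_left _ _).trans hi
  have hi2 : (i0:ℝ) ≤ i := by exact_mod_cast (show i0 ≤ i by have := (le_max_right 1 (i0+1)).trans hi; omega)
  set X : ℝ := (2:ℝ)^i with hX
  have hX1 : 1 ≤ X := one_le_pow₀ one_le_two
  have hX0 : 0 < X := by linarith
  set L := Real.log X with hL
  have hLi : L = i * Real.log 2 := by rw [hL, hX, Real.log_pow]
  have hL0 : 0 < L := by rw [hLi]; have : (1:ℝ) ≤ i := by exact_mod_cast hi1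
                         positivity
  have hLbig : 2*ε + 2 * C + 2 ≤ (β-γ)/4 * L := by
    have := hi0.trans hi2
    rw [div_le_iff₀ (by positivity)] at this
    rw [hLi]; linarith
  have key : ∀ θ : ℝ, 0 < θ → θ ≤ β → |∑ n ∈ Icc 1 ⌊X^θ⌋₊, thf n * (1/(n:ℝ)) - θ * L| ≤ ε * (1 + β * L) + C + 1 := by
    intro θ hθ hθβ
    have hy1 : 1 ≤ X^θ := Real.one_le_rpow hX1 hθ.le
    have hN1 : 1 ≤ ⌊X^θ⌋₊ := Nat.le_floor (by simpa using hy1)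
    have k := h _ hN1
    set N := ⌊X^θ⌋₊ with hN
    have hN0 : (0:ℝ) < N := by exact_mod_cast hN1
    have n1 : (N:ℝ) ≤ X^θ := Nat.floor_le (by positivity)
    have n2 : X^θ ≤ 2 * N := by
      have := Nat.lt_floor_add_one (X^θ)
      have : (1:ℝ) ≤ N := by exact_mod_cast hN1
      linarith
    have m1 : Real.log N ≤ θ * L := by rw [hL, ← Real.log_rpow hX0]; exact Real.log_le_log hN0 n1
    have m2 : θ * L ≤ Real.log N + 1 := by
      rw [hL, ← Real.log_rpow hX0]
      have := Real.log_le_log (by positivity) n2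
      rw [Real.log_mul (by norm_num) hN0.ne'] at this
      have : Real.log 2 ≤ 1 := by have := Real.log_two_lt_d9; linarith
      linarith
    simp only [zero_add, pow_one, Nat.cast_zero, div_one, pow_zero, mul_one, one_mul] at k
    have m3 : θ * L ≤ β * L := by gcongr
    have m4 : ε * (1 + Real.log N) ≤ ε * (1 + β * L) := by gcongr; linarith
    have := abs_sub_le (∑ n ∈ Icc 1 N, thf n * (1/(n:ℝ))) (Real.log N) (θ * L)
    have : |Real.log N - θ * L| ≤ 1 := by rw [abs_le]; constructor <;> linarith
    linarith
  have k1 := key γ hγ hγβ.le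
  have k2 := key β hβ le_rfl
  have hfl : ⌊X^γ⌋₊ ≤ ⌊X^β⌋₊ := Nat.floor_le_floor (Real.rpow_le_rpow_of_exponent_le hX1 hγβ.le)
  have e : sig γ β i = ∑ n ∈ Icc 1 ⌊X^β⌋₊, thf n * (1/(n:ℝ)) - ∑ n ∈ Icc 1 ⌊X^γ⌋₊, thf n * (1/(n:ℝ)) := by
    have e1 : ∀ N : ℕ, Icc 1 N = Ioc 0 N := fun N => by ext; simp [Nat.succ_le_iff]
    rw [e1, e1, eq_sub_iff_add_eq, add_comm, Finset.sum_Ioc_consecutive _ (Nat.zero_le _) hfl |>.symm]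
    congr 1
    unfold sig PP
    rw [Finset.sum_filter]
    refine Finset.sum_congr rfl fun n _ => ?_
    unfold thf
    by_cases hp : n.Prime
    · simp [hp, div_eq_mul_inv]
    · simp [hp]
  have hmain : (β - γ)/2 * L ≤ sig γ β i := by
    rw [e]
    have a1 := (abs_le.1 k1).2
    have a2 := (abs_le.1 k2).1
    have e3 : ε * (β * L) = (β - γ)/8 * L := by rw [hε]; field_simp
    nlinarith
  exact ⟨lt_of_lt_of_le (by positivity) hmain, hmain⟩

lemma pow_diff (a b : ℝ) (ha : 0 ≤ a) (hab : a ≤ b) (j : ℕ) : b^j - a^j ≤ j * (1+b)^(j-1) * (b-a) := by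
  have hb : 0 ≤ b := ha.trans hab
  rw [← geom_sum₂_mul]
  have hba : 0 ≤ b - a := by linarith
  apply mul_le_mul_of_nonneg_right _ hba
  calc _ ≤ ∑ i ∈ range j, (1+b)^(j-1) := Finset.sum_le_sum fun i hi => by
            have : i + (j - 1 - i) = j - 1 := by have := mem_range.1 hi; omega
            calc b^i * a^(j-1-i) ≤ (1+b)^i * (1+b)^(j-1-i) := by gcongr <;> linarith
              _ = _ := by rw [← pow_add, this]
    _ = _ := by simp

lemma AS_real (f : ℕ → ℝ) (c : ℝ) (j : ℕ) (hf : AS f c j) (ε : ℝ) (hε : 0 < ε) : ∃ C, 0 ≤ C ∧ ∀ z : ℝ, 1 ≤ z →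
    |∑ n ∈ Icc 1 ⌊z⌋₊, f n - c * z * Real.log z ^ j| ≤ ε * z * (1 + Real.log z)^j + C := by
  obtain ⟨C, hC, h⟩ := hf (ε/2) (by positivity)
  obtain ⟨D, hD, h2⟩ := absorb2 (|c| * (1 + j)) (ε/2) (by positivity) (by positivity) j
  refine ⟨C + D, by positivity, fun z hz => ?_⟩
  have hN1 : 1 ≤ ⌊z⌋₊ := Nat.le_floor (by simpa using hz)
  have k := h _ hN1
  set N := ⌊z⌋₊ with hN
  have hN0 : (0:ℝ) < N := by exact_mod_cast hN1
  have hN1' : (1:ℝ) ≤ N := by exact_mod_cast hN1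
  have n1 : (N:ℝ) ≤ z := Nat.floor_le (by linarith)
  have n2 : z < N + 1 := Nat.lt_floor_add_one z
  have m0 : 0 ≤ Real.log N := Real.log_nonneg hN1'
  have m1 : Real.log N ≤ Real.log z := Real.log_le_log hN0 n1
  have m2 : Real.log z - Real.log N ≤ 1/N := by
    rw [← Real.log_div (by linarith) hN0.ne']
    have := Real.log_le_sub_one_of_pos (x := z/N) (by positivity)
    have e : z/N - 1 = (z - N)/N := by field_simp
    rw [e] at this
    refine this.trans ?_
    gcongr; linarith
  set P := (1 + Real.log z)^j with hP
  have hP1 : 1 ≤ P := one_le_pow₀ (by linarith)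
  have p1 := pow_diff _ _ m0 m1 j
  have p2 : (j:ℝ) * (1 + Real.log z)^(j-1) * (Real.log z - Real.log N) ≤ j * P * (1/N) := by
    have : (1 + Real.log z)^(j-1) ≤ P := pow_le_pow_right₀ (by linarith) (Nat.sub_le _ _)
    have : 0 ≤ Real.log z - Real.log N := by linarith
    gcongr
  have p3 : Real.log N ^ j ≤ Real.log z ^ j := by gcongr
  have p4 : Real.log z ^ j ≤ P := by rw [hP]; exact pow_le_pow_left₀ (by linarith) (by linarith) j
  have p5 : 0 ≤ Real.log z ^ j := pow_nonneg (by linarith) j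
  have q : |N * Real.log N ^ j - z * Real.log z ^ j| ≤ (1 + j) * P := by
    rw [abs_sub_comm, abs_of_nonneg (by nlinarith [pow_nonneg m0 j])]
    have e : z * Real.log z ^ j - N * Real.log N ^ j = (z - N) * Real.log z ^ j + N * (Real.log z ^ j - Real.log N ^ j) := by ring
    rw [e]
    have a1 : (z - N) * Real.log z ^ j ≤ 1 * P := by gcongr; linarith
    have a2 : N * (Real.log z ^ j - Real.log N ^ j) ≤ N * (j * P * (1/N)) := by gcongr; linarith
    have a3 : N * (j * P * (1/(N:ℝ))) = j * P := by field_simp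
    linarith
  have q2 : |c * N * Real.log N ^ j - c * z * Real.log z ^ j| ≤ |c| * (1 + j) * P := by
    rw [mul_assoc, mul_assoc, ← mul_sub, abs_mul, mul_assoc]; gcongr
  have q3 := h2 z hz
  have q4 : ε/2 * z ≤ ε/2 * z * P := le_mul_of_one_le_right (by positivity) hP1
  have q5 : ε/2 * N * (1 + Real.log N)^j ≤ ε/2 * z * P := by rw [hP]; gcongr
  have := abs_sub_le (∑ n ∈ Icc 1 N, f n) (c * N * Real.log N ^ j) (c * z * Real.log z ^ j)
  linarith

lemma AS_block (f : ℕ → ℝ) (c : ℝ) (j : ℕ) (hf : AS f c j) (ε : ℝ) (hε : 0 < ε) : ∃ C, 0 ≤ C ∧ ∀ a p : ℕ, 1 ≤ p → p ≤ a →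
    |∑ n ∈ Ioc (a/p) (2*a/p), f n - c * (a/p:ℝ) * Real.log (a/p:ℝ) ^ j| ≤ ε * (a/p:ℝ) * (1 + Real.log (a/p:ℝ))^j + C := by
  set η := ε / (2 * (1 + 2 * 2^j)) with hη
  have hη0 : 0 < η := by positivity
  obtain ⟨C, hC, h⟩ := AS_real f c j hf η hη0
  have hab : ∃ D, 0 ≤ D ∧ ∀ y : ℝ, 1 ≤ y → |c| * (2 * y * (j * (2 * (1 + Real.log y))^(j-1))) ≤ ε/2 * y * (1 + Real.log y)^j + D := by
    rcases j with _ | j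
    · refine ⟨0, le_rfl, fun y hy => ?_⟩
      simp; positivity
    · obtain ⟨D, hD, h2⟩ := absorb (|c| * 2 * (j+1) * 2^j) (ε/2) (by positivity) (by positivity) j
      refine ⟨D, hD, fun y hy => le_trans (le_of_eq ?_) (h2 y hy)⟩
      rw [Nat.add_sub_cancel, mul_pow]; push_cast; ring
  obtain ⟨D, hD, h2⟩ := hab
  refine ⟨2 * C + D, by positivity, fun a p hp hpa => ?_⟩
  have hp0 : (0:ℝ) < p := by exact_mod_cast hp
  set y : ℝ := (a:ℝ)/p with hy
  have hy1 : 1 ≤ y := by rw [hy, le_div_iff₀ hp0, one_mul]; exact_mod_cast hpa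
  have f1 : a / p = ⌊y⌋₊ := by rw [hy, Nat.floor_div_eq_div]
  have f2 : 2 * a / p = ⌊2*y⌋₊ := by rw [hy, ← mul_div_assoc, ← Nat.floor_div_eq_div (K := ℝ)]; push_cast; rfl
  have hle : ⌊y⌋₊ ≤ ⌊2*y⌋₊ := Nat.floor_le_floor (by linarith)
  have k1 := h y hy1
  have k2 := h (2*y) (by linarith)
  have k3 := h2 y hy1
  have e : ∑ n ∈ Ioc (a/p) (2*a/p), f n = ∑ n ∈ Icc 1 ⌊2*y⌋₊, f n - ∑ n ∈ Icc 1 ⌊y⌋₊, f n := by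
    have e1 : ∀ N : ℕ, Icc 1 N = Ioc 0 N := fun N => by ext; simp [Nat.succ_le_iff]
    rw [f1, f2, e1, e1, eq_sub_iff_add_eq, add_comm, Finset.sum_Ioc_consecutive _ (Nat.zero_le _) hle]
  rw [e]
  have m0 : 0 ≤ Real.log y := Real.log_nonneg hy1
  have hl : Real.log (2*y) = Real.log 2 + Real.log y := Real.log_mul (by norm_num) (by linarith)
  have l2 : Real.log 2 ≤ 1 := by have := Real.log_two_lt_d9; linarith
  have l20 : 0 < Real.log 2 := Real.log_pos (by norm_num)
  have m1 : Real.log y ≤ Real.log (2*y) := by linarith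
  have p1 := pow_diff _ _ m0 m1 j
  have p2 : (j:ℝ) * (1 + Real.log (2*y))^(j-1) * (Real.log (2*y) - Real.log y) ≤ j * (2 * (1 + Real.log y))^(j-1) := by
    calc _ ≤ (j:ℝ) * (2 * (1 + Real.log y))^(j-1) * 1 := by gcongr <;> linarith
      _ = _ := by ring
  have p3 : Real.log y ^ j ≤ Real.log (2*y) ^ j := by gcongr
  have q1 : |c * (2*y) * Real.log (2*y)^j - c * (2*y) * Real.log y ^ j| ≤ ε/2 * y * (1 + Real.log y)^j + D := by
    refine le_trans ?_ k3
    rw [← mul_sub, abs_mul, abs_mul, abs_of_nonneg (show 0 ≤ 2*y by linarith),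
      abs_of_nonneg (show 0 ≤ Real.log (2*y)^j - Real.log y ^ j by linarith), mul_assoc]
    have : 0 ≤ y := by linarith
    gcongr
    linarith
  have q2 : η * (2*y) * (1 + Real.log (2*y))^j + η * y * (1 + Real.log y)^j ≤ ε/2 * y * (1 + Real.log y)^j := by
    have : (1 + Real.log (2*y))^j ≤ 2^j * (1 + Real.log y)^j := by rw [← mul_pow]; exact pow_le_pow_left₀ (by linarith) (by linarith) j
    calc _ ≤ η * (2*y) * (2^j * (1 + Real.log y)^j) + η * y * (1 + Real.log y)^j := by gcongr
      _ = (η * (1 + 2 * 2^j)) * y * (1 + Real.log y)^j := by ring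
      _ = _ := by rw [hη]; field_simp
  have e2 : c * (2*y) * Real.log y ^ j = c * y * Real.log y ^ j + c * y * Real.log y ^ j := by ring
  rw [abs_le] at *
  constructor <;> linarith [k1.1, k1.2, k2.1, k2.2, q1.1, q1.2]

lemma Q_id (s : ℝ) (hs : s = 1 ∨ s = -1) (K : ℕ) (u v : ℝ) :
    s * (cc s K * (u+v)^K - s * ∑ j ∈ range K, ((K+1).choose (j+1) : ℝ) * u^(K-j) * (cc s j * v^j)) =
      ((K:ℝ)+1) * (if s = 1 then v else u)^K := by
  rcases hs with rfl | rfl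
  · simp only [cc, if_true, one_mul]
    have : ∀ j ∈ range K, ((K+1).choose (j+1) : ℝ) * u^(K-j) * (((j:ℝ)+1) * v^j) = ((K:ℝ)+1) * (v^j * u^(K-j) * (K.choose j : ℝ)) := by
      intro j _
      have h := Nat.add_one_mul_choose_eq K j
      have h' : ((K:ℝ)+1) * (K.choose j : ℝ) = ((K+1).choose (j+1) : ℝ) * ((j:ℝ)+1) := by exact_mod_cast h
      linear_combination (-(v^j * u^(K-j))) * h'
    rw [Finset.sum_congr rfl this, ← Finset.mul_sum, add_comm u v, add_pow, Finset.sum_range_succ]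
    simp
    ring
  · have h1 : ¬ ((-1:ℝ) = 1) := by norm_num
    simp only [cc, if_neg h1]
    rcases K with _ | K
    · simp
    · rw [Finset.sum_range_succ']
      simp

lemma Dp_term (s : ℝ) (hs : s = 1 ∨ s = -1) (K p m : ℕ) (hp : p.Prime) (hm : 2 ≤ m) :
    |sg s (p*m) * LA (K+1) (p*m) - s * ∑ j ∈ range K, ((K+1).choose (j+1) : ℝ) * Real.log p ^ (K-j) * sgF s (LA (j+1)) m|
      ≤ if p ∣ m then Real.log ((p*m : ℕ):ℝ) ^ (K+1) else 0 := by
  have hm0 : m ≠ 0 := by omega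
  have hp0 : p ≠ 0 := hp.ne_zero
  have hpR : (1:ℝ) ≤ p := by exact_mod_cast hp.one_lt.le
  have hmR : (1:ℝ) ≤ m := by exact_mod_cast (by omega : 1 ≤ m)
  have lp : 0 ≤ Real.log p := Real.log_nonneg hpR
  have lm : 0 ≤ Real.log m := Real.log_nonneg hmR
  set R := ∑ j ∈ range (K+1), ((K+1).choose j : ℝ) * Real.log p ^ (K+1-j) * LA j m with hR
  have e1 : R = ∑ j ∈ range K, ((K+1).choose (j+1) : ℝ) * Real.log p ^ (K-j) * LA (j+1) m := by
    rw [hR, Finset.sum_range_succ', LA_zero, ArithmeticFunction.one_apply_ne (by omega)]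
    simp only [Nat.add_sub_add_right, mul_zero, add_zero]
  have e2 : s * ∑ j ∈ range K, ((K+1).choose (j+1) : ℝ) * Real.log p ^ (K-j) * sgF s (LA (j+1)) m = s * sg s m * R := by
    rw [e1, mul_assoc, Finset.mul_sum (a := sg s m)]
    congr 1
    refine Finset.sum_congr rfl fun j _ => ?_
    rw [sgF_apply]; ring
  have e3 : sg s (p*m) = s * sg s m := by rw [sg_mul s hp0 hm0, sg_prime s hp]
  rw [e2, e3, ← mul_sub, abs_mul, abs_mul, sg_abs hs]
  have : |s| = 1 := by rcases hs with rfl | rfl <;> simp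
  rw [this, one_mul, one_mul]
  split_ifs with h
  · have a1 := LA_nonneg (K+1) (p*m)
    have a2 := LA_le (K+1) (p*m) (mul_ne_zero hp0 hm0)
    have a3 : 0 ≤ R := Finset.sum_nonneg fun j _ => by
      have := LA_nonneg j m; positivity
    have a4 : R ≤ Real.log ((p*m : ℕ):ℝ) ^ (K+1) := by
      rw [Nat.cast_mul, Real.log_mul (by positivity) (by positivity), add_comm, add_pow, Finset.sum_range_succ]
      refine le_trans (Finset.sum_le_sum fun j _ => ?_) (le_add_of_nonneg_right (by positivity))
      have := LA_le j m hm0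
      calc ((K+1).choose j : ℝ) * Real.log p ^ (K+1-j) * LA j m ≤ ((K+1).choose j : ℝ) * Real.log p ^ (K+1-j) * Real.log m ^ j := by gcongr
        _ = _ := by ring
    rw [abs_le]; constructor <;> linarith
  · rw [LA_prime_mul (K+1) p m hp hm0 h, ← hR, sub_self, abs_zero]

lemma Dp (s : ℝ) (hs : s = 1 ∨ s = -1) (K p a : ℕ) (hp : p.Prime) (hpa : p ≤ a) :
    |∑ n ∈ (Ioc a (2*a)).filter (fun n => p ∣ n), sg s n * LA (K+1) n
      - s * ∑ j ∈ range K, ((K+1).choose (j+1) : ℝ) * Real.log p ^ (K-j) * ∑ m ∈ Ioc (a/p) (2*a/p), sgF s (LA (j+1)) m|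
      ≤ 2 * a / (p:ℝ)^2 * Real.log (2*a) ^ (K+1) := by
  have hle : a/p ≤ 2*a/p := Nat.div_le_div_right (by omega)
  have e1 : ∑ n ∈ (Ioc a (2*a)).filter (fun n => p ∣ n), sg s n * LA (K+1) n = ∑ m ∈ Ioc (a/p) (2*a/p), sg s (p*m) * LA (K+1) (p*m) := by
    have h1 := split_mult (fun n => sg s n * LA (K+1) n) p a (2*a) (by omega)
    rw [sum_mult _ _ _ hp.pos, sum_mult _ _ _ hp.pos] at h1
    have e : ∀ N : ℕ, Icc 1 N = Ioc 0 N := fun N => by ext; simp [Nat.succ_le_iff]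
    rw [e, e, ← Finset.sum_Ioc_consecutive _ (Nat.zero_le _) hle] at h1
    linarith
  have e2 : s * ∑ j ∈ range K, ((K+1).choose (j+1) : ℝ) * Real.log p ^ (K-j) * ∑ m ∈ Ioc (a/p) (2*a/p), sgF s (LA (j+1)) m
      = ∑ m ∈ Ioc (a/p) (2*a/p), s * ∑ j ∈ range K, ((K+1).choose (j+1) : ℝ) * Real.log p ^ (K-j) * sgF s (LA (j+1)) m := by
    rw [← Finset.mul_sum, Finset.sum_comm]
    simp_rw [Finset.mul_sum]
  rw [e1, e2, ← Finset.sum_sub_distrib]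
  refine (Finset.abs_sum_le_sum_abs _ _).trans ?_
  have hap : 1 ≤ a/p := (Nat.one_le_div_iff hp.pos).2 hpa
  have ha : 1 ≤ a := hp.pos.trans_le hpa
  have haR : (1:ℝ) ≤ a := by exact_mod_cast ha
  have hl : 0 ≤ Real.log (2*a) := Real.log_nonneg (by linarith)
  have hp0 : (0:ℝ) < p := by exact_mod_cast hp.pos
  calc _ ≤ ∑ m ∈ Ioc (a/p) (2*a/p), if p ∣ m then Real.log (2*a) ^ (K+1) else 0 := by
        refine Finset.sum_le_sum fun m hm => ?_
        rw [mem_Ioc] at hm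
        refine (Dp_term s hs K p m hp (by omega)).trans ?_
        split_ifs
        · have h1 : p * m ≤ 2 * a := by rw [mul_comm]; exact (Nat.le_div_iff_mul_le hp.pos).1 hm.2
          have h2 : ((p*m : ℕ):ℝ) ≤ 2 * a := by exact_mod_cast h1
          have h3 : 1 ≤ p * m := Nat.mul_pos hp.pos (by omega)
          have h4 : (1:ℝ) ≤ ((p*m : ℕ):ℝ) := by exact_mod_cast h3
          have := Real.log_nonneg h4
          gcongr
        · exact le_rfl
    _ ≤ ∑ m ∈ (Icc 1 (2*a/p)).filter (fun m => p ∣ m), Real.log (2*a) ^ (K+1) := by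
        rw [← Finset.sum_filter]
        apply Finset.sum_le_sum_of_subset_of_nonneg
        · intro m; simp only [mem_filter, mem_Ioc, mem_Icc]; omega
        · intros; positivity
    _ = ((((Icc 1 (2*a/p)).filter (fun m => p ∣ m)).card : ℕ) : ℝ) * Real.log (2*a) ^ (K+1) := by simp
    _ ≤ (((2*a/p : ℕ):ℝ) / p) * Real.log (2*a) ^ (K+1) := by
        have := card_mult (2*a/p) p hp.pos
        gcongr
    _ ≤ _ := by
        have : ((2*a/p : ℕ):ℝ) ≤ 2 * a / p := by have := Nat.cast_div_le (α := ℝ) (m := 2*a) (n := p); push_cast at this; exact this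
        have e : 2 * a / (p:ℝ)^2 = 2 * a / p / p := by field_simp
        rw [e]
        gcongr

lemma AS_block_unif (s : ℝ) (hs : s = 1 ∨ s = -1) (K : ℕ) (ε : ℝ) (hε : 0 < ε) : ∃ C, 0 ≤ C ∧ ∀ j, j ≤ K → ∀ a p : ℕ, 1 ≤ p → p ≤ a →
    |∑ n ∈ Ioc (a/p) (2*a/p), sgF s (LA (j+1)) n - cc s j * (a/p:ℝ) * Real.log (a/p:ℝ) ^ j| ≤ ε * (a/p:ℝ) * (1 + Real.log (a/p:ℝ))^j + C := by
  choose C hC h using fun j => AS_block _ _ j (AS_sg s hs j) ε hε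
  refine ⟨∑ j ∈ range (K+1), C j, Finset.sum_nonneg fun j _ => hC j, fun j hj a p h1 h2 => (h j a p h1 h2).trans ?_⟩
  gcongr
  exact Finset.single_le_sum (f := C) (fun j _ => hC j) (by simp; omega)

lemma Dp_err (s : ℝ) (hs : s = 1 ∨ s = -1) (K : ℕ) (ε C : ℝ) (hε : 0 < ε) (hC : 0 ≤ C)
    (h : ∀ j, j ≤ K → ∀ a p : ℕ, 1 ≤ p → p ≤ a →
      |∑ n ∈ Ioc (a/p) (2*a/p), sgF s (LA (j+1)) n - cc s j * (a/p:ℝ) * Real.log (a/p:ℝ) ^ j| ≤ ε * (a/p:ℝ) * (1 + Real.log (a/p:ℝ))^j + C)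
    (a p : ℕ) (hp : p.Prime) (hpa : p ≤ a) :
    |p * ∑ n ∈ (Ioc a (2*a)).filter (fun n => p ∣ n), sg s n * LA (K+1) n
      - a * (s * ∑ j ∈ range K, ((K+1).choose (j+1) : ℝ) * Real.log p ^ (K-j) * (cc s j * Real.log (a/p:ℝ)^j))|
      ≤ 2 * (a / p) * (2 * (1 + Real.log a)) ^ (K+1) + 2^(K+1) * (1 + Real.log a)^K * (ε * a + C * p) := by
  have hp0 : (0:ℝ) < p := by exact_mod_cast hp.pos
  have hp1 : (1:ℝ) ≤ p := by exact_mod_cast hp.pos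
  have hpa' : (p:ℝ) ≤ a := by exact_mod_cast hpa
  have ha1 : (1:ℝ) ≤ a := hp1.trans hpa'
  have hd := Dp s hs K p a hp hpa
  set D := ∑ n ∈ (Ioc a (2*a)).filter (fun n => p ∣ n), sg s n * LA (K+1) n
  set u := Real.log p
  set L := Real.log a
  set y : ℝ := (a:ℝ)/p with hy
  have hy1 : 1 ≤ y := by rw [hy, le_div_iff₀ hp0, one_mul]; exact hpa'
  have hpy : p * y = a := by rw [hy]; field_simp
  set v := Real.log y with hv
  have hu : 0 ≤ u := Real.log_nonneg hp1
  have hv0 : 0 ≤ v := Real.log_nonneg hy1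
  have huv : v = L - u := by rw [hv, hy, Real.log_div (by linarith) hp0.ne']
  have hL : 0 ≤ L := Real.log_nonneg ha1
  have hl2 : Real.log (2*a) ≤ 2 * (1 + L) := by
    rw [Real.log_mul (by norm_num) (by linarith)]
    have := Real.log_two_lt_d9
    change _ + L ≤ _
    linarith
  have hl20 : 0 ≤ Real.log (2*a) := Real.log_nonneg (by linarith)
  set S1 := ∑ j ∈ range K, ((K+1).choose (j+1) : ℝ) * u ^ (K-j) * ∑ m ∈ Ioc (a/p) (2*a/p), sgF s (LA (j+1)) m with hS1
  set S2 := ∑ j ∈ range K, ((K+1).choose (j+1) : ℝ) * u ^ (K-j) * (cc s j * v^j) with hS2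
  have k1 : |S1 - y * S2| ≤ 2^(K+1) * ((1+L)^K * (ε * y + C)) := by
    rw [hS1, hS2, Finset.mul_sum, ← Finset.sum_sub_distrib]
    refine (Finset.abs_sum_le_sum_abs _ _).trans ?_
    calc _ ≤ ∑ j ∈ range K, ((K+1).choose (j+1) : ℝ) * ((1+L)^K * (ε * y + C)) := by
          refine Finset.sum_le_sum fun j hj => ?_
          have hjK : j < K := mem_range.1 hj
          have h1 := h j hjK.le a p hp.pos hpa
          rw [← hy, ← hv] at h1
          have e : ((K+1).choose (j+1) : ℝ) * u ^ (K-j) * ∑ m ∈ Ioc (a/p) (2*a/p), sgF s (LA (j+1)) m - y * (((K+1).choose (j+1) : ℝ) * u ^ (K-j) * (cc s j * v^j))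
            = ((K+1).choose (j+1) : ℝ) * (u ^ (K-j) * (∑ m ∈ Ioc (a/p) (2*a/p), sgF s (LA (j+1)) m - cc s j * y * v^j)) := by ring
          rw [e, abs_mul, abs_mul, Nat.abs_cast, abs_of_nonneg (pow_nonneg hu _)]
          have q1 : u ^ (K-j) ≤ (1+L)^(K-j) := pow_le_pow_left₀ hu (by linarith) _
          have q2 : (1+v)^j ≤ (1+L)^j := pow_le_pow_left₀ (by linarith) (by linarith) _
          have q3 : 1 ≤ (1+L)^j := one_le_pow₀ (by linarith)
          have q4 : (1+L)^(K-j) * (1+L)^j = (1+L)^K := by rw [← pow_add]; congr 1; omega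
          have q5 : ε * y * (1+v)^j + C ≤ (1+L)^j * (ε * y + C) := by
            have : ε * y * (1+v)^j ≤ ε * y * (1+L)^j := by gcongr
            nlinarith
          refine mul_le_mul_of_nonneg_left ?_ (Nat.cast_nonneg _)
          calc _ ≤ (1+L)^(K-j) * ((1+L)^j * (ε * y + C)) := by
                apply mul_le_mul q1 (h1.trans q5) (abs_nonneg _) (by positivity)
            _ = _ := by rw [← mul_assoc, q4]
      _ = (∑ j ∈ range K, ((K+1).choose (j+1) : ℝ)) * ((1+L)^K * (ε * y + C)) := by rw [Finset.sum_mul]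
      _ ≤ _ := by
          have : ∑ j ∈ range K, ((K+1).choose (j+1) : ℝ) ≤ 2^(K+1) := by
            have h3 : ∑ j ∈ range (K+2), ((K+1).choose j : ℝ) = 2^(K+1) := by exact_mod_cast Nat.sum_range_choose (K+1)
            rw [← h3, Finset.sum_range_succ, Finset.sum_range_succ']
            simp
            linarith
          gcongr
  have hsabs : |s| = 1 := by rcases hs with rfl | rfl <;> simp
  have k2 : |s * S1 - s * (y * S2)| ≤ 2^(K+1) * ((1+L)^K * (ε * y + C)) := by
    rw [← mul_sub, abs_mul, hsabs, one_mul]; exact k1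
  have k3 : |D - s * (y * S2)| ≤ 2 * a / (p:ℝ)^2 * (2 * (1+L)) ^ (K+1) + 2^(K+1) * ((1+L)^K * (ε * y + C)) := by
    refine (abs_sub_le _ (s * S1) _).trans (add_le_add (hd.trans ?_) k2)
    gcongr
  have e4 : p * D - a * (s * S2) = p * (D - s * (y * S2)) := by rw [← hpy]; ring
  rw [e4, abs_mul, Nat.abs_cast]
  calc _ ≤ (p:ℝ) * (2 * a / (p:ℝ)^2 * (2 * (1+L)) ^ (K+1) + 2^(K+1) * ((1+L)^K * (ε * y + C))) := by gcongr
    _ = _ := by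
      have e5 : (p:ℝ) * (2 * a / (p:ℝ)^2) = 2 * y := by rw [hy]; field_simp
      linear_combination (2 * (1+L)) ^ (K+1) * e5 + 2^(K+1) * (1+L)^K * ε * hpy

set_option maxHeartbeats 400000 in
lemma T_ineq (s : ℝ) (hs : s = 1 ∨ s = -1) (K : ℕ) (γ β ρ : ℝ) (hγ : 0 < γ) (hβ : β < 1) (hρ0 : 0 ≤ ρ) (hρ1 : ρ ≤ γ) (hρ2 : ρ ≤ 1 - β)
    (ε : ℝ) (hε : 0 < ε) : ∃ C, 0 ≤ C ∧ ∀ i : ℕ, 0 < sig γ β i → ∀ X : ℝ, X = 2^i →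
    X * (((K:ℝ)+1) * (ρ * Real.log X)^K) - (ε * X * (1 + Real.log X)^K + C)
      - (2 * X^(1-γ) * (2 * (1 + Real.log X)) ^ (K+1) + 2^(K+1) * (1 + Real.log X)^K * (ε * X + C * X^β))
    ≤ s * ∑ n ∈ Ioc (2^i) (2^(i+1)), sg s n * LA (K+1) n * Wi γ β i n := by
  obtain ⟨C, hC, h⟩ := AS_block_unif s hs K ε hε
  refine ⟨C, hC, fun i hsig X hX => ?_⟩
  set a : ℕ := 2^i with ha
  have haX : (a:ℝ) = X := by rw [hX, ha]; push_cast; rfl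
  have h2a : 2^(i+1) = 2 * a := by rw [ha, pow_succ]; ring
  have hX1 : 1 ≤ X := by rw [hX]; exact one_le_pow₀ (by norm_num)
  have hX0 : 0 < X := by linarith
  have hL : 0 ≤ Real.log X := Real.log_nonneg hX1
  rw [h2a]
  set L := Real.log X with hLdef
  have h0 := h K le_rfl a 1 le_rfl (by rw [ha]; exact Nat.one_le_two_pow)
  simp only [Nat.div_one, Nat.cast_one, div_one] at h0
  rw [haX, ← hLdef] at h0
  have w := Wi_sum γ β i a (2*a) 1 (fun n => sg s n * LA (K+1) n)
  simp only [one_dvd, Finset.filter_true, Nat.lcm_one_right] at w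
  rw [w]
  set D : ℕ → ℝ := fun p => ∑ n ∈ (Ioc a (2*a)).filter (fun n => p ∣ n), sg s n * LA (K+1) n with hD
  set E1 := 2 * X^(1-γ) * (2 * (1 + L)) ^ (K+1) + 2^(K+1) * (1 + L)^K * (ε * X + C * X^β) with hE1
  set M := ((K:ℝ)+1) * (ρ * L)^K with hM
  have hsabs : |s| = 1 := by rcases hs with rfl | rfl <;> simp
  have key : ∀ p ∈ PP γ β i, s * (p * D p) ≤ X * (s * (cc s K * L^K) - M) + E1 := by
    intro p hp
    obtain ⟨pp, pl, pu⟩ := PP_mem hp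
    rw [← hX] at pl pu
    have hp0 : (0:ℝ) < p := by exact_mod_cast pp.pos
    have hpX : (p:ℝ) ≤ X := pu.trans (by
      calc X^β ≤ X^(1:ℝ) := Real.rpow_le_rpow_of_exponent_le hX1 hβ.le
        _ = X := Real.rpow_one X)
    have hpa : p ≤ a := by rw [← haX] at hpX; exact_mod_cast hpX
    have d := Dp_err s hs K ε C hε hC h a p pp hpa
    rw [haX] at d
    set u := Real.log p with hu
    have hv : Real.log (X/p) = L - u := Real.log_div hX0.ne' hp0.ne'
    rw [hv, ← hLdef] at d
    set S2 := ∑ j ∈ range K, ((K+1).choose (j+1) : ℝ) * u ^ (K-j) * (cc s j * (L-u)^j) with hS2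
    have q := Q_id s hs K u (L-u)
    rw [← hS2, add_sub_cancel] at q
    have hul : γ * L ≤ u := by
      rw [hu, hLdef, ← Real.log_rpow hX0]
      exact Real.log_le_log (by positivity) pl.le
    have huu : u ≤ β * L := by
      rw [hu, hLdef, ← Real.log_rpow hX0]
      exact Real.log_le_log hp0 pu
    have hM' : M ≤ ((K:ℝ)+1) * (if s = 1 then L - u else u)^K := by
      have r1 := mul_le_mul_of_nonneg_right hρ1 hL
      have r2 := mul_le_mul_of_nonneg_right hρ2 hL
      rw [hM]
      gcongr
      split_ifs <;> linarith
    have dE : 2 * (X / p) * (2 * (1 + L)) ^ (K+1) + 2^(K+1) * (1 + L)^K * (ε * X + C * p) ≤ E1 := by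
      rw [hE1]
      have : X / p ≤ X^(1-γ) := by
        rw [Real.rpow_sub hX0, Real.rpow_one]
        gcongr
      gcongr
    have d2 : s * (p * D p - X * (s * S2)) ≤ E1 := by
      refine (le_abs_self _).trans ?_
      rw [abs_mul, hsabs, one_mul]
      exact d.trans dE
    have : X * M ≤ X * (s * (cc s K * L^K - s * S2)) := by
      rw [q]; gcongr
    linear_combination d2 + this
  have hT : s * ((∑ p ∈ PP γ β i, Real.log p * D p) / sig γ β i) ≤ X * (s * (cc s K * L^K) - M) + E1 := by
    rw [← mul_div_assoc, div_le_iff₀ hsig, Finset.mul_sum, sig, Finset.mul_sum]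
    refine Finset.sum_le_sum fun p hp => ?_
    obtain ⟨pp, -, -⟩ := PP_mem hp
    have hp0 : (0:ℝ) < p := by exact_mod_cast pp.pos
    have hl : 0 ≤ Real.log p / p := div_nonneg (Real.log_nonneg (by exact_mod_cast pp.pos)) hp0.le
    calc s * (Real.log p * D p) = (s * (p * D p)) * (Real.log p / p) := by field_simp
      _ ≤ _ := mul_le_mul_of_nonneg_right (key p hp) hl
  have h0' : -(ε * X * (1 + L)^K + C) ≤ s * (∑ n ∈ Ioc a (2*a), sg s n * LA (K+1) n - cc s K * X * L^K) := by
    refine neg_le_of_abs_le ?_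
    rw [abs_mul, hsabs, one_mul]; exact h0
  rw [mul_sub]
  linear_combination h0' + hT

lemma T_low (s : ℝ) (hs : s = 1 ∨ s = -1) (K : ℕ) (γ β : ℝ) (hγ : 0 < γ) (hγ1 : γ < 1) (hβ : β < 1) :
    ∃ κ : ℝ, 0 < κ ∧ ∀ᶠ i : ℕ in atTop, 0 < sig γ β i →
      κ * (2:ℝ)^i * Real.log ((2:ℝ)^i)^K ≤ s * ∑ n ∈ Ioc (2^i) (2^(i+1)), sg s n * LA (K+1) n * Wi γ β i n := by
  set ρ := min γ (1-β) with hρ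
  have hρ0 : 0 < ρ := lt_min hγ (by linarith)
  have hρ1 : ρ ≤ γ := min_le_left _ _
  have hρ2 : ρ ≤ 1 - β := min_le_right _ _
  set M := ((K:ℝ)+1) * ρ^K with hM
  have hM0 : 0 < M := by positivity
  set ε := M / 2 / ((1 + 2^(K+1)) * 2^K) with hε
  have hε0 : 0 < ε := by positivity
  obtain ⟨C, hC, h⟩ := T_ineq s hs K γ β ρ hγ hβ hρ0.le hρ1 hρ2 ε hε0
  obtain ⟨C3, hC3, h3⟩ := Lg_pow_le_rpow (K+1) (ρ/2) (by positivity)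
  set C' := C + 2 * 2^(K+1) + 2^(K+1) * C with hC'
  have hC'0 : 0 < C' := by positivity
  refine ⟨M/4, by positivity, ?_⟩
  have t1 : Tendsto (fun i : ℕ => (2:ℝ)^i) atTop atTop := tendsto_pow_atTop_atTop_of_one_lt (by norm_num)
  have t2 := (tendsto_rpow_neg_atTop (show 0 < ρ/2 by positivity)).comp t1
  have t3 : ∀ᶠ i : ℕ in atTop, ((2:ℝ)^i)^(-(ρ/2)) < M/4/(C'*C3) := t2.eventually (gt_mem_nhds (by positivity))
  filter_upwards [t3, eventually_ge_atTop 2] with i hi hi2 hsig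
  have h4 := h i hsig _ rfl
  refine le_trans ?_ h4
  have hX1 : (1:ℝ) ≤ 2^i := one_le_pow₀ (by norm_num)
  have hX4 : (4:ℝ) ≤ 2^i := by
    calc (4:ℝ) = 2^2 := by norm_num
      _ ≤ _ := pow_le_pow_right₀ (by norm_num) hi2
  have h5 := h3 _ hX1
  set X : ℝ := 2^i
  have hX0 : 0 < X := by linarith
  have hL1 : 1 ≤ Real.log X := by
    rw [Real.le_log_iff_exp_le hX0]
    have := Real.exp_one_lt_d9; linarith
  set L := Real.log X
  have hLg : (1 + L)^K ≤ 2^K * L^K := by rw [← mul_pow]; exact pow_le_pow_left₀ (by linarith) (by linarith) K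
  have hLgm : (1+L)^K ≤ (1+L)^(K+1) := pow_le_pow_right₀ (by linarith) (by omega)
  have hLg1 : 1 ≤ (1+L)^(K+1) := one_le_pow₀ (by linarith)
  have a1 : ε * X * (1+L)^K + 2^(K+1) * (1+L)^K * (ε * X) ≤ M/2 * X * L^K := by
    calc _ = ε * (1 + 2^(K+1)) * X * (1+L)^K := by ring
      _ ≤ ε * (1 + 2^(K+1)) * X * (2^K * L^K) := by gcongr
      _ = (ε * ((1 + 2^(K+1)) * 2^K)) * X * L^K := by ring
      _ = _ := by rw [hε]; field_simp
  have hβX : X^β ≤ X^(1-ρ) := Real.rpow_le_rpow_of_exponent_le hX1 (by linarith)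
  have hγX : X^(1-γ) ≤ X^(1-ρ) := Real.rpow_le_rpow_of_exponent_le hX1 (by linarith)
  have h1X : 1 ≤ X^(1-ρ) := Real.one_le_rpow hX1 (by linarith)
  have a2 : C + 2 * X^(1-γ) * (2 * (1 + L)) ^ (K+1) + 2^(K+1) * (1+L)^K * (C * X^β) ≤ M/4 * X * L^K := by
    calc _ ≤ C * (X^(1-ρ) * (1+L)^(K+1)) + 2 * X^(1-ρ) * (2^(K+1) * (1 + L) ^ (K+1)) + 2^(K+1) * (1+L)^(K+1) * (C * X^(1-ρ)) := by
          rw [mul_pow]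
          have : 1 ≤ X^(1-ρ) * (1+L)^(K+1) := one_le_mul_of_one_le_of_one_le h1X hLg1
          have : C ≤ C * (X^(1-ρ) * (1+L)^(K+1)) := le_mul_of_one_le_right hC this
          gcongr
      _ = C' * X^(1-ρ) * (1+L)^(K+1) := by rw [hC']; ring
      _ ≤ C' * X^(1-ρ) * (C3 * X^(ρ/2)) := by gcongr
      _ = (C' * C3) * (X * X^(-(ρ/2))) := by
          have : X^(1-ρ) * X^(ρ/2) = X * X^(-(ρ/2)) := by
            rw [← Real.rpow_add hX0]
            nth_rewrite 2 [← Real.rpow_one X]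
            rw [← Real.rpow_add hX0]; congr 1; ring
          linear_combination C' * C3 * this
      _ ≤ (C' * C3) * (X * (M/4/(C'*C3))) := by gcongr
      _ = M/4 * X * 1 := by field_simp
      _ ≤ _ := by gcongr; exact one_le_pow₀ hL1
  have a3 : X * (((K:ℝ)+1) * (ρ * L)^K) = M * X * L^K := by rw [hM, mul_pow]; ring
  rw [a3]
  linear_combination a1 + a2

lemma core (ν0 δ0 s : ℝ) (hs : s = 1 ∨ s = -1) (h1 : 0 < ν0) (h2 : ν0 < 1/2) (h3 : 0 < δ0) (h4 : ν0 + δ0 < 1) :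
    ∃ (w : ℕ → ℝ) (G θ1 θ2 : ℝ), (∀ n, |w n| ≤ G) ∧ ν0 < θ1 ∧ θ1 ≤ 1 ∧ δ0 < θ2 ∧ θ2 ≤ 1 ∧ PW w θ1 ∧
      PW (fun n => sg (-1) n * w n) θ2 ∧ ∀ K : ℕ, ∃ c : ℝ, 0 < c ∧ ∀ᶠ i : ℕ in atTop,
        c * (2:ℝ)^i * Real.log ((2:ℝ)^i)^K ≤ |∑ n ∈ Ioc (2^i) (2^(i+1)), LA (K+1) n * (sg s n * w n)| := by
  obtain ⟨γ, g1, g2⟩ := exists_between (show ν0 < min (1/2) (1-δ0) from lt_min h2 (by linarith))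
  have g3 := g2.trans_le (min_le_left _ _)
  have g4 := g2.trans_le (min_le_right _ _)
  obtain ⟨β, b1, b2⟩ := exists_between (show γ < min (1-γ) (1-δ0) from lt_min (by linarith) (by linarith))
  have b3 := b2.trans_le (min_le_left _ _)
  have b4 := b2.trans_le (min_le_right _ _)
  obtain ⟨δ, d1, d2⟩ := exists_between (show δ0 < 1 - β by linarith)
  obtain ⟨i0, i1, hsig⟩ := sig_lower γ β (by linarith) b1
  have hc : 0 < (β-γ)/2 := by linarith
  have hb := ww_bound γ β ((β-γ)/2) i0 hc i1 hsig
  have k1 := ww_BK1 γ β i0 (by linarith) (by linarith) (fun i hi => (hsig i hi).1)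
  have k2 := ww_BK2 γ β δ ((β-γ)/2) i0 (by linarith) (by linarith) (by linarith) hc hsig
  have hb2 : ∀ n, |sg (-1) n * ww γ β i0 n| ≤ 1 + 2/((β-γ)/2) := fun n => by
    rw [abs_mul, sg_abs (Or.inr rfl), one_mul]; exact hb n
  refine ⟨ww γ β i0, 1 + 2/((β-γ)/2), (ν0+γ)/2, (δ0+δ)/2, hb, by linarith, by linarith, by linarith, by linarith,
    BK_PW _ _ _ _ hb (by linarith) (by linarith) k1, BK_PW _ _ _ _ hb2 (by linarith) (by linarith) k2, fun K => ?_⟩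
  obtain ⟨κ, hκ, h⟩ := T_low s hs K γ β (by linarith) (by linarith) (by linarith)
  refine ⟨κ, hκ, ?_⟩
  filter_upwards [h, eventually_ge_atTop i0] with i hi hi0
  refine (hi (hsig i hi0).1).trans ?_
  have e : ∑ n ∈ Ioc (2^i) (2^(i+1)), sg s n * LA (K+1) n * Wi γ β i n = ∑ n ∈ Ioc (2^i) (2^(i+1)), LA (K+1) n * (sg s n * ww γ β i0 n) := by
    refine Finset.sum_congr rfl fun n hn => ?_
    rw [mem_Ioc] at hn
    rw [ww_block γ β i0 hn.1 hn.2, if_neg (by omega)]; ring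
  rw [e]
  refine (le_abs_self _).trans ?_
  rw [abs_mul]
  have : |s| = 1 := by rcases hs with rfl | rfl <;> simp
  rw [this, one_mul]

lemma core2 (ν α : ℝ) (h1 : 0 < ν) (h3 : 0 < α) (h4 : ν + α < 1) :
    ∃ (g : ℕ → ℝ) (G θ1 θ2 : ℝ), (∀ n, |g n| ≤ G) ∧ ν < θ1 ∧ θ1 ≤ 1 ∧ α < θ2 ∧ θ2 ≤ 1 ∧ PW g θ1 ∧
      PW (fun n => sg (-1) n * g n) θ2 ∧ ∀ K : ℕ, ∃ c : ℝ, 0 < c ∧ ∀ᶠ i : ℕ in atTop,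
        c * (2:ℝ)^i * Real.log ((2:ℝ)^i)^K ≤ |∑ n ∈ Ioc (2^i) (2^(i+1)), LA (K+1) n * g n| := by
  rcases lt_or_ge ν (1/2) with h | h
  · obtain ⟨w, G, θ1, θ2, a1, a2, a3, a4, a5, a6, a7, a8⟩ := core ν α 1 (Or.inl rfl) h1 h h3 h4
    simp only [sg_one_left, one_mul] at a8
    exact ⟨w, G, θ1, θ2, a1, a2, a3, a4, a5, a6, a7, a8⟩
  · obtain ⟨w, G, θ1, θ2, a1, a2, a3, a4, a5, a6, a7, a8⟩ := core α ν (-1) (Or.inr rfl) h3 (by linarith) h1 (by linarith)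
    refine ⟨fun n => sg (-1) n * w n, G, θ2, θ1, fun n => ?_, a4, a5, a2, a3, a7, ?_, a8⟩
    · rw [abs_mul, sg_abs (Or.inr rfl), one_mul]; exact a1 n
    · simp only [← mul_assoc, sg_sq (Or.inr rfl), one_mul]; exact a6

lemma PW_mono (g : ℕ → ℝ) (θ θ' : ℝ) (h : θ ≤ θ') (hg : PW g θ') : PW g θ := fun m => by
  obtain ⟨C, hC, h1⟩ := hg m
  exact ⟨C, hC, fun x hx q hq hqx => h1 x hx q hq (hqx.trans (Real.rpow_le_rpow_of_exponent_le hx h))⟩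

lemma PW_sg (θ : ℝ) (hθ0 : 0 ≤ θ) (hθ : θ < 1) : PW (sg (-1)) θ := fun m => by
  obtain ⟨C, hC, h⟩ := L_mult m
  have ht : 0 < 1 - θ := by linarith
  refine ⟨C / (1-θ)^m, by positivity, fun x hx q hq hqx => ?_⟩
  have hq0 : (0:ℝ) < q := by exact_mod_cast hq
  have hx0 : 0 < x := by linarith
  have hL := Real.log_nonneg hx
  have hqx' : (q:ℝ) ≤ x := hqx.trans (by
    calc x^θ ≤ x^(1:ℝ) := Real.rpow_le_rpow_of_exponent_le hx hθ.le
      _ = x := Real.rpow_one x)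
  refine (h x q hq hqx').trans ?_
  have l1 : Real.log q ≤ θ * Real.log x := by
    rw [← Real.log_rpow hx0]; exact Real.log_le_log hq0 hqx
  have l2 : (1-θ) * (1 + Real.log x) ≤ 1 + Real.log (x/q) := by
    rw [Real.log_div hx0.ne' hq0.ne']; linarith
  calc C*(x/q)/(1+Real.log (x/q))^m ≤ C*(x/q)/((1-θ) * (1 + Real.log x))^m := by gcongr
    _ = _ := by rw [mul_pow]; field_simp

lemma Lg_to_log (B : ℝ) (hB : 0 < B) (x : ℝ) (hx : 2 ≤ x) : 1 / (1 + Real.log x)^(⌈B⌉₊) ≤ Real.log x ^ (-B) := by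
  have hL : 0 < Real.log x := Real.log_pos (by linarith)
  rw [Real.rpow_neg hL.le, ← one_div]
  apply one_div_le_one_div_of_le (by positivity)
  calc Real.log x ^ B ≤ (1 + Real.log x)^B := Real.rpow_le_rpow hL.le (by linarith) hB.le
    _ ≤ (1 + Real.log x)^((⌈B⌉₊:ℕ):ℝ) := Real.rpow_le_rpow_of_exponent_le (by linarith) (Nat.le_ceil B)
    _ = _ := Real.rpow_natCast _ _

lemma parity_part (g : ℕ → ℝ) (G r α θ2 : ℝ) (hG : ∀ n, |g n| ≤ G) (hr : 0 ≤ r) (hα : 0 < α) (h1 : α < θ2) (h2 : θ2 ≤ 1) (hα1 : α < 1)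
    (h : PW (fun n => sg (-1) n * g n) θ2) (B : ℝ) (hB : 0 < B) : ∃ C : ℝ, ∀ x : ℝ, 2 ≤ x →
        ∑ d ∈ Finset.Icc 1 ⌊x ^ α⌋₊,
          |∑ n ∈ (Finset.Icc 1 ⌊x⌋₊).filter (fun n => d ∣ n), (ArithmeticFunction.moebius n : ℝ) * (1 + r * g n)|
          ≤ C * x * Real.log x ^ (-B) := by
  obtain ⟨C1, c1, k1⟩ := AV_sqfree (fun n => sg (-1) n * g n) G α θ2 (fun n => by rw [abs_mul, sg_abs (Or.inr rfl), one_mul]; exact hG n) h1 h2 h ⌈B⌉₊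
  obtain ⟨C2, c2, k2⟩ := AV_sqfree (sg (-1)) 1 α ((α+1)/2) (fun n => by rw [sg_abs (Or.inr rfl)]) (by linarith) (by linarith) (PW_sg _ (by linarith) (by linarith)) ⌈B⌉₊
  refine ⟨C2 + r * C1, fun x hx => ?_⟩
  have k1 := k1 x (by linarith)
  have k2 := k2 x (by linarith)
  have hl := Lg_to_log B hB x hx
  calc _ ≤ ∑ d ∈ Finset.Icc 1 ⌊x ^ α⌋₊, (|∑ n ∈ (Finset.Icc 1 ⌊x⌋₊).filter (fun n => d ∣ n), (if Squarefree n then 1 else 0) * sg (-1) n|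
          + r * |∑ n ∈ (Finset.Icc 1 ⌊x⌋₊).filter (fun n => d ∣ n), (if Squarefree n then 1 else 0) * (sg (-1) n * g n)|) := by
        refine Finset.sum_le_sum fun d _ => ?_
        have e : ∑ n ∈ (Finset.Icc 1 ⌊x⌋₊).filter (fun n => d ∣ n), (ArithmeticFunction.moebius n : ℝ) * (1 + r * g n)
          = ∑ n ∈ (Finset.Icc 1 ⌊x⌋₊).filter (fun n => d ∣ n), (if Squarefree n then 1 else 0) * sg (-1) n
            + r * ∑ n ∈ (Finset.Icc 1 ⌊x⌋₊).filter (fun n => d ∣ n), (if Squarefree n then 1 else 0) * (sg (-1) n * g n) := by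
          rw [Finset.mul_sum, ← Finset.sum_add_distrib]
          refine Finset.sum_congr rfl fun n _ => ?_
          rw [moebius_real]; ring
        rw [e]
        refine (abs_add_le _ _).trans (le_of_eq ?_)
        rw [abs_mul, abs_of_nonneg hr]
    _ ≤ C2 * x / (1 + Real.log x)^(⌈B⌉₊) + r * (C1 * x / (1 + Real.log x)^(⌈B⌉₊)) := by
        rw [Finset.sum_add_distrib, ← Finset.mul_sum]
        gcongr
    _ = (C2 + r * C1) * x * (1 / (1 + Real.log x)^(⌈B⌉₊)) := by ring
    _ ≤ _ := by
        have : 0 ≤ x := by linarith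
        gcongr

lemma R_part (g : ℕ → ℝ) (r ν : ℝ) (hr : 0 ≤ r) (hν1 : ν < 1) (h : AV g ν) (B : ℝ) (hB : 0 < B) : ∃ C : ℝ, ∀ x : ℝ, 2 ≤ x →
    ∑ d ∈ Finset.Icc 1 ⌊x ^ ν⌋₊, |(∑ n ∈ (Finset.Icc 1 ⌊x⌋₊).filter (fun n => d ∣ n), (1 + r * g n)) - x / d|
      ≤ C * x * Real.log x ^ (-B) := by
  obtain ⟨C1, c1, k1⟩ := h ⌈B⌉₊
  obtain ⟨C2, c2, k2⟩ := Lg_pow_le_rpow ⌈B⌉₊ (1-ν) (by linarith)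
  refine ⟨C2 + r * C1, fun x hx => ?_⟩
  have k1 := k1 x (by linarith)
  have k2 := k2 x (by linarith)
  have hl := Lg_to_log B hB x hx
  have hx0 : 0 < x := by linarith
  have hL : 0 ≤ Real.log x := Real.log_nonneg (by linarith)
  calc _ ≤ ∑ d ∈ Finset.Icc 1 ⌊x ^ ν⌋₊, (1 + r * |∑ n ∈ (Finset.Icc 1 ⌊x⌋₊).filter (fun n => d ∣ n), g n|) := by
        refine Finset.sum_le_sum fun d hd => ?_
        have hd1 : 0 < d := (mem_Icc.1 hd).1
        have hd0 : (0:ℝ) < d := by exact_mod_cast hd1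
        have e : ∑ n ∈ (Finset.Icc 1 ⌊x⌋₊).filter (fun n => d ∣ n), (1:ℝ) = ⌊x/d⌋₊ := by
          rw [sum_mult _ _ _ hd1, Nat.floor_div_natCast]; simp
        rw [Finset.sum_add_distrib, e, ← Finset.mul_sum, add_sub_right_comm]
        refine (abs_add_le _ _).trans ?_
        rw [abs_mul, abs_of_nonneg hr]
        gcongr
        have a1 := Nat.floor_le (show 0 ≤ x/d by positivity)
        have a2 := Nat.lt_floor_add_one (x/d)
        rw [abs_le]; constructor <;> linarith
    _ ≤ x^ν + r * (C1 * x / (1 + Real.log x)^(⌈B⌉₊)) := by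
        rw [Finset.sum_add_distrib, ← Finset.mul_sum]
        gcongr
        simp
        exact Nat.floor_le (by positivity)
    _ ≤ C2 * x / (1 + Real.log x)^(⌈B⌉₊) + r * (C1 * x / (1 + Real.log x)^(⌈B⌉₊)) := by
        gcongr
        rw [le_div_iff₀ (by positivity)]
        calc x^ν * (1 + Real.log x)^(⌈B⌉₊) ≤ x^ν * (C2 * x^(1-ν)) := by gcongr
          _ = C2 * (x^ν * x^(1-ν)) := by ring
          _ = _ := by rw [← Real.rpow_add hx0]; simp
    _ = (C2 + r * C1) * x * (1 / (1 + Real.log x)^(⌈B⌉₊)) := by ring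
    _ ≤ _ := by gcongr

lemma contra (g : ℕ → ℝ) (r : ℝ) (hr : 0 < r) (K : ℕ) (c : ℝ) (hc : 0 < c)
    (h : ∀ᶠ i : ℕ in atTop, c * (2:ℝ)^i * Real.log ((2:ℝ)^i)^K ≤ |∑ n ∈ Ioc (2^i) (2^(i+1)), LA (K+1) n * g n|)
    (ht : Tendsto (fun x : ℝ => (∑ n ∈ Icc 1 ⌊x⌋₊, (1 + r * g n) * LA (K+1) n) / (((K:ℝ)+1) * x * Real.log x ^ K)) atTop (nhds 1)) : False := by
  have t1 : Tendsto (fun i : ℕ => (2:ℝ)^i) atTop atTop := tendsto_pow_atTop_atTop_of_one_lt (by norm_num)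
  set U : ℕ → ℝ := fun i => ∑ n ∈ Icc 1 (2^i), LA (K+1) n * g n with hU
  have key : ∀ ε : ℝ, 0 < ε → ∀ᶠ i : ℕ in atTop, |U i| ≤ ε * (2:ℝ)^i * Real.log ((2:ℝ)^i)^K := by
    intro ε hε
    set e1 := r * ε / 2 / ((K:ℝ)+1) with he1
    set e2 := r * ε / 2 / (2^K + 1) with he2
    have e10 : 0 < e1 := by positivity
    have e20 : 0 < e2 := by positivity
    obtain ⟨C, hC, hA⟩ := AS_one K e2 e20
    have t2 := (ht.comp t1).eventually (Metric.ball_mem_nhds 1 e10)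
    filter_upwards [t2, t1.eventually_ge_atTop (C/e2), eventually_ge_atTop 2] with i h1 h2 h3
    have hX4 : (4:ℝ) ≤ 2^i := by
      calc (4:ℝ) = 2^2 := by norm_num
        _ ≤ _ := pow_le_pow_right₀ (by norm_num) h3
    have hfl : ⌊(2:ℝ)^i⌋₊ = 2^i := by
      have := Nat.floor_natCast (R := ℝ) (2^i); push_cast at this; exact this
    have hA := hA (2^i) Nat.one_le_two_pow
    rw [Real.dist_eq, Function.comp_apply, hfl] at h1
    push_cast at hA
    set X : ℝ := 2^i
    have hX0 : 0 < X := by linarith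
    have hL1 : 1 ≤ Real.log X := by
      rw [Real.le_log_iff_exp_le hX0]
      have := Real.exp_one_lt_d9; linarith
    set L := Real.log X
    have hLK : 1 ≤ L^K := one_le_pow₀ hL1
    have hLg : (1 + L)^K ≤ 2^K * L^K := by rw [← mul_pow]; exact pow_le_pow_left₀ (by linarith) (by linarith) K
    have e : ∑ n ∈ Icc 1 (2^i), (1 + r * g n) * LA (K+1) n = ∑ n ∈ Icc 1 (2^i), LA (K+1) n + r * U i := by
      rw [hU, Finset.mul_sum, ← Finset.sum_add_distrib]
      exact Finset.sum_congr rfl fun n _ => by ring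
    rw [e] at h1
    set A := ∑ n ∈ Icc 1 (2^i), LA (K+1) n
    have hD : 0 < ((K:ℝ)+1) * X * L^K := by positivity
    have h4 : |A + r * U i - ((K:ℝ)+1) * X * L^K| ≤ e1 * (((K:ℝ)+1) * X * L^K) := by
      rw [div_sub_one hD.ne', abs_div, abs_of_pos hD, div_lt_iff₀ hD] at h1
      exact h1.le
    have h5 : C ≤ e2 * X * L^K := by
      rw [div_le_iff₀ e20] at h2
      calc C ≤ e2 * X * 1 := by linarith
        _ ≤ _ := by gcongr
    have h6 : e2 * X * (1+L)^K ≤ e2 * X * (2^K * L^K) := by gcongr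
    have h7 : |r * U i| ≤ e1 * (((K:ℝ)+1) * X * L^K) + (e2 * X * (2^K * L^K) + e2 * X * L^K) := by
      rw [abs_le] at *
      constructor <;> linarith [h4.1, h4.2, hA.1, hA.2]
    rw [abs_mul, abs_of_pos hr] at h7
    have h8 : e1 * (((K:ℝ)+1) * X * L^K) + (e2 * X * (2^K * L^K) + e2 * X * L^K) = r * (ε * X * L^K) := by
      have a1 : e1 * ((K:ℝ)+1) = r * ε / 2 := by rw [he1]; field_simp
      have a2 : e2 * (2^K+1) = r * ε / 2 := by rw [he2]; field_simp
      linear_combination X * L^K * (a1 + a2)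
    rw [h8] at h7
    exact le_of_mul_le_mul_left h7 hr
  set ε := c / (2 * (2 * 2^K + 1)) with hε
  have hε0 : 0 < ε := by positivity
  have k := key ε hε0
  have k' := (tendsto_add_atTop_nat 1).eventually k
  obtain ⟨i, h1, h2, h3, h4⟩ := (h.and (k.and (k'.and (eventually_ge_atTop 1)))).exists
  have hB : ∑ n ∈ Ioc (2^i) (2^(i+1)), LA (K+1) n * g n = U (i+1) - U i := by
    have e1 : ∀ N : ℕ, Icc 1 N = Ioc 0 N := fun N => by ext; simp [Nat.succ_le_iff]
    simp only [hU]
    rw [e1, e1, eq_sub_iff_add_eq, add_comm, Finset.sum_Ioc_consecutive _ (Nat.zero_le _) (Nat.pow_le_pow_right (by norm_num) (by omega))]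
  rw [hB] at h1
  have hX2 : (2:ℝ) ≤ 2^i := by
    calc (2:ℝ) = 2^1 := by norm_num
      _ ≤ _ := pow_le_pow_right₀ (by norm_num) h4
  rw [pow_succ (2:ℝ) i] at h3
  set X : ℝ := 2^i
  have hL0 : 0 < Real.log X := Real.log_pos (by linarith)
  have hl2 : Real.log (X*2) ≤ 2 * Real.log X := by
    rw [Real.log_mul (by linarith) (by norm_num)]
    have := Real.log_le_log (by norm_num) hX2
    linarith
  have hl20 : 0 ≤ Real.log (X*2) := Real.log_nonneg (by linarith)
  have h5 : |U (i+1)| ≤ ε * (X*2) * (2^K * Real.log X^K) := by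
    refine h3.trans ?_
    rw [← mul_pow]
    gcongr
  have h6 := abs_sub (U (i+1)) (U i)
  have h7 : ε * (X*2) * (2^K * Real.log X^K) + ε * X * Real.log X^K = c/2 * (X * Real.log X^K) := by
    have : ε * (2 * 2^K + 1) = c/2 := by rw [hε]; field_simp
    linear_combination X * Real.log X^K * this
  have h8 : 0 < X * Real.log X^K := by positivity
  nlinarith

/-- Fix `ν ∈ (0,1)` and `α ∈ (0, 1−ν)`.  There exists `(a_n)` with
`0 ≤ a_n ≤ 2` satisfying `R(ν)` and Hooley's averaged parity condition
`∑_{d ≤ x^α} |∑_{n ≤ x, d ∣ n} μ(n) a_n| ≤ C_B x (log x)^{−B}` for every `B > 0`, but such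
that the asymptotic formula `S_k(x) ∼ k x (log x)^{k−1}` fails for every `k ≥ 1`. -/
theorem bombieri_sieve_stmt5 (ν α : ℝ) (hν : ν ∈ Set.Ioo (0 : ℝ) 1)
    (hα : α ∈ Set.Ioo (0 : ℝ) (1 - ν)) :
    ∃ a : ℕ → ℝ, (∀ n, 0 ≤ a n ∧ a n ≤ 2) ∧ Rcond ν a ∧
      (∀ B : ℝ, 0 < B → ∃ C : ℝ, ∀ x : ℝ, 2 ≤ x →
        ∑ d ∈ Finset.Icc 1 ⌊x ^ α⌋₊,
          |∑ n ∈ (Finset.Icc 1 ⌊x⌋₊).filter (fun n => d ∣ n),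
              (ArithmeticFunction.moebius n : ℝ) * a n|
          ≤ C * x * Real.log x ^ (-B)) ∧
      ∀ k : ℕ, 1 ≤ k →
        ¬ Tendsto (fun x : ℝ => Ssum a k x / (k * x * Real.log x ^ (k - 1)))
            atTop (nhds 1) := by
  obtain ⟨ν0, ν1⟩ := hν
  obtain ⟨α0, α1⟩ := hα
  obtain ⟨g, G0, θ1, θ2, a1, a2, a3, a4, a5, a6, a7, a8⟩ := core2 ν α ν0 α0 (by linarith)
  set G := |G0| + 1 with hG
  have hG0 : 0 < G := by positivity
  have hgG : ∀ n, |g n| ≤ G := fun n => (a1 n).trans (by rw [hG]; linarith [le_abs_self G0])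
  have hr : 0 < 1/G := by positivity
  refine ⟨fun n => 1 + 1/G * g n, fun n => ?_, fun B hB => ?_, fun B hB => ?_, fun k hk ht => ?_⟩
  · have h : |1/G * g n| ≤ 1 := by
      rw [abs_mul, abs_of_pos hr, one_div_mul_eq_div, div_le_one hG0]; exact hgG n
    rw [abs_le] at h
    constructor <;> linarith
  · exact R_part g (1/G) ν hr.le ν1 (PW_AV g ν ν1.le (PW_mono g ν θ1 a2.le a6)) B hB
  · exact parity_part g G (1/G) α θ2 hgG hr.le α0 a4 a5 (by linarith) a7 B hB
  · obtain ⟨K, rfl⟩ : ∃ K, k = K + 1 := ⟨k-1, by omega⟩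
    obtain ⟨c, hc, h⟩ := a8 K
    refine contra g (1/G) hr K c hc h ?_
    simp only [Ssum, LA_eq, Nat.add_sub_cancel, Nat.cast_add, Nat.cast_one] at ht
    exact ht
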